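/- arXiv:2302.02355 — 2 statements merged into one kernel-verified Lean document; each statement's English description precedes it below -/
import Mathlib

section
/- Let d ≥ 3 and let Δ be a normal d-pseudomanifold such that g_2(lk_Δ v) ≥ 1 for every vertex v of Δ. If u is a vertex of Δ with g_2(Δ) = g_2(Δ[V(st_Δ u)]), then V(Δ) = V(st_Δ u). -/
/-!
Common definitions: finite abstract simplicial complexes (with vertices in ℕ),
links, f-vectors, g-numbers, reduced simplicial homology over a field (via Betti
numbers of the simplicial chain complex), homology spheres/manifolds, geometric
realization and triangulated spheres/balls, normal pseudomanifolds, and the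
combinatorial operations (bistellar moves, edge contraction/expansion, edge
flips) used in the paper.
-/

noncomputable section

/-- A finite abstract simplicial complex with vertex set contained in `ℕ`:
a finite, downward closed family of finite sets (faces). -/
structure SComplex where
  faces : Finset (Finset ℕ)
  down : ∀ σ ∈ faces, ∀ τ ⊆ σ, τ ∈ faces

namespace SComplex

/-- The vertex set of a complex. -/
def vertexSet (Δ : SComplex) : Finset ℕ := Δ.faces.biUnion id

/-- The link of a face `σ`:
`lk_Δ σ = {γ ∈ Δ : γ ∩ σ = ∅ and γ ∪ σ ∈ Δ}`. -/
def link (Δ : SComplex) (σ : Finset ℕ) : SComplex where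
  faces := Δ.faces.filter fun γ => γ ∩ σ = ∅ ∧ γ ∪ σ ∈ Δ.faces
  down := by
    intro γ hγ τ hτ
    simp only [Finset.mem_filter] at hγ ⊢
    obtain ⟨h1, h2, h3⟩ := hγ
    refine ⟨Δ.down γ h1 τ hτ, ?_,
      Δ.down _ h3 _ (Finset.union_subset_union hτ (Finset.Subset.refl σ))⟩
    have h4 : τ ∩ σ ⊆ γ ∩ σ := Finset.inter_subset_inter hτ (Finset.Subset.refl σ)
    rw [h2] at h4
    exact Finset.subset_empty.mp h4

/-- The induced subcomplex on a set `W` of vertices. -/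
def induced (Δ : SComplex) (W : Finset ℕ) : SComplex where
  faces := Δ.faces.filter fun σ => σ ⊆ W
  down := by
    intro σ hσ τ hτ
    simp only [Finset.mem_filter] at hσ ⊢
    exact ⟨Δ.down σ hσ.1 τ hτ, hτ.trans hσ.2⟩

/-- `fVec Δ i = f_i(Δ)`, the number of `i`-dimensional faces. -/
def fVec (Δ : SComplex) (i : ℕ) : ℕ := (Δ.faces.filter fun σ => σ.card = i + 1).card

/-- `g₂` of a pure `d`-dimensional complex: `g₂ = f₁ - (d+1)·f₀ + C(d+2, 2)`. -/
def g2 (Δ : SComplex) (d : ℕ) : ℤ :=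
  (Δ.fVec 1 : ℤ) - ((d : ℤ) + 1) * (Δ.fVec 0 : ℤ) + (Nat.choose (d + 2) 2 : ℤ)

/-- `g₃` of a pure `d`-dimensional complex:
`g₃ = f₂ - d·f₁ + C(d+1,2)·f₀ - C(d+2,3)`. -/
def g3 (Δ : SComplex) (d : ℕ) : ℤ :=
  (Δ.fVec 2 : ℤ) - (d : ℤ) * (Δ.fVec 1 : ℤ) + (Nat.choose (d + 1) 2 : ℤ) * (Δ.fVec 0 : ℤ)
    - (Nat.choose (d + 2) 3 : ℤ)

/-- A complex is pure of dimension `d` if every face is contained in a face with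
`d+1` vertices and no face has more than `d+1` vertices. -/
def IsPure (Δ : SComplex) (d : ℕ) : Prop :=
  (∀ σ ∈ Δ.faces, σ.card ≤ d + 1) ∧
  ∀ σ ∈ Δ.faces, ∃ τ ∈ Δ.faces, σ ⊆ τ ∧ τ.card = d + 1

/-- `σ` is a missing face of `Δ`: its boundary is in `Δ` but `σ` is not. -/
def IsMissing (Δ : SComplex) (σ : Finset ℕ) : Prop :=
  σ ∉ Δ.faces ∧ ∀ τ ⊂ σ, τ ∈ Δ.faces

/-- A pure `d`-dimensional complex is prime if it has no missing facets
(missing faces with `d+1` vertices). -/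
def IsPrime (Δ : SComplex) (d : ℕ) : Prop :=
  ∀ σ : Finset ℕ, σ.card = d + 1 → ¬ Δ.IsMissing σ

/-- The faces of `Δ` with exactly `n` vertices. -/
def facesOfCard (Δ : SComplex) (n : ℕ) : Finset (Finset ℕ) :=
  Δ.faces.filter fun σ => σ.card = n

/-- The matrix of the simplicial boundary map from chains spanned by faces with
`n+1` vertices to chains spanned by faces with `n` vertices, with the standard
signs coming from the natural order on the vertices. -/
def bdryMat (F : Type*) [Field F] (Δ : SComplex) (n : ℕ) :
    Matrix ↥(Δ.facesOfCard n) ↥(Δ.facesOfCard (n + 1)) F := fun τ σ =>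
  if (τ : Finset ℕ) ⊆ (σ : Finset ℕ) then
    ∑ v ∈ (σ : Finset ℕ) \ (τ : Finset ℕ),
      (-1 : F) ^ (((σ : Finset ℕ).filter fun x => x < v).card)
  else 0

/-- The simplicial boundary map (as a linear map) of the reduced simplicial chain
complex of `Δ` over `F`; chains in level `n` are spanned by the faces with `n`
vertices (so the empty face spans the level-0 part, giving the *reduced*
chain complex). -/
def bdry (F : Type*) [Field F] (Δ : SComplex) (n : ℕ) :
    (↥(Δ.facesOfCard (n + 1)) → F) →ₗ[F] ↥(Δ.facesOfCard n) → F :=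
  (Δ.bdryMat F n).mulVecLin

/-- `betti F Δ n` is the reduced Betti number `b̃_{n-1}(Δ; F)`: the dimension of
the reduced simplicial homology of `Δ` over `F` in degree `n - 1` (chains in
level `n` are spanned by the faces with `n` vertices). -/
def betti (F : Type*) [Field F] (Δ : SComplex) : ℕ → ℕ
  | 0 => (Δ.facesOfCard 0).card - Module.finrank F ↥(LinearMap.range (Δ.bdry F 0))
  | n + 1 =>
      Module.finrank F ↥(LinearMap.ker (Δ.bdry F n)) -
        Module.finrank F ↥(LinearMap.range (Δ.bdry F (n + 1)))

/-- `Δ` has the same reduced homology over `F` as the sphere `S^m`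
(`m : ℤ`, possibly `-1`): all reduced Betti numbers vanish except in degree `m`,
where the Betti number is `1`. -/
def SameHomologyAsSphere (F : Type*) [Field F] (Δ : SComplex) (m : ℤ) : Prop :=
  ∀ n : ℕ, (Δ.betti F n : ℤ) = if (n : ℤ) = m + 1 then 1 else 0

/-- `Δ` is an `F`-homology `d`-sphere: for every face `σ` (including the empty
face), the link of `σ` has the same reduced homology over `F` as the sphere of
dimension `d - |σ|`. -/
def IsHomologySphere (F : Type*) [Field F] (Δ : SComplex) (d : ℤ) : Prop :=
  Δ.faces.Nonempty ∧
  ∀ σ ∈ Δ.faces, (Δ.link σ).SameHomologyAsSphere F (d - (σ.card : ℤ))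

/-- `Δ` is an `F`-homology `d`-manifold: it is pure of dimension `d` and the link
of every vertex is an `F`-homology `(d-1)`-sphere. -/
def IsHomologyManifold (F : Type*) [Field F] (Δ : SComplex) (d : ℕ) : Prop :=
  Δ.IsPure d ∧ ∀ v ∈ Δ.vertexSet, (Δ.link {v}).IsHomologySphere F ((d : ℤ) - 1)

/-- The geometric realization of `Δ`: convex combinations of vertices supported
on faces of `Δ`, inside `ℕ → ℝ`. -/
def realization (Δ : SComplex) : Set (ℕ → ℝ) :=
  {f | ∃ σ ∈ Δ.faces, (∀ v, v ∉ σ → f v = 0) ∧ (∀ v, 0 ≤ f v) ∧ ∑ v ∈ σ, f v = 1}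

/-- `Δ` is a triangulated `d`-sphere: its geometric realization is homeomorphic
to the unit sphere in `ℝ^{d+1}`. -/
def IsTriangulatedSphere (Δ : SComplex) (d : ℕ) : Prop :=
  Nonempty (↥Δ.realization ≃ₜ ↥(Metric.sphere (0 : EuclideanSpace ℝ (Fin (d + 1))) 1))

/-- `Δ` is a triangulated `d`-ball: its geometric realization is homeomorphic
to the closed unit ball in `ℝ^d`. -/
def IsTriangulatedBall (Δ : SComplex) (d : ℕ) : Prop :=
  Nonempty (↥Δ.realization ≃ₜ ↥(Metric.closedBall (0 : EuclideanSpace ℝ (Fin d)) 1))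

/-- Two vertices are related if they span an edge of `Δ`. -/
def EdgeRel (Δ : SComplex) (x y : ℕ) : Prop :=
  x ≠ y ∧ ({x, y} : Finset ℕ) ∈ Δ.faces

/-- `Δ` is connected: it has a vertex, and any two vertices are joined by a path
of edges. -/
def IsConnectedC (Δ : SComplex) : Prop :=
  Δ.vertexSet.Nonempty ∧
  ∀ x ∈ Δ.vertexSet, ∀ y ∈ Δ.vertexSet, Relation.ReflTransGen Δ.EdgeRel x y

/-- Two facets of a pure `d`-complex are adjacent if they share a ridge. -/
def FacetAdj (Δ : SComplex) (d : ℕ) (σ τ : Finset ℕ) : Prop :=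
  σ ∈ Δ.faces ∧ τ ∈ Δ.faces ∧ σ.card = d + 1 ∧ τ.card = d + 1 ∧ (σ ∩ τ).card = d

/-- `Δ` is strongly connected: any two facets are joined by a chain of facets in
which consecutive facets share a ridge. -/
def StronglyConnected (Δ : SComplex) (d : ℕ) : Prop :=
  ∀ σ ∈ Δ.faces, ∀ τ ∈ Δ.faces, σ.card = d + 1 → τ.card = d + 1 →
    Relation.ReflTransGen (Δ.FacetAdj d) σ τ

/-- `Δ` is a normal `d`-pseudomanifold: pure, strongly connected, every
`(d-1)`-face lies in exactly two facets, and the link of every face of dimension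
at most `d-2` is connected. -/
def IsNormalPseudomanifold (Δ : SComplex) (d : ℕ) : Prop :=
  Δ.IsPure d ∧ Δ.StronglyConnected d ∧
  (∀ σ ∈ Δ.faces, σ.card = d →
    (Δ.faces.filter fun τ => σ ⊆ τ ∧ τ.card = d + 1).card = 2) ∧
  ∀ σ ∈ Δ.faces, σ.card + 1 ≤ d → IsConnectedC (Δ.link σ)

/-- The face set of the join of two (vertex-disjoint) complexes, given by their
face sets: all unions `σ ∪ τ`. -/
def joinFaces (A B : Finset (Finset ℕ)) : Finset (Finset ℕ) :=
  (A ×ˢ B).image fun p => p.1 ∪ p.2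

/-- The face set of the boundary complex `∂σ` of a simplex `σ`:
all proper subsets of `σ`. -/
def bdryFaces (σ : Finset ℕ) : Finset (Finset ℕ) := σ.powerset.erase σ

/-- `C` is an `n`-cycle: a connected pure 1-dimensional complex on `n ≥ 3`
vertices in which every vertex has exactly two neighbours. -/
def IsCycle (C : SComplex) (n : ℕ) : Prop :=
  3 ≤ n ∧ C.vertexSet.card = n ∧ C.IsPure 1 ∧ IsConnectedC C ∧
  ∀ v ∈ C.vertexSet, ((C.link {v}).vertexSet).card = 2

/-- The vertex set of the closed star of the vertex `u`. -/
def closedStarVerts (Δ : SComplex) (u : ℕ) : Finset ℕ :=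
  insert u (Δ.link {u}).vertexSet

/-- The degree of a vertex: `d(u) = f₀(lk_Δ u)`. -/
def degree (Δ : SComplex) (u : ℕ) : ℕ := (Δ.link {u}).fVec 0

/-- `Δ'` is obtained from `Δ` by a bistellar `i`-move in dimension `d`: for a
`(d-i)`-face `σ` with `lk_Δ σ = ∂τ`, where `τ` is an `i`-simplex not in `Δ`,
replace `σ ⋆ ∂τ` by `τ ⋆ ∂σ`. -/
def BistellarMove (d i : ℕ) (Δ Δ' : SComplex) : Prop :=
  ∃ σ τ : Finset ℕ, σ ∈ Δ.faces ∧ σ.card = d - i + 1 ∧ τ.card = i + 1 ∧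
    τ ∉ Δ.faces ∧ (Δ.link σ).faces = bdryFaces τ ∧
    Δ'.faces = (Δ.faces.filter fun α => ¬ σ ⊆ α) ∪ joinFaces τ.powerset (bdryFaces σ)

/-- `Δ'` is obtained from the `d`-dimensional complex `Δ` by contracting an edge
`uv` satisfying the link condition (with one of the two vertex links a
triangulated `(d-1)`-sphere), identifying `v` with `u`. -/
def EdgeContraction (d : ℕ) (Δ Δ' : SComplex) : Prop :=
  ∃ u v : ℕ, u ≠ v ∧ ({u, v} : Finset ℕ) ∈ Δ.faces ∧
    ((Δ.link {u}).IsTriangulatedSphere (d - 1) ∨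
      (Δ.link {v}).IsTriangulatedSphere (d - 1)) ∧
    (Δ.link {u}).faces ∩ (Δ.link {v}).faces = (Δ.link ({u, v} : Finset ℕ)).faces ∧
    Δ'.faces = Δ.faces.image fun σ => σ.image fun x => if x = v then u else x

/-- `Δ'` is obtained from the normal 4-pseudomanifold `Δ` by an edge expansion:
for a vertex `w` and a triangulated 2-sphere `S` separating `lk_Δ w` into a
triangulated 3-ball `D₁` and a complex `D₂` with common boundary `S`,
`Δ' = (Δ \ st_Δ w) ∪ (uv ⋆ S) ∪ (u ⋆ D₁) ∪ (v ⋆ D₂)` with `u`, `v` new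
vertices. -/
def EdgeExpansion (Δ Δ' : SComplex) : Prop :=
  ∃ w u v : ℕ, ∃ S D₁ D₂ : SComplex,
    ({w} : Finset ℕ) ∈ Δ.faces ∧ u ≠ v ∧ u ∉ Δ.vertexSet ∧ v ∉ Δ.vertexSet ∧
    S.IsTriangulatedSphere 2 ∧ D₁.IsTriangulatedBall 3 ∧
    D₁.faces ∪ D₂.faces = (Δ.link {w}).faces ∧
    D₁.faces ∩ D₂.faces = S.faces ∧
    Δ'.faces = (Δ.faces.filter fun σ => w ∉ σ) ∪
      joinFaces ({u, v} : Finset ℕ).powerset S.faces ∪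
      joinFaces ({u} : Finset ℕ).powerset D₁.faces ∪
      joinFaces ({v} : Finset ℕ).powerset D₂.faces

/-- `Δ'` is obtained from the normal 4-pseudomanifold `Δ` by flipping an edge
`ab` with `lk_Δ ab = ∂(cd) ⋆ ∂(xyz)` (where `cd` is a missing edge of `Δ`) by
`cd`: replace `ab ⋆ ∂(cd) ⋆ ∂(xyz)` by `∂(ab) ⋆ cd ⋆ ∂(xyz)`. -/
def EdgeFlip (Δ Δ' : SComplex) : Prop :=
  ∃ a b c d x y z : ℕ,
    ({a, b} : Finset ℕ).card = 2 ∧ ({c, d} : Finset ℕ).card = 2 ∧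
    ({x, y, z} : Finset ℕ).card = 3 ∧
    ({a, b} : Finset ℕ) ∈ Δ.faces ∧ Δ.IsMissing {c, d} ∧
    (Δ.link ({a, b} : Finset ℕ)).faces =
      joinFaces (bdryFaces {c, d}) (bdryFaces {x, y, z}) ∧
    Δ'.faces = (Δ.faces.filter fun α => ¬ ({a, b} : Finset ℕ) ⊆ α) ∪
      joinFaces (joinFaces (bdryFaces {a, b}) (({c, d} : Finset ℕ).powerset))
        (bdryFaces {x, y, z})

/-- Operation (i) on 4-dimensional complexes: `Δ` is obtained from `Δ'` by a
bistellar 1-move followed by an edge contraction. -/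
def Op1 (Δ' Δ : SComplex) : Prop :=
  ∃ M : SComplex, BistellarMove 4 1 Δ' M ∧ EdgeContraction 4 M Δ

/-- Operation (ii) on 4-dimensional complexes: `Δ` is obtained from `Δ'` by an
edge expansion together with finitely many (possibly zero) edge flippings or
bistellar 2-moves. -/
def Op2 (Δ' Δ : SComplex) : Prop :=
  ∃ M : SComplex, EdgeExpansion Δ' M ∧
    Relation.ReflTransGen (fun X Y => EdgeFlip X Y ∨ BistellarMove 4 2 X Y) M Δ

/-- Membership in the class `H_α`: prime `F`-homology 4-manifolds with
`g₂ = α` all of whose vertex links are prime. -/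
def MemH (F : Type*) [Field F] (Δ : SComplex) (α : ℕ) : Prop :=
  Δ.IsHomologyManifold F 4 ∧ Δ.g2 4 = (α : ℤ) ∧ Δ.IsPrime 4 ∧
    ∀ v ∈ Δ.vertexSet, (Δ.link {v}).IsPrime 3

/-- Property (*): whenever the link of a vertex `u` is `C ⋆ ∂(pqc)` for a cycle
`C` and a 2-simplex `pqc`, the triangle `pqc` is a face of `Δ` and every vertex
of `C` is incident to at least one diagonal edge (an edge of `Δ` joining two
vertices of `C` that are not adjacent in `C`). -/
def PropertyStar (Δ : SComplex) : Prop :=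
  ∀ (u : ℕ) (C : SComplex) (p q c : ℕ) (n : ℕ),
    ({u} : Finset ℕ) ∈ Δ.faces → IsCycle C n → ({p, q, c} : Finset ℕ).card = 3 →
    (Δ.link {u}).faces = joinFaces C.faces (bdryFaces {p, q, c}) →
    ({p, q, c} : Finset ℕ) ∈ Δ.faces ∧
      ∀ x ∈ C.vertexSet, ∃ y ∈ C.vertexSet,
        x ≠ y ∧ ({x, y} : Finset ℕ) ∉ C.faces ∧ ({x, y} : Finset ℕ) ∈ Δ.faces

/-- `Δ` is an octahedral 3-sphere:
`Δ = ∂(a₁b₁) ⋆ ∂(a₂b₂) ⋆ ∂(a₃b₃) ⋆ ∂(a₄b₄)`. -/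
def IsOctahedral3Sphere (Δ : SComplex) : Prop :=
  ∃ a₁ b₁ a₂ b₂ a₃ b₃ a₄ b₄ : ℕ,
    ({a₁, b₁, a₂, b₂, a₃, b₃, a₄, b₄} : Finset ℕ).card = 8 ∧
    Δ.faces = joinFaces (joinFaces (bdryFaces {a₁, b₁}) (bdryFaces {a₂, b₂}))
      (joinFaces (bdryFaces {a₃, b₃}) (bdryFaces {a₄, b₄}))

end SComplex

namespace S6
open SComplex Finset

/-- Normal pseudomanifold without the (derivable) strong connectivity. -/
structure NPM (Δ : SComplex) (d : ℕ) : Prop where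
  pure : Δ.IsPure d
  two : ∀ σ ∈ Δ.faces, σ.card = d →
    (Δ.faces.filter fun τ => σ ⊆ τ ∧ τ.card = d + 1).card = 2
  conn : ∀ σ ∈ Δ.faces, σ.card + 1 ≤ d → IsConnectedC (Δ.link σ)

theorem mem_vert {Δ : SComplex} {x : ℕ} : x ∈ Δ.vertexSet ↔ ({x} : Finset ℕ) ∈ Δ.faces := by
  unfold vertexSet
  simp only [mem_biUnion, id]
  constructor
  · rintro ⟨σ, h, hx⟩
    exact Δ.down σ h _ (by simpa using hx)
  · intro h
    exact ⟨_, h, by simp⟩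

theorem sub_vert {Δ : SComplex} {σ : Finset ℕ} (h : σ ∈ Δ.faces) : σ ⊆ Δ.vertexSet := by
  intro x hx
  exact mem_vert.2 (Δ.down σ h _ (by simpa using hx))

theorem mem_link1 {Δ : SComplex} {v : ℕ} {γ : Finset ℕ} :
    γ ∈ (Δ.link {v}).faces ↔ v ∉ γ ∧ insert v γ ∈ Δ.faces := by
  unfold link
  simp only [mem_filter]
  have h2 : γ ∪ {v} = insert v γ := by rw [union_comm, insert_eq]
  have h1 : γ ∩ {v} = ∅ ↔ v ∉ γ := by
    rw [← disjoint_iff_inter_eq_empty]; simp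
  rw [h1, h2]
  constructor
  · tauto
  · rintro ⟨h, h'⟩
    exact ⟨Δ.down _ h' _ (subset_insert _ _), h, h'⟩

theorem mem_link {Δ : SComplex} {σ γ : Finset ℕ} :
    γ ∈ (Δ.link σ).faces ↔ γ ∈ Δ.faces ∧ γ ∩ σ = ∅ ∧ γ ∪ σ ∈ Δ.faces := by
  unfold link; simp only [mem_filter]

theorem SComplex_ext {Δ Γ : SComplex} (h : ∀ σ, σ ∈ Δ.faces ↔ σ ∈ Γ.faces) : Δ = Γ := by
  cases Δ; cases Γ; simp only [SComplex.mk.injEq]; ext σ; exact h σ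

theorem link_link {Δ : SComplex} {v : ℕ} {σ : Finset ℕ} (hσ : σ ∈ (Δ.link {v}).faces) :
    (Δ.link {v}).link σ = Δ.link (insert v σ) := by
  apply SComplex_ext
  intro γ
  rw [mem_link, mem_link1, mem_link1, mem_link, ← disjoint_iff_inter_eq_empty, ← disjoint_iff_inter_eq_empty,
    disjoint_insert_right, union_insert]
  rw [mem_link1] at hσ
  constructor
  · rintro ⟨⟨h1, h2⟩, h3, h4, h5⟩
    exact ⟨Δ.down _ h2 _ (subset_insert _ _), ⟨h1, h3⟩, h5⟩
  · rintro ⟨h1, ⟨h2, h3⟩, h4⟩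
    refine ⟨⟨h2, Δ.down _ h4 _ (insert_subset_insert _ subset_union_left)⟩, h3, ?_, h4⟩
    simp [h2, hσ.1]

theorem link_pure {Δ : SComplex} {d v : ℕ} (h : Δ.IsPure (d + 1)) : (Δ.link {v}).IsPure d := by
  constructor
  · intro σ hσ
    rw [mem_link1] at hσ
    have := h.1 _ hσ.2
    rw [card_insert_of_notMem hσ.1] at this
    omega
  · intro σ hσ
    rw [mem_link1] at hσ
    obtain ⟨τ, hτ, hs, hc⟩ := h.2 _ hσ.2
    have hv : v ∈ τ := hs (mem_insert_self _ _)
    refine ⟨τ.erase v, mem_link1.2 ⟨by simp, by rwa [insert_erase hv]⟩, ?_, ?_⟩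
    · intro x hx
      refine mem_erase.2 ⟨?_, hs (mem_insert_of_mem hx)⟩
      rintro rfl; exact hσ.1 hx
    · rw [card_erase_of_mem hv]; omega

theorem link_conn {Δ : SComplex} {d v : ℕ}
    (h : ∀ σ ∈ Δ.faces, σ.card + 1 ≤ d + 1 → IsConnectedC (Δ.link σ)) :
    ∀ σ ∈ (Δ.link {v}).faces, σ.card + 1 ≤ d → IsConnectedC ((Δ.link {v}).link σ) := by
  intro σ hσ hc
  rw [link_link hσ]
  rw [mem_link1] at hσ
  apply h _ hσ.2
  rw [card_insert_of_notMem hσ.1]; omega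

theorem link_npm {Δ : SComplex} {d v : ℕ} (h : NPM Δ (d + 1)) : NPM (Δ.link {v}) d := by
  refine ⟨link_pure h.pure, ?_, link_conn h.conn⟩
  intro σ hσ hc
  rw [mem_link1] at hσ
  rw [← h.two _ hσ.2 (by rw [card_insert_of_notMem hσ.1, hc])]
  apply card_bij (fun τ _ => insert v τ)
  · intro τ hτ
    simp only [mem_filter, mem_link1] at hτ ⊢
    exact ⟨hτ.1.2, insert_subset_insert _ hτ.2.1, by rw [card_insert_of_notMem hτ.1.1, hτ.2.2]⟩
  · intro a ha b hb hab
    simp only [mem_filter, mem_link1] at ha hb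
    rw [← erase_insert ha.1.1, hab, erase_insert hb.1.1]
  · intro τ hτ
    simp only [mem_filter] at hτ
    have hv : v ∈ τ := hτ.2.1 (mem_insert_self _ _)
    refine ⟨τ.erase v, ?_, insert_erase hv⟩
    simp only [mem_filter, mem_link1]
    refine ⟨⟨by simp, by rw [insert_erase hv]; exact hτ.1⟩, ?_, ?_⟩
    · intro x hx
      refine mem_erase.2 ⟨?_, hτ.2.1 (mem_insert_of_mem hx)⟩
      rintro rfl; exact hσ.1 hx
    · rw [card_erase_of_mem hv]; omega

theorem link_empty (Δ : SComplex) : Δ.link ∅ = Δ := by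
  apply SComplex_ext
  intro γ
  unfold link
  simp

/-- A property of facets that propagates through ridges holds for all facets. -/
theorem strong_conn (d : ℕ) : ∀ (Δ : SComplex), Δ.IsPure d →
    (∀ σ ∈ Δ.faces, σ.card + 1 ≤ d → IsConnectedC (Δ.link σ)) →
    ∀ P : Finset ℕ → Prop,
    (∀ F ∈ Δ.faces, ∀ F' ∈ Δ.faces, F.card = d + 1 → F'.card = d + 1 → (F ∩ F').card = d →
      P F → P F') →
    ∀ F ∈ Δ.faces, ∀ F' ∈ Δ.faces, F.card = d + 1 → F'.card = d + 1 → P F → P F' := by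
  induction d with
  | zero =>
    intro Δ _ _ P hP F hF F' hF' hc hc' h
    obtain ⟨x, rfl⟩ := card_eq_one.1 hc
    obtain ⟨y, rfl⟩ := card_eq_one.1 hc'
    by_cases hxy : x = y
    · rwa [← hxy]
    · exact hP _ hF _ hF' hc hc' (by simp [hxy]) h
  | succ d ih =>
    intro Δ hp hconn P hP F hF F' hF' hc hc' h
    -- all facets of the star of a vertex
    have star : ∀ x, ∀ F ∈ Δ.faces, ∀ F' ∈ Δ.faces, F.card = d + 2 → F'.card = d + 2 →
        x ∈ F → x ∈ F' → P F → P F' := by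
      intro x F hF F' hF' hc hc' hx hx' h
      have := ih (Δ.link {x}) (link_pure hp) (link_conn hconn) (fun G => P (insert x G)) ?_
        (F.erase x) (mem_link1.2 ⟨by simp, by rwa [insert_erase hx]⟩)
        (F'.erase x) (mem_link1.2 ⟨by simp, by rwa [insert_erase hx']⟩)
        (by rw [card_erase_of_mem hx]; omega) (by rw [card_erase_of_mem hx']; omega)
        (by simpa only [insert_erase hx] using h)
      · simpa only [insert_erase hx'] using this
      · intro G hG G' hG' hc hc' hi hPG
        rw [mem_link1] at hG hG'
        refine hP _ hG.2 _ hG'.2 ?_ ?_ ?_ hPG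
        · rw [card_insert_of_notMem hG.1, hc]
        · rw [card_insert_of_notMem hG'.1, hc']
        · rw [← insert_inter_distrib, card_insert_of_notMem (by simp [hG.1]), hi]
    have hcon := hconn ∅ (Δ.down _ hF _ (empty_subset _)) (by simp)
    rw [link_empty] at hcon
    obtain ⟨x, hx⟩ : F.Nonempty := card_pos.1 (by omega)
    obtain ⟨y, hy⟩ : F'.Nonempty := card_pos.1 (by omega)
    have hpath := hcon.2 x (sub_vert hF hx) y (sub_vert hF' hy)
    have key : ∀ G ∈ Δ.faces, G.card = d + 2 → y ∈ G → P G := by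
      clear hy
      induction hpath with
      | refl => intro G hG hGc hxG; exact star x F hF G hG hc hGc hx hxG h
      | tail _ hyz ih2 =>
        rename_i b c _
        intro G hG hGc hcG
        obtain ⟨τ, hτ, hs, hτc⟩ := hp.2 _ hyz.2
        have hPτ := ih2 τ hτ hτc (hs (by simp))
        exact star c τ hτ G hG hτc hGc (hs (by simp)) hcG hPτ
    exact key F' hF' hc' hy

/-- Crossing ridge. -/
theorem boundary {Δ : SComplex} {d : ℕ} (h : NPM Δ d) {W F : Finset ℕ}
    (hF : F ∈ Δ.faces) (hFc : F.card = d + 1) (hFW : F ⊆ W) (hW : ¬ Δ.vertexSet ⊆ W) :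
    ∃ σ : Finset ℕ, ∃ w v : ℕ, σ.card = d ∧ σ ⊆ W ∧ w ∈ W ∧ v ∉ W ∧ w ∉ σ ∧ v ∉ σ ∧
      insert w σ ∈ Δ.faces ∧ insert v σ ∈ Δ.faces := by
  by_contra hcon
  apply hW
  intro x hx
  rw [mem_vert] at hx
  obtain ⟨G, hG, hxG, hGc⟩ := h.pure.2 _ hx
  refine strong_conn d Δ h.pure h.conn (fun F => F ⊆ W) ?_ F hF G hG hFc hGc hFW (hxG (by simp))
  intro A hA B hB hAc hBc hi hAW
  by_contra hBW
  apply hcon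
  have h1 : (A \ B).card = 1 := by have := card_sdiff_add_card_inter A B; omega
  have h2 : (B \ A).card = 1 := by
    have := card_sdiff_add_card_inter B A; rw [inter_comm] at this; omega
  obtain ⟨w, hw⟩ := card_eq_one.1 h1
  obtain ⟨v, hv⟩ := card_eq_one.1 h2
  have hwm : w ∈ A \ B := by rw [hw]; simp
  have hvm : v ∈ B \ A := by rw [hv]; simp
  rw [mem_sdiff] at hwm hvm
  have eA : insert w (A ∩ B) = A := by
    rw [insert_eq, ← hw, sdiff_union_inter]
  have eB : insert v (A ∩ B) = B := by
    rw [insert_eq, ← hv, inter_comm, sdiff_union_inter]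
  refine ⟨A ∩ B, w, v, hi, inter_subset_left.trans hAW, hAW hwm.1, ?_, ?_, ?_, ?_, ?_⟩
  · intro hvW
    apply hBW
    rw [← eB]
    exact insert_subset hvW (inter_subset_left.trans hAW)
  · simp [hwm]
  · simp [hvm]
  · rwa [eA]
  · rwa [eB]

/-- Neighbours of `y` in the link of the codimension two face `ρ`. -/
def nbr (Δ : SComplex) (ρ : Finset ℕ) (y : ℕ) : Finset ℕ :=
  Δ.vertexSet.filter fun z => z ∉ ρ ∧ z ≠ y ∧ insert z (insert y ρ) ∈ Δ.faces

theorem mem_nbr {Δ : SComplex} {ρ : Finset ℕ} {y z : ℕ} :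
    z ∈ nbr Δ ρ y ↔ z ∉ ρ ∧ z ≠ y ∧ insert z (insert y ρ) ∈ Δ.faces := by
  unfold nbr
  rw [mem_filter]
  constructor
  · tauto
  · intro h
    exact ⟨sub_vert h.2.2 (mem_insert_self _ _), h⟩

theorem card_nbr {Δ : SComplex} {d : ℕ} (h : NPM Δ d) {ρ : Finset ℕ} (hρ : ρ.card + 1 = d)
    {y : ℕ} (hy : y ∉ ρ) (hf : insert y ρ ∈ Δ.faces) : (nbr Δ ρ y).card = 2 := by
  have hc : (insert y ρ).card = d := by rw [card_insert_of_notMem hy, hρ]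
  rw [← h.two _ hf hc]
  apply card_bij (fun z _ => insert z (insert y ρ))
  · intro z hz
    rw [mem_nbr] at hz
    rw [mem_filter]
    refine ⟨hz.2.2, subset_insert _ _, ?_⟩
    rw [card_insert_of_notMem (by simp [hz.1, hz.2.1]), hc]
  · intro a ha b hb hab
    rw [mem_nbr] at ha hb
    have : a ∈ insert b (insert y ρ) := by rw [← hab]; simp
    simp only [mem_insert] at this
    tauto
  · intro τ hτ
    rw [mem_filter] at hτ
    obtain ⟨z, hz⟩ := card_eq_one.1 (show (τ \ insert y ρ).card = 1 by
      rw [card_sdiff_of_subset hτ.2.1]; omega)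
    have hzm : z ∈ τ \ insert y ρ := by rw [hz]; simp
    have e : insert z (insert y ρ) = τ := by
      rw [insert_eq, ← hz, sdiff_union_of_subset hτ.2.1]
    simp only [mem_sdiff, mem_insert, not_or] at hzm
    exact ⟨z, mem_nbr.2 ⟨hzm.2.2, hzm.2.1, by rw [e]; exact hτ.1⟩, e⟩

theorem even_sym (A : Finset ℕ) (N : ℕ → Finset ℕ) (hs : ∀ y z, z ∈ N y → y ∈ N z)
    (hi : ∀ y, y ∉ N y) : Even (∑ y ∈ A, (N y ∩ A).card) := by
  have h1 : ∑ y ∈ A, (N y ∩ A).card = ((A ×ˢ A).filter fun p => p.2 ∈ N p.1).card := by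
    rw [card_filter, sum_product]
    apply sum_congr rfl
    intro y _
    rw [← card_filter]
    congr 1
    ext z
    simp only [mem_inter, mem_filter]
    tauto
  rw [h1]
  rw [← ZMod.natCast_eq_zero_iff_even]
  have : ∑ p ∈ (A ×ˢ A).filter (fun p => p.2 ∈ N p.1), (1 : ZMod 2) = 0 := by
    apply sum_involution (fun p _ => (p.2, p.1))
    · intros; decide
    · rintro ⟨a, b⟩ h _ he
      simp only [mem_filter, Prod.mk.injEq] at h he
      rw [he.1] at h
      exact hi _ h.2
    · rintro ⟨a, b⟩ h
      simp only [mem_filter, mem_product] at h ⊢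
      exact ⟨⟨h.1.2, h.1.1⟩, hs _ _ h.2⟩
    · intros; rfl
  simpa using this

theorem parity {Δ : SComplex} {d : ℕ} (h : NPM Δ d) {ρ A : Finset ℕ} {x v w : ℕ}
    (hρ : ρ.card + 1 = d) (hx : x ∉ ρ) (hxA : x ∉ A) (hv : v ∈ A) (hw : w ∉ A)
    (hvr : v ∉ insert x ρ) (hwr : w ∉ insert x ρ)
    (hvf : insert v (insert x ρ) ∈ Δ.faces) (hwf : insert w (insert x ρ) ∈ Δ.faces) :
    ∃ y ∈ A, ∃ z, z ∉ A ∧ z ≠ x ∧ y ∉ ρ ∧ z ∉ ρ ∧ insert z (insert y ρ) ∈ Δ.faces := by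
  by_contra hcon
  set A' := A.filter (fun y => y ∉ ρ ∧ insert y ρ ∈ Δ.faces) with hA'
  simp only [mem_insert, not_or] at hvr hwr
  have hsym : ∀ y z, y ∉ ρ → z ∈ nbr Δ ρ y → y ∈ nbr Δ ρ z := by
    intro y z hy hz
    rw [mem_nbr] at hz ⊢
    exact ⟨hy, hz.2.1.symm, by rw [insert_comm]; exact hz.2.2⟩
  have hvA' : v ∈ A' := by
    rw [hA', mem_filter]
    refine ⟨hv, hvr.2, Δ.down _ hvf _ (insert_subset_insert _ (subset_insert _ _))⟩
  have hvn : v ∈ nbr Δ ρ x := mem_nbr.2 ⟨hvr.2, hvr.1, hvf⟩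
  have hwn : w ∈ nbr Δ ρ x := mem_nbr.2 ⟨hwr.2, hwr.1, hwf⟩
  have hvw : v ≠ w := by rintro rfl; exact hw hv
  have hnx : nbr Δ ρ x = {v, w} := by
    symm
    apply eq_of_subset_of_card_le
    · intro z hz
      simp only [mem_insert, mem_singleton] at hz
      rcases hz with rfl | rfl <;> assumption
    · rw [card_nbr h hρ hx (Δ.down _ hvf _ (subset_insert _ _)), card_pair hvw]
  have hev : Even (∑ y ∈ A', ((nbr Δ ρ y \ ρ) ∩ A').card) := by
    have := even_sym A' (fun y => if y ∈ ρ then ∅ else nbr Δ ρ y) ?_ ?_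
    · convert this using 2 with y hy
      rw [hA', mem_filter] at hy
      rw [if_neg hy.2.1]
      congr 2
      ext z; simp only [mem_sdiff, mem_nbr]; tauto
    · intro y z hz
      by_cases hy : y ∈ ρ
      · simp [hy] at hz
      · simp only [hy, if_false] at hz
        have hz' := hz
        rw [mem_nbr] at hz'
        simp only [hz'.1, if_false]
        exact hsym _ _ hy hz
    · intro y
      by_cases hy : y ∈ ρ
      · simp [hy]
      · simp [hy, mem_nbr]
  have hone : ∀ y ∈ A', (nbr Δ ρ y).card =
      ((nbr Δ ρ y \ ρ) ∩ A').card + if y = v then 1 else 0 := by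
    intro y hy
    have hy' := hy
    rw [hA', mem_filter] at hy'
    rw [← card_inter_add_card_sdiff (nbr Δ ρ y) A']
    congr 1
    · congr 2
      ext z; simp only [mem_sdiff, mem_nbr]; tauto
    · have hz : ∀ z ∈ nbr Δ ρ y \ A', z = x ∧ y = v := by
        intro z hz
        rw [mem_sdiff] at hz
        have hz2 := mem_nbr.1 hz.1
        have hzx : z = x := by
          by_contra hzx
          apply hcon
          refine ⟨y, hy'.1, z, ?_, hzx, hy'.2.1, hz2.1, hz2.2.2⟩
          intro hzA
          apply hz.2
          rw [hA', mem_filter]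
          exact ⟨hzA, hz2.1, Δ.down _ hz2.2.2 _ (insert_subset_insert _ (subset_insert _ _))⟩
        refine ⟨hzx, ?_⟩
        have := hsym _ _ hy'.2.1 hz.1
        rw [hzx, hnx, mem_insert, mem_singleton] at this
        rcases this with h | h
        · exact h
        · exfalso; rw [h] at hy'; exact hw hy'.1
      by_cases hyv : y = v
      · rw [if_pos hyv]
        rw [card_eq_one]
        refine ⟨x, ?_⟩
        ext z
        rw [mem_singleton]
        constructor
        · intro h; exact (hz z h).1
        · rintro rfl
          rw [mem_sdiff, hyv]
          refine ⟨hsym _ _ hx hvn, ?_⟩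
          rw [hA', mem_filter]; tauto
      · rw [if_neg hyv, card_eq_zero, eq_empty_iff_forall_notMem]
        intro z h; exact hyv (hz z h).2
  have hsum : ∑ y ∈ A', (nbr Δ ρ y).card = 2 * A'.card := by
    rw [sum_congr rfl (g := fun _ => 2)]
    · simp [mul_comm]
    · intro y hy
      rw [hA', mem_filter] at hy
      exact card_nbr h hρ hy.2.1 hy.2.2
  rw [sum_congr rfl hone, sum_add_distrib, sum_ite_eq', if_pos hvA'] at hsum
  obtain ⟨m, hm⟩ := hev
  omega

/-- The number of edges inside `W`. -/
def E (Δ : SComplex) (W : Finset ℕ) : ℕ :=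
  (Δ.faces.filter fun σ => σ.card = 2 ∧ σ ⊆ W).card

theorem E_le_choose (Δ : SComplex) (W : Finset ℕ) : E Δ W ≤ W.card.choose 2 := by
  rw [← card_powersetCard]
  apply card_le_card
  intro σ hσ
  rw [mem_filter] at hσ
  rw [mem_powersetCard]
  tauto

theorem glue (Δ : SComplex) (W : Finset ℕ) (w : ℕ) :
    E Δ W + E (Δ.link {w}) (Δ.link {w}).vertexSet +
      ((Δ.link {w}).vertexSet.filter fun x => w ∈ W → x ∉ W).card +
      (Δ.faces.filter fun σ => σ.card = 2 ∧ σ ⊆ W ∪ insert w (Δ.link {w}).vertexSet ∧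
        ¬ σ ⊆ W ∧ ¬ σ ⊆ insert w (Δ.link {w}).vertexSet).card
    ≤ E Δ (W ∪ insert w (Δ.link {w}).vertexSet) + E (Δ.link {w}) (W ∩ (Δ.link {w}).vertexSet) := by
  set L := Δ.link {w} with hL
  set X1 := Δ.faces.filter fun σ => σ.card = 2 ∧ σ ⊆ W with hX1
  set X2 := L.faces.filter fun σ => σ.card = 2 ∧ ¬ σ ⊆ W with hX2
  set K := L.vertexSet.filter fun x => w ∈ W → x ∉ W with hK
  set X3 := K.image fun x => ({w, x} : Finset ℕ) with hX3
  set X4 := Δ.faces.filter fun σ => σ.card = 2 ∧ σ ⊆ W ∪ insert w L.vertexSet ∧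
        ¬ σ ⊆ W ∧ ¬ σ ⊆ insert w L.vertexSet with hX4
  have hLv : ∀ x, x ∈ L.vertexSet → x ≠ w ∧ ({w, x} : Finset ℕ) ∈ Δ.faces := by
    intro x hx
    rw [mem_vert, hL, mem_link1] at hx
    refine ⟨?_, hx.2⟩
    rintro rfl; simp at hx
  have hcK : X3.card = K.card := by
    apply card_image_of_injOn
    intro a ha b hb hab
    have ha' := hLv a (mem_filter.1 ha).1
    have : a ∈ ({w, b} : Finset ℕ) := by
      have : a ∈ ({w, a} : Finset ℕ) := by simp
      rw [show ({w, a} : Finset ℕ) = {w, b} from hab] at this; exact this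
    simp only [mem_insert, mem_singleton] at this
    tauto
  have hE2 : E L L.vertexSet = E L (W ∩ L.vertexSet) + X2.card := by
    unfold E
    rw [← card_filter_add_card_filter_not (s := L.faces.filter fun σ => σ.card = 2 ∧ σ ⊆ L.vertexSet)
      (fun σ => σ ⊆ W)]
    congr 2
    · ext σ; simp only [mem_filter, subset_inter_iff]; tauto
    · ext σ; simp only [mem_filter, hX2]
      constructor
      · tauto
      · rintro ⟨h1, h2, h3⟩; exact ⟨⟨h1, h2, sub_vert h1⟩, h3⟩
  have hsub : X1 ∪ (X2 ∪ (X3 ∪ X4)) ⊆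
      Δ.faces.filter fun σ => σ.card = 2 ∧ σ ⊆ W ∪ insert w L.vertexSet := by
    intro σ hσ
    rw [mem_filter]
    simp only [mem_union] at hσ
    rcases hσ with h | h | h | h
    · rw [hX1, mem_filter] at h
      exact ⟨h.1, h.2.1, h.2.2.trans subset_union_left⟩
    · rw [hX2, mem_filter] at h
      refine ⟨?_, h.2.1, (sub_vert h.1).trans ((subset_insert _ _).trans subset_union_right)⟩
      have := h.1
      rw [hL, mem_link1] at this
      exact Δ.down _ this.2 _ (subset_insert _ _)
    · rw [hX3, mem_image] at h
      obtain ⟨x, hx, rfl⟩ := h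
      have hx := (mem_filter.1 hx).1
      refine ⟨(hLv x hx).2, card_pair (hLv x hx).1.symm, ?_⟩
      apply Subset.trans _ subset_union_right
      intro y hy
      simp only [mem_insert, mem_singleton] at hy ⊢
      rcases hy with rfl | rfl <;> tauto
    · rw [hX4, mem_filter] at h; tauto
  have hle := card_le_card hsub
  have hX3m : ∀ σ ∈ X3, w ∈ σ ∧ ¬ σ ⊆ W ∧ σ ⊆ insert w L.vertexSet := by
    intro σ h
    rw [hX3, mem_image] at h
    obtain ⟨x, hx, rfl⟩ := h
    have hx2 := mem_filter.1 hx
    refine ⟨by simp, ?_, ?_⟩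
    · intro hs
      exact hx2.2 (hs (by simp)) (hs (by simp))
    · intro y hy
      simp only [mem_insert, mem_singleton] at hy ⊢
      rcases hy with rfl | rfl <;> tauto
  have hX2m : ∀ σ ∈ X2, w ∉ σ ∧ ¬ σ ⊆ W ∧ σ ⊆ insert w L.vertexSet := by
    intro σ h
    rw [hX2, mem_filter] at h
    have := h.1
    rw [hL, mem_link1] at this
    exact ⟨this.1, h.2.2, (sub_vert h.1).trans (subset_insert _ _)⟩
  have hX4m : ∀ σ ∈ X4, ¬ σ ⊆ W ∧ ¬ σ ⊆ insert w L.vertexSet := by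
    intro σ h
    rw [hX4, mem_filter] at h; tauto
  have hX1m : ∀ σ ∈ X1, σ ⊆ W := by
    intro σ h
    rw [hX1, mem_filter] at h; tauto
  rw [card_union_of_disjoint, card_union_of_disjoint, card_union_of_disjoint] at hle
  · have e1 : E Δ W = X1.card := rfl
    have e2 : E Δ (W ∪ insert w L.vertexSet) = (Δ.faces.filter fun σ => σ.card = 2 ∧
      σ ⊆ W ∪ insert w L.vertexSet).card := rfl
    rw [← e2] at hle
    omega
  · rw [disjoint_left]; intro σ h1 h2
    have := hX3m σ h1; have := hX4m σ h2; tauto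
  · rw [disjoint_left]; intro σ h1 h2
    rw [mem_union] at h2
    have := hX2m σ h1
    rcases h2 with h2 | h2
    · have := hX3m σ h2; tauto
    · have := hX4m σ h2; tauto
  · rw [disjoint_left]; intro σ h1 h2
    have := hX1m σ h1
    simp only [mem_union] at h2
    rcases h2 with h2 | h2 | h2
    · have := hX2m σ h2; tauto
    · have := hX3m σ h2; tauto
    · have := hX4m σ h2; tauto


/-- Edges touching `A`. -/
def EA (Δ : SComplex) (A : Finset ℕ) : Finset (Finset ℕ) :=
  Δ.faces.filter fun σ => σ.card = 2 ∧ ∃ a ∈ A, a ∈ σ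

/-- Triangles touching `A`. -/
def TA (Δ : SComplex) (A : Finset ℕ) : Finset (Finset ℕ) :=
  Δ.faces.filter fun σ => σ.card = 3 ∧ ∃ a ∈ A, a ∈ σ

theorem mem_EA {Δ : SComplex} {A σ : Finset ℕ} :
    σ ∈ EA Δ A ↔ σ ∈ Δ.faces ∧ σ.card = 2 ∧ ∃ a ∈ A, a ∈ σ := by
  unfold EA; rw [mem_filter]

theorem mem_TA {Δ : SComplex} {A σ : Finset ℕ} :
    σ ∈ TA Δ A ↔ σ ∈ Δ.faces ∧ σ.card = 3 ∧ ∃ a ∈ A, a ∈ σ := by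
  unfold TA; rw [mem_filter]

theorem two_TA {Δ : SComplex} (h : NPM Δ 2) {A e : Finset ℕ} (he : e ∈ EA Δ A) :
    ((TA Δ A).filter fun t => e ⊆ t).card = 2 := by
  rw [mem_EA] at he
  rw [← h.two e he.1 he.2.1]
  congr 1
  ext t
  simp only [mem_filter, mem_TA]
  constructor
  · tauto
  · rintro ⟨h1, h2, h3⟩
    obtain ⟨a, ha, hae⟩ := he.2.2
    exact ⟨⟨h1, h3, a, ha, h2 hae⟩, h2⟩

theorem edges_at {Δ : SComplex} {A t : Finset ℕ} (ht : t ∈ TA Δ A) {a : ℕ} (ha : a ∈ A) :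
    (((EA Δ A).filter fun e => e ⊆ t ∧ a ∈ e).card : ZMod 2) = 0 := by
  rw [mem_TA] at ht
  by_cases hat : a ∈ t
  · have : (EA Δ A).filter (fun e => e ⊆ t ∧ a ∈ e) =
        (t.erase a).image (fun p => ({a, p} : Finset ℕ)) := by
      ext e
      simp only [mem_filter, mem_image, mem_EA]
      constructor
      · rintro ⟨⟨h1, h2, _⟩, h3, h4⟩
        obtain ⟨p, hp⟩ := card_eq_one.1 (show (e.erase a).card = 1 by
          rw [card_erase_of_mem h4, h2])
        have hpe : p ∈ e.erase a := by rw [hp]; simp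
        refine ⟨p, ?_, ?_⟩
        · exact erase_subset_erase _ h3 hpe
        · rw [← insert_erase h4, hp]
      · rintro ⟨p, hp, rfl⟩
        rw [mem_erase] at hp
        have hs : ({a, p} : Finset ℕ) ⊆ t := by
          intro y hy
          simp only [mem_insert, mem_singleton] at hy
          rcases hy with rfl | rfl
          · exact hat
          · exact hp.2
        exact ⟨⟨Δ.down _ ht.1 _ hs, card_pair hp.1.symm, a, ha, by simp⟩, hs, by simp⟩
    rw [this, card_image_of_injOn, card_erase_of_mem hat, ht.2.1]
    · decide
    · intro p hp q hq hpq
      have hp' := mem_erase.1 (mem_coe.1 hp)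
      have : p ∈ ({a, q} : Finset ℕ) := by
        have hpp : p ∈ ({a, p} : Finset ℕ) := by simp
        rw [show ({a, p} : Finset ℕ) = {a, q} from hpq] at hpp; exact hpp
      simp only [mem_insert, mem_singleton] at this
      tauto
  · have : (EA Δ A).filter (fun e => e ⊆ t ∧ a ∈ e) = ∅ := by
      rw [eq_empty_iff_forall_notMem]
      intro e he
      rw [mem_filter] at he
      exact hat (he.2.1 he.2.2)
    rw [this]; simp

theorem zmod2_eq {x y : ZMod 2} (h : x + y = 0) : x = y := by
  revert x y; decide

theorem euler {Δ : SComplex} (h : NPM Δ 2) {A : Finset ℕ} {v b c : ℕ}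
    (hv : v ∈ A) (hb : b ∉ A) (ht0 : ({v, b, c} : Finset ℕ) ∈ Δ.faces)
    (ht0c : ({v, b, c} : Finset ℕ).card = 3)
    (hreach : ∀ P : ℕ → Prop, P v →
      (∀ x ∈ A, ∀ y ∈ A, x ≠ y → ({x, y} : Finset ℕ) ∈ Δ.faces → P x → P y) → ∀ a ∈ A, P a) :
    A.card + (TA Δ A).card ≤ (EA Δ A).card + 1 := by
  set T := TA Δ A with hT
  set t0 : Finset ℕ := {v, b, c} with ht0d
  have hvt0 : v ∈ t0 := by simp [ht0d]
  have ht0T : t0 ∈ T := by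
    rw [hT, mem_TA]; exact ⟨ht0, ht0c, v, hv, hvt0⟩
  let B : Matrix ↥(T.erase t0) ↥(EA Δ A) (ZMod 2) := fun t e => if e.1 ⊆ t.1 then 1 else 0
  let C : Matrix ↥(EA Δ A) ↥A (ZMod 2) := fun e a => if a.1 ∈ e.1 then 1 else 0
  have hBC : B * C = 0 := by
    ext t a
    rw [Matrix.mul_apply, Matrix.zero_apply]
    have := edges_at (Δ := Δ) (A := A) (mem_of_mem_erase t.2) a.2
    rw [← this, card_filter, Nat.cast_sum]
    rw [← sum_coe_sort (EA Δ A)]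
    apply sum_congr rfl
    intro e _
    simp only [B, C]
    by_cases h1 : e.1 ⊆ t.1 <;> by_cases h2 : a.1 ∈ e.1 <;> simp [h1, h2]
  have hrC : C.rank = A.card := by
    rw [← Matrix.rank_transpose, LinearIndependent.rank_matrix, Fintype.card_coe]
    rw [Fintype.linearIndependent_iff]
    intro g hg
    let z : ℕ → ZMod 2 := fun a => if ha : a ∈ A then g ⟨a, ha⟩ else 0
    have hz : ∀ e ∈ EA Δ A, ∑ a ∈ e, z a = 0 := by
      intro e he
      have h1 := congrFun hg ⟨e, he⟩
      rw [Finset.sum_apply] at h1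
      have h2 : ∑ a ∈ A, (if a ∈ e then z a else 0) = 0 := by
        rw [← sum_coe_sort A]
        refine Eq.trans ?_ (show _ = (0 : ZMod 2) from h1)
        apply sum_congr rfl
        intro a _
        simp [z, C, Matrix.transpose]
      rw [← sum_filter] at h2
      rw [← h2]
      symm
      apply sum_subset
      · intro a ha; rw [mem_filter] at ha; exact ha.2
      · intro a ha hna
        rw [mem_filter] at hna
        have : a ∉ A := by tauto
        simp [z, this]
    have hpair : ∀ x ∈ A, ∀ y, x ≠ y → ({x, y} : Finset ℕ) ∈ Δ.faces → z x = z y := by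
      intro x hx y hxy hf
      have := hz {x, y} (mem_EA.2 ⟨hf, card_pair hxy, x, hx, by simp⟩)
      rw [sum_pair hxy] at this
      exact zmod2_eq this
    have hall : ∀ a ∈ A, z a = 0 := by
      apply hreach
      · rw [hpair v hv b (by rintro rfl; exact hb hv) (Δ.down _ ht0 _ (by
          intro a ha; simp only [ht0d, mem_insert, mem_singleton] at ha ⊢; tauto))]
        simp [z, hb]
      · intro x hx y _ hxy hf hzx
        rw [← hpair x hx y hxy hf, hzx]
    intro a
    have := hall a.1 a.2
    simpa [z] using this
  have hrB : B.rank = (T.erase t0).card := by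
    rw [LinearIndependent.rank_matrix, Fintype.card_coe]
    rw [Fintype.linearIndependent_iff]
    intro g hg
    let Y : Finset ℕ → ZMod 2 := fun t => if ht : t ∈ T.erase t0 then g ⟨t, ht⟩ else 0
    have hY0 : Y t0 = 0 := by simp [Y]
    have hY : ∀ e ∈ EA Δ A, ∑ t ∈ T with e ⊆ t, Y t = 0 := by
      intro e he
      have h1 := congrFun hg ⟨e, he⟩
      rw [Finset.sum_apply] at h1
      have h2 : ∑ t ∈ T.erase t0, (if e ⊆ t then Y t else 0) = 0 := by
        rw [← sum_coe_sort (T.erase t0)]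
        refine Eq.trans ?_ (show _ = (0 : ZMod 2) from h1)
        apply sum_congr rfl
        intro t _
        have := t.2
        simp only [Y, B, Pi.smul_apply, Matrix.row, this, dif_pos, smul_eq_mul]
        split_ifs <;> simp
      rw [sum_erase _ (by simp [hY0])] at h2
      rw [sum_filter]; exact h2
    have hadj : ∀ s ∈ T, ∀ s' ∈ T, (s ∩ s') ∈ EA Δ A → s ≠ s' → Y s = Y s' := by
      intro s hs s' hs' he hne
      have h1 := hY _ he
      have h2 : ({s, s'} : Finset (Finset ℕ)) = T.filter (fun t => s ∩ s' ⊆ t) := by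
        apply eq_of_subset_of_card_le
        · intro r hr
          simp only [mem_insert, mem_singleton] at hr
          rw [mem_filter]
          rcases hr with rfl | rfl
          · exact ⟨hs, inter_subset_left⟩
          · exact ⟨hs', inter_subset_right⟩
        · rw [two_TA h he, card_pair hne]
      rw [← h2, sum_pair hne] at h1
      exact zmod2_eq h1
    have star : ∀ a ∈ A, ∀ s ∈ T, ∀ s' ∈ T, a ∈ s → a ∈ s' → Y s = 0 → Y s' = 0 := by
      intro a ha s hs s' hs' has has' hs0
      rw [hT, mem_TA] at hs hs'
      have := strong_conn 1 (Δ.link {a}) (link_pure h.pure) (link_conn h.conn)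
        (fun G => Y (insert a G) = 0) ?_
        (s.erase a) (mem_link1.2 ⟨by simp, by rw [insert_erase has]; exact hs.1⟩)
        (s'.erase a) (mem_link1.2 ⟨by simp, by rw [insert_erase has']; exact hs'.1⟩)
        (by rw [card_erase_of_mem has]; omega) (by rw [card_erase_of_mem has']; omega)
        (by simpa only [insert_erase has] using hs0)
      · simpa only [insert_erase has'] using this
      · intro G hG G' hG' hc hc' hi hPG
        rw [mem_link1] at hG hG'
        have hin : insert a G ∩ insert a G' = insert a (G ∩ G') := by
          rw [← insert_inter_distrib]
        have hcd : (insert a (G ∩ G')).card = 2 := by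
          rw [card_insert_of_notMem (by simp [hG.1]), hi]
        change Y (insert a G') = 0
        rw [← hadj (insert a G) ?_ (insert a G') ?_ ?_ ?_]
        · exact hPG
        · rw [hT, mem_TA]
          exact ⟨hG.2, by rw [card_insert_of_notMem hG.1, hc], a, ha, by simp⟩
        · rw [hT, mem_TA]
          exact ⟨hG'.2, by rw [card_insert_of_notMem hG'.1, hc'], a, ha, by simp⟩
        · rw [hin, mem_EA]
          exact ⟨Δ.down _ hG.2 _ (insert_subset_insert _ inter_subset_left), hcd, a, ha, by simp⟩
        · intro heq
          rw [heq, inter_self] at hin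
          have h3 : (insert a G').card = 3 := by rw [card_insert_of_notMem hG'.1, hc']
          rw [hin, hcd] at h3
          omega
    have hall : ∀ a ∈ A, ∀ s ∈ T, a ∈ s → Y s = 0 := by
      apply hreach
      · intro s hs hvs
        exact star v hv t0 ht0T s hs hvt0 hvs hY0
      · intro x hx y hy hxy hf hQ s hs hys
        obtain ⟨τ, hτ, hsub, hτc⟩ := h.pure.2 _ hf
        have hτT : τ ∈ T := by
          rw [hT, mem_TA]; exact ⟨hτ, hτc, x, hx, hsub (by simp)⟩
        exact star y hy τ hτT s hs (hsub (by simp)) hys (hQ τ hτT (hsub (by simp)))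
    intro t
    have ht := mem_of_mem_erase t.2
    obtain ⟨_, _, a, ha, hat⟩ := mem_TA.1 (show t.1 ∈ TA Δ A from ht)
    have := hall a ha t.1 ht hat
    simpa [Y, -mem_erase, t.2] using this
  have := Matrix.rank_add_rank_le_card_of_mul_eq_zero hBC
  rw [hrC, hrB, Fintype.card_coe, card_erase_of_mem ht0T] at this
  omega

theorem count {Δ : SComplex} (h : NPM Δ 2) (A : Finset ℕ) :
    2 * (EA Δ A).card + ((TA Δ A).filter fun t => (t ∩ A).card = 1).card ≤ 3 * (TA Δ A).card := by
  have h1 : ∑ e ∈ EA Δ A, ((TA Δ A).filter fun t => e ⊆ t).card =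
      ∑ t ∈ TA Δ A, ((EA Δ A).filter fun e => e ⊆ t).card := by
    simp_rw [card_filter]; exact sum_comm
  rw [sum_congr rfl (fun e he => two_TA h he), sum_const, smul_eq_mul] at h1
  have h2 : ∀ t ∈ TA Δ A, ((EA Δ A).filter fun e => e ⊆ t).card +
      (if (t ∩ A).card = 1 then 1 else 0) ≤ 3 := by
    intro t ht
    rw [mem_TA] at ht
    have hp : (powersetCard 2 t).card = 3 := by rw [card_powersetCard, ht.2.1]; rfl
    have hsub : (EA Δ A).filter (fun e => e ⊆ t) ⊆ powersetCard 2 t := by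
      intro e he
      rw [mem_filter, mem_EA] at he
      rw [mem_powersetCard]; tauto
    split_ifs with hc
    · obtain ⟨a, ha⟩ := card_eq_one.1 hc
      have hat : a ∈ t ∩ A := by rw [ha]; simp
      rw [mem_inter] at hat
      have hm : t.erase a ∈ powersetCard 2 t := by
        rw [mem_powersetCard]
        exact ⟨erase_subset _ _, by rw [card_erase_of_mem hat.1]; omega⟩
      have : (EA Δ A).filter (fun e => e ⊆ t) ⊆ (powersetCard 2 t).erase (t.erase a) := by
        intro e he
        refine mem_erase.2 ⟨?_, hsub he⟩
        rintro rfl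
        rw [mem_filter, mem_EA] at he
        obtain ⟨x, hx, hxt⟩ := he.1.2.2
        rw [mem_erase] at hxt
        have : x ∈ t ∩ A := mem_inter.2 ⟨hxt.2, hx⟩
        rw [ha, mem_singleton] at this
        exact hxt.1 this
      have := card_le_card this
      rw [card_erase_of_mem hm, hp] at this
      omega
    · have := card_le_card hsub; omega
  have h3 := sum_le_sum h2
  rw [sum_add_distrib, ← h1, ← card_filter, sum_const, smul_eq_mul] at h3
  omega

theorem three {Δ : SComplex} (h : NPM Δ 2) {A : Finset ℕ} {v b c w : ℕ}
    (hv : v ∈ A) (hb : b ∉ A) (hc : c ∉ A) (hw : w ∉ A) (hbc : b ≠ c) (hwb : w ≠ b) (hwc : w ≠ c)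
    (ht0 : ({v, b, c} : Finset ℕ) ∈ Δ.faces) (ht1 : ({w, b, c} : Finset ℕ) ∈ Δ.faces) :
    3 ≤ ((TA Δ A).filter fun t => (t ∩ A).card = 1).card := by
  have ne : ∀ {x y}, x ∈ A → y ∉ A → x ≠ y := by
    rintro x y hx hy rfl; exact hy hx
  have hvb := ne hv hb
  have hvc := ne hv hc
  have mem : ∀ y z r, y ∈ A → z ∉ A → r ∉ A → z ≠ r → ({z, y, r} : Finset ℕ) ∈ Δ.faces →
      ({z, y, r} : Finset ℕ) ∈ (TA Δ A).filter fun t => (t ∩ A).card = 1 := by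
    intro y z r hy hz hr hzr hf
    rw [mem_filter, mem_TA]
    refine ⟨⟨hf, ?_, y, hy, by simp⟩, ?_⟩
    · rw [card_eq_three]
      exact ⟨z, y, r, (ne hy hz).symm, hzr, ne hy hr, rfl⟩
    · rw [card_eq_one]
      refine ⟨y, ?_⟩
      ext x
      simp only [mem_inter, mem_insert, mem_singleton]
      constructor
      · rintro ⟨rfl | rfl | rfl, hx⟩ <;> tauto
      · rintro rfl; tauto
  obtain ⟨y, hy, z, hz, hzx, hyr, hzr, hyz⟩ := parity h (ρ := {b}) (A := A) (x := c) (v := v)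
    (w := w) (by simp) (by simpa using hbc.symm) hc hv hw (by simp [hvb, hvc])
    (by simp [hwb, hwc]) (by rwa [pair_comm]) (by rwa [pair_comm])
  obtain ⟨y', hy', z', hz', hzx', hyr', hzr', hyz'⟩ := parity h (ρ := {c}) (A := A) (x := b)
    (v := v) (w := w) (by simp) (by simpa using hbc) hb hv hw (by simp [hvb, hvc])
    (by simp [hwb, hwc]) ht0 ht1
  have m0 := mem v b c hv hb hc hbc (by rwa [insert_comm])
  have m1 := mem y z b hy hz hb (by simpa using hzr) hyz
  have m2 := mem y' z' c hy' hz' hc (by simpa using hzr') hyz'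
  have hc1 : c ∉ ({z, y, b} : Finset ℕ) := by
    simp only [mem_insert, mem_singleton, not_or]
    exact ⟨hzx.symm, (ne hy hc).symm, hbc.symm⟩
  have hb1 : b ∉ ({z', y', c} : Finset ℕ) := by
    simp only [mem_insert, mem_singleton, not_or]
    exact ⟨hzx'.symm, (ne hy' hb).symm, hbc⟩
  have h3 : ({{b, v, c}, {z, y, b}, {z', y', c}} : Finset (Finset ℕ)).card = 3 := by
    rw [card_eq_three]
    refine ⟨_, _, _, ?_, ?_, ?_, rfl⟩
    · intro he; apply hc1; rw [← he]; simp
    · intro he; apply hb1; rw [← he]; simp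
    · intro he; apply hc1; rw [he]; simp
  rw [← h3]
  apply card_le_card
  intro t ht
  simp only [mem_insert, mem_singleton] at ht
  rcases ht with rfl | rfl | rfl <;> assumption

theorem surface {Δ : SComplex} (h : NPM Δ 2) : ∀ (n : ℕ) (W F : Finset ℕ),
    (Δ.vertexSet \ W).card = n → W ⊆ Δ.vertexSet → F ∈ Δ.faces → F.card = 3 → F ⊆ W →
    (E Δ W : ℤ) - 3 * W.card ≤ E Δ Δ.vertexSet - 3 * Δ.vertexSet.card := by
  classical
  intro n
  induction n using Nat.strong_induction_on with
  | _ n ihn =>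
  intro W F hn hWV hF hFc hFW
  by_cases hW : Δ.vertexSet ⊆ W
  · rw [Subset.antisymm hWV hW]
  obtain ⟨σ, w, v, hσc, hσW, hwW, hvW, hwσ, hvσ, hwf, hvf⟩ := boundary h hF hFc hFW hW
  obtain ⟨b, c, hbc, rfl⟩ := card_eq_two.1 hσc
  have hvV : v ∈ Δ.vertexSet := sub_vert hvf (mem_insert_self _ _)
  let R : ℕ → ℕ → Prop := fun x y => y ∉ W ∧ x ≠ y ∧ ({x, y} : Finset ℕ) ∈ Δ.faces
  set A := (Δ.vertexSet \ W).filter fun y => Relation.ReflTransGen R v y with hA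
  have hAm : ∀ y, y ∈ A ↔ (y ∈ Δ.vertexSet ∧ y ∉ W) ∧ Relation.ReflTransGen R v y := by
    intro y; rw [hA, mem_filter, mem_sdiff]
  have hAW : ∀ y ∈ W, y ∉ A := by
    intro y hy hyA; exact ((hAm y).1 hyA).1.2 hy
  have hvA : v ∈ A := (hAm v).2 ⟨⟨hvV, hvW⟩, Relation.ReflTransGen.refl⟩
  have hclosed : ∀ x ∈ A, ∀ y, x ≠ y → ({x, y} : Finset ℕ) ∈ Δ.faces → y ∉ W → y ∈ A := by
    intro x hx y hxy hf hyW
    rw [hAm] at hx ⊢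
    exact ⟨⟨sub_vert hf (by simp), hyW⟩, hx.2.tail ⟨hyW, hxy, hf⟩⟩
  have hreach : ∀ P : ℕ → Prop, P v →
      (∀ x ∈ A, ∀ y ∈ A, x ≠ y → ({x, y} : Finset ℕ) ∈ Δ.faces → P x → P y) → ∀ a ∈ A, P a := by
    intro P hPv hP a ha
    have hr := ((hAm a).1 ha).2
    have : a ∈ A ∧ P a := by
      clear ha
      induction hr with
      | refl => exact ⟨hvA, hPv⟩
      | tail _ hxy ih =>
        have hyA := hclosed _ ih.1 _ hxy.2.1 hxy.2.2 hxy.1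
        exact ⟨hyA, hP _ ih.1 _ hyA hxy.2.1 hxy.2.2 ih.2⟩
    exact this.2
  have hbW : b ∈ W := hσW (by simp)
  have hcW : c ∈ W := hσW (by simp)
  have e1 := euler h hvA (hAW b hbW) hvf (by rw [card_insert_of_notMem hvσ, hσc]) hreach
  have e2 := count h A
  simp only [mem_insert, mem_singleton, not_or] at hwσ
  have e3 := three h hvA (hAW b hbW) (hAW c hcW) (hAW w hwW) hbc hwσ.1 hwσ.2 hvf hwf
  have hAV : A ⊆ Δ.vertexSet := fun y hy => ((hAm y).1 hy).1.1
  have hE : E Δ (W ∪ A) = E Δ W + (EA Δ A).card := by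
    unfold E
    rw [← card_union_of_disjoint]
    · congr 1
      ext e
      simp only [mem_union, mem_filter, mem_EA]
      constructor
      · rintro ⟨h1, h2, h3⟩
        by_cases heW : e ⊆ W
        · exact Or.inl ⟨h1, h2, heW⟩
        · right
          obtain ⟨x, hx, hxW⟩ := not_subset.1 heW
          have := h3 hx
          rw [mem_union] at this
          exact ⟨h1, h2, x, by tauto, hx⟩
      · rintro (⟨h1, h2, h3⟩ | ⟨h1, h2, a, ha, hae⟩)
        · exact ⟨h1, h2, h3.trans subset_union_left⟩
        · refine ⟨h1, h2, ?_⟩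
          intro y hy
          rw [mem_union]
          by_cases hyW : y ∈ W
          · exact Or.inl hyW
          · right
            by_cases hay : a = y
            · rwa [← hay]
            · refine hclosed a ha y hay (Δ.down _ h1 _ ?_) hyW
              intro r hr
              simp only [mem_insert, mem_singleton] at hr
              rcases hr with rfl | rfl <;> assumption
    · rw [disjoint_left]
      intro e he he'
      rw [mem_filter] at he
      rw [mem_EA] at he'
      obtain ⟨a, ha, hae⟩ := he'.2.2
      exact hAW a (he.2.2 hae) ha
  have hcd : (W ∪ A).card = W.card + A.card := by
    apply card_union_of_disjoint
    rw [disjoint_left]; exact hAW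
  have hrec := ihn _ (by
    rw [← hn]
    apply card_lt_card
    rw [ssubset_iff_of_subset (sdiff_subset_sdiff (Subset.refl _) subset_union_left)]
    exact ⟨v, by rw [mem_sdiff]; exact ⟨hvV, hvW⟩, by simp [hvA]⟩)
    (W ∪ A) F rfl (union_subset hWV hAV) hF hFc (hFW.trans subset_union_left)
  rw [hE, hcd] at hrec
  push_cast at hrec
  have : (3 : ℤ) * A.card ≤ (EA Δ A).card := by
    have : 3 * A.card ≤ (EA Δ A).card := by omega
    exact_mod_cast this
  linarith

theorem star_sub (Δ : SComplex) {w : ℕ} (hw : w ∈ Δ.vertexSet) :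
    insert w (Δ.link {w}).vertexSet ⊆ Δ.vertexSet := by
  apply insert_subset hw
  intro x hx
  rw [mem_vert, mem_link1] at hx
  exact sub_vert hx.2 (by simp)

theorem mem_lk_of_face {Δ : SComplex} {σ : Finset ℕ} (h : σ ∈ Δ.faces) {w x : ℕ} (hw : w ∈ σ)
    (hx : x ∈ σ) (hne : x ≠ w) : x ∈ (Δ.link {w}).vertexSet := by
  rw [mem_vert, mem_link1]
  refine ⟨by simpa using hne.symm, Δ.down _ h _ ?_⟩
  intro y hy
  simp only [mem_insert, mem_singleton] at hy
  rcases hy with rfl | rfl <;> assumption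

theorem weak (k : ℕ) : ∀ (Δ : SComplex), NPM Δ (k + 2) → ∀ (n : ℕ) (W F : Finset ℕ),
    (Δ.vertexSet \ W).card = n → W ⊆ Δ.vertexSet → F ∈ Δ.faces → F.card = k + 3 → F ⊆ W →
    (E Δ W : ℤ) - (k + 3) * W.card ≤ E Δ Δ.vertexSet - (k + 3) * Δ.vertexSet.card := by
  induction k with
  | zero =>
    intro Δ h n W F h1 h2 h3 h4 h5
    have := surface h n W F h1 h2 h3 h4 h5
    simpa using this
  | succ k ih =>
    intro Δ h n
    induction n using Nat.strong_induction_on with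
    | _ n ihn =>
    intro W F hn hWV hF hFc hFW
    by_cases hW : Δ.vertexSet ⊆ W
    · rw [Subset.antisymm hWV hW]
    obtain ⟨σ, w, v, hσc, hσW, hwW, hvW, hwσ, hvσ, hwf, hvf⟩ := boundary h hF hFc hFW hW
    obtain ⟨c, hc⟩ : σ.Nonempty := card_pos.1 (by omega)
    set L := Δ.link {c} with hL
    have hcV : c ∈ Δ.vertexSet := hWV (hσW hc)
    have hLn : NPM L (k + 2) := link_npm h
    have hG : (insert w σ).erase c ∈ L.faces := by
      rw [hL, mem_link1]
      exact ⟨by simp, by rwa [insert_erase (mem_insert_of_mem hc)]⟩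
    have hGc : ((insert w σ).erase c).card = k + 3 := by
      rw [card_erase_of_mem (mem_insert_of_mem hc), card_insert_of_notMem hwσ]; omega
    have hGW : (insert w σ).erase c ⊆ W ∩ L.vertexSet := by
      apply subset_inter _ (sub_vert hG)
      exact (erase_subset _ _).trans (insert_subset hwW hσW)
    have hw1 := ih L hLn _ (W ∩ L.vertexSet) _ rfl inter_subset_right hG hGc hGW
    have hgl := glue Δ W c
    rw [← hL] at hgl
    have hvL : v ∈ L.vertexSet :=
      mem_lk_of_face hvf (mem_insert_of_mem hc) (mem_insert_self _ _)
        (by rintro rfl; exact hvσ hc)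
    have hS := star_sub Δ hcV
    rw [← hL] at hS
    have hrec := ihn _ (by
      rw [← hn]
      apply card_lt_card
      rw [ssubset_iff_of_subset (sdiff_subset_sdiff (Subset.refl _) subset_union_left)]
      exact ⟨v, by rw [mem_sdiff]; exact ⟨hS (mem_insert_of_mem hvL), hvW⟩, by simp [hvL]⟩)
      (W ∪ insert c L.vertexSet) F rfl (union_subset hWV hS) hF hFc (hFW.trans subset_union_left)
    have hcW : c ∈ W := hσW hc
    have hK : (L.vertexSet.filter fun x => c ∈ W → x ∉ W).card + (W ∩ L.vertexSet).card
        = L.vertexSet.card := by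
      rw [inter_comm, ← card_sdiff_add_card_inter L.vertexSet W]
      congr 2
      ext x; simp only [mem_filter, mem_sdiff]; tauto
    have hU : (W ∪ insert c L.vertexSet).card + (W ∩ L.vertexSet).card
        = W.card + L.vertexSet.card := by
      rw [union_insert, insert_eq_of_mem (mem_union_left _ hcW), card_union_add_card_inter]
    zify at hgl hK hU
    have hpos : (0:ℤ) ≤ ((Δ.faces.filter fun σ => σ.card = 2 ∧ σ ⊆ W ∪ insert c L.vertexSet ∧
        ¬ σ ⊆ W ∧ ¬ σ ⊆ insert c L.vertexSet).card : ℤ) := by positivity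
    push_cast at hrec ⊢
    refine le_trans ?_ hrec
    have e : ((W ∪ insert c L.vertexSet).card : ℤ) = W.card + L.vertexSet.card
      - (W ∩ L.vertexSet).card := by linarith
    rw [e]
    linarith

theorem strict (k : ℕ) (Δ : SComplex) (h : NPM Δ (k + 3))
    (hl : ∀ v ∈ Δ.vertexSet, (1 : ℤ) ≤ E (Δ.link {v}) (Δ.link {v}).vertexSet
      - (k + 3) * (Δ.link {v}).vertexSet.card + (k + 4).choose 2) :
    ∀ (n : ℕ) (W F : Finset ℕ),
    (Δ.vertexSet \ W).card = n → W ⊆ Δ.vertexSet → F ∈ Δ.faces → F.card = k + 4 → F ⊆ W →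
    ¬ Δ.vertexSet ⊆ W →
    (E Δ W : ℤ) - (k + 4) * W.card < E Δ Δ.vertexSet - (k + 4) * Δ.vertexSet.card := by
  intro n
  induction n using Nat.strong_induction_on with
  | _ n ihn =>
  intro W F hn hWV hF hFc hFW hW
  obtain ⟨σ, w, v, hσc, hσW, hwW, hvW, hwσ, hvσ, hwf, hvf⟩ := boundary h hF hFc hFW hW
  set L := Δ.link {v} with hL
  have hvV : v ∈ Δ.vertexSet := sub_vert hvf (mem_insert_self _ _)
  have hLn : NPM L (k + 2) := link_npm h
  have hG : σ ∈ L.faces := by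
    rw [hL, mem_link1]; exact ⟨hvσ, hvf⟩
  have hGW : σ ⊆ W ∩ L.vertexSet := subset_inter hσW (sub_vert hG)
  have hgl := glue Δ W v
  rw [← hL] at hgl
  have hS := star_sub Δ hvV
  rw [← hL] at hS
  have hg2 := hl v hvV
  rw [← hL] at hg2
  have hK : (L.vertexSet.filter fun x => v ∈ W → x ∉ W).card = L.vertexSet.card := by
    congr 1
    ext x; simp only [mem_filter]; tauto
  have hvL : v ∉ L.vertexSet := by
    rw [mem_vert, hL, mem_link1]; simp
  have hU : (W ∪ insert v L.vertexSet).card + (W ∩ L.vertexSet).card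
      = W.card + L.vertexSet.card + 1 := by
    rw [union_insert, card_insert_of_notMem (by simp [hvW, hvL]), ← card_union_add_card_inter]
    omega
  set t := (W ∩ L.vertexSet).card with ht
  have htσ : k + 3 ≤ t := by rw [← hσc]; exact card_le_card hGW
  set X4 := Δ.faces.filter fun σ => σ.card = 2 ∧ σ ⊆ W ∪ insert v L.vertexSet ∧
        ¬ σ ⊆ W ∧ ¬ σ ⊆ insert v L.vertexSet with hX4
  rw [hK] at hgl
  have hrec : ¬ Δ.vertexSet ⊆ W ∪ insert v L.vertexSet →
      (E Δ (W ∪ insert v L.vertexSet) : ℤ) - (k + 4) * (W ∪ insert v L.vertexSet).card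
        < E Δ Δ.vertexSet - (k + 4) * Δ.vertexSet.card := by
    intro hne
    refine ihn _ ?_ (W ∪ insert v L.vertexSet) F rfl (union_subset hWV hS) hF hFc
      (hFW.trans subset_union_left) hne
    rw [← hn]
    apply card_lt_card
    rw [ssubset_iff_of_subset (sdiff_subset_sdiff (Subset.refl _) subset_union_left)]
    exact ⟨v, by rw [mem_sdiff]; exact ⟨hvV, hvW⟩, by simp⟩
  have hrec' : (E Δ (W ∪ insert v L.vertexSet) : ℤ) - (k + 4) * (W ∪ insert v L.vertexSet).card
        ≤ E Δ Δ.vertexSet - (k + 4) * Δ.vertexSet.card := by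
    by_cases hne : Δ.vertexSet ⊆ W ∪ insert v L.vertexSet
    · rw [Subset.antisymm (union_subset hWV hS) hne]
    · exact (hrec hne).le
  have e : ((W ∪ insert v L.vertexSet).card : ℤ) = W.card + L.vertexSet.card + 1 - t := by
    have : ((W ∪ insert v L.vertexSet).card : ℤ) + t = W.card + L.vertexSet.card + 1 := by
      exact_mod_cast hU
    linarith
  have hgl' : (E Δ W : ℤ) + E L L.vertexSet + L.vertexSet.card + X4.card ≤
      E Δ (W ∪ insert v L.vertexSet) + E L (W ∩ L.vertexSet) := by exact_mod_cast hgl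
  have hch := E_le_choose L (W ∩ L.vertexSet)
  rw [← ht] at hch
  have hX4pos : (0 : ℤ) ≤ X4.card := by positivity
  have c4 : (((k + 4).choose 2 : ℕ) : ℤ) * 2 = (k + 4) * (k + 3) := by
    have := Nat.triangle_succ (k + 3)
    have h2 := Nat.choose_two_right (k + 4)
    have h3 : 2 ∣ (k + 4) * (k + 4 - 1) := (Nat.even_mul_pred_self (k + 4)).two_dvd
    have h4 : (k + 4).choose 2 * 2 = (k + 4) * (k + 4 - 1) := by
      rw [h2, Nat.div_mul_cancel h3]
    have h5 : k + 4 - 1 = k + 3 := by omega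
    rw [h5] at h4
    exact_mod_cast h4
  have c3 : (((k + 4).choose 2 : ℕ) : ℤ) = (k + 3).choose 2 + (k + 3) := by
    have : (k + 4).choose 2 = (k + 3).choose 1 + (k + 3).choose 2 := Nat.choose_succ_succ _ _
    rw [this, Nat.choose_one_right]; push_cast; ring
  rw [e] at hrec' hrec
  rcases Nat.lt_or_ge t (k + 5) with hlt | hge
  · have : t = k + 4 ∨ t = k + 3 := by omega
    rcases this with h4 | h3
    · rw [h4] at hrec' hch
      have hch' : (E L (W ∩ L.vertexSet) : ℤ) ≤ (k + 4).choose 2 := by exact_mod_cast hch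
      push_cast at hrec'
      linarith
    · rw [h3] at hrec' hch hrec
      have hch' : (E L (W ∩ L.vertexSet) : ℤ) ≤ (k + 3).choose 2 := by exact_mod_cast hch
      push_cast at hrec' hrec
      by_cases hne : Δ.vertexSet ⊆ W ∪ insert v L.vertexSet
      · have hTσ : W ∩ L.vertexSet = σ := (eq_of_subset_of_card_le hGW (by omega)).symm
        obtain ⟨x, hx⟩ : σ.Nonempty := card_pos.1 (by omega)
        have hxe : insert x (σ.erase x) = σ := insert_erase hx
        obtain ⟨y, hy, z, hz, hzx, hyr, hzr, hyz⟩ := parity h (ρ := σ.erase x)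
          (A := Δ.vertexSet \ W) (x := x) (v := v) (w := w)
          (by rw [card_erase_of_mem hx]; omega) (by simp) (by simp [hσW hx])
          (by rw [mem_sdiff]; exact ⟨hvV, hvW⟩) (by simp [hwW])
          (by rwa [hxe]) (by rwa [hxe]) (by rwa [hxe]) (by rwa [hxe])
        have hzV : z ∈ Δ.vertexSet := sub_vert hyz (by simp)
        rw [mem_sdiff] at hy hz
        have hzW : z ∈ W := by tauto
        have hzσ : z ∉ σ := by
          intro hz'; exact hzr (mem_erase.2 ⟨hzx, hz'⟩)
        have hzy : z ≠ y := by rintro rfl; exact hy.2 hzW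
        have hmem : ({z, y} : Finset ℕ) ∈ X4 := by
          rw [hX4, mem_filter]
          have hin : ({z, y} : Finset ℕ) ∈ Δ.faces := Δ.down _ hyz _ (by
            intro a ha; simp only [mem_insert, mem_singleton] at ha ⊢; tauto)
          refine ⟨hin, card_pair hzy, (sub_vert hin).trans hne, ?_, ?_⟩
          · intro hs; exact hy.2 (hs (by simp))
          · intro hs
            have := hs (show z ∈ ({z, y} : Finset ℕ) by simp)
            rw [mem_insert] at this
            rcases this with rfl | h
            · exact hvW hzW
            · apply hzσ; rw [← hTσ, mem_inter]; exact ⟨hzW, h⟩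
        have hX4' : (1 : ℤ) ≤ X4.card := by
          exact_mod_cast card_pos.2 ⟨_, hmem⟩
        linarith
      · have := hrec hne
        linarith
  · have hw1 := weak k L hLn _ (W ∩ L.vertexSet) σ rfl inter_subset_right hG hσc hGW
    rw [← ht] at hw1
    have : (k : ℤ) + 5 ≤ t := by exact_mod_cast hge
    linarith

theorem fVec_zero (Δ : SComplex) : Δ.fVec 0 = Δ.vertexSet.card := by
  unfold fVec
  symm
  apply card_bij (fun x _ => ({x} : Finset ℕ))
  · intro x hx
    rw [mem_filter]
    exact ⟨mem_vert.1 hx, by simp⟩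
  · intro a _ b _ hab
    simpa using hab
  · intro σ hσ
    rw [mem_filter] at hσ
    obtain ⟨x, rfl⟩ := card_eq_one.1 hσ.2
    exact ⟨x, mem_vert.2 hσ.1, rfl⟩

theorem fVec_one (Δ : SComplex) : Δ.fVec 1 = E Δ Δ.vertexSet := by
  unfold fVec E
  congr 1
  ext σ
  simp only [mem_filter]
  constructor
  · rintro ⟨h1, h2⟩; exact ⟨h1, h2, sub_vert h1⟩
  · tauto

theorem induced_vert (Δ : SComplex) {W : Finset ℕ} (hW : W ⊆ Δ.vertexSet) :
    (Δ.induced W).vertexSet = W := by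
  ext x
  rw [mem_vert]
  unfold induced
  simp only [mem_filter, singleton_subset_iff]
  constructor
  · tauto
  · intro h; exact ⟨mem_vert.1 (hW h), h⟩

theorem induced_E (Δ : SComplex) {W : Finset ℕ} : E (Δ.induced W) W = E Δ W := by
  unfold E
  congr 1
  ext σ
  unfold induced
  simp only [mem_filter]
  tauto

end S6

/-- Let `d ≥ 3` and `Δ` a normal `d`-pseudomanifold such that
`g₂(lk_Δ v) ≥ 1` for every vertex `v`. If `u` is a vertex with
`g₂(Δ) = g₂(Δ[V(st_Δ u)])`, then `V(Δ) = V(st_Δ u)`. -/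
theorem statement6 (d : ℕ) (hd : 3 ≤ d) (Δ : SComplex)
    (hpm : Δ.IsNormalPseudomanifold d)
    (hlinks : ∀ v ∈ Δ.vertexSet, 1 ≤ (Δ.link {v}).g2 (d - 1))
    (u : ℕ) (hu : ({u} : Finset ℕ) ∈ Δ.faces)
    (hstar : Δ.g2 d = (Δ.induced (Δ.closedStarVerts u)).g2 d) :
    Δ.vertexSet = Δ.closedStarVerts u := by
  obtain ⟨k, rfl⟩ : ∃ k, d = k + 3 := ⟨d - 3, by omega⟩
  have h : S6.NPM Δ (k + 3) := ⟨hpm.1, hpm.2.2.1, hpm.2.2.2⟩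
  have huV : u ∈ Δ.vertexSet := S6.mem_vert.2 hu
  have hWV : Δ.closedStarVerts u ⊆ Δ.vertexSet := S6.star_sub Δ huV
  obtain ⟨F, hF, huF, hFc⟩ := hpm.1.2 _ hu
  have huF' : u ∈ F := huF (by simp)
  have hFW : F ⊆ Δ.closedStarVerts u := by
    intro x hx
    unfold SComplex.closedStarVerts
    rw [Finset.mem_insert]
    by_cases hxu : x = u
    · exact Or.inl hxu
    · exact Or.inr (S6.mem_lk_of_face hF huF' hx hxu)
  refine Finset.Subset.antisymm ?_ hWV
  by_contra hne
  have hs := S6.strict k Δ h ?_ _ _ F rfl hWV hF hFc hFW hne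
  · unfold SComplex.g2 at hstar
    rw [S6.fVec_one, S6.fVec_one, S6.fVec_zero, S6.fVec_zero, S6.induced_vert Δ hWV,
      S6.induced_E] at hstar
    push_cast at hstar
    linarith
  · intro v hv
    have := hlinks v hv
    unfold SComplex.g2 at this
    rw [S6.fVec_one, S6.fVec_zero] at this
    have e1 : k + 3 - 1 = k + 2 := by omega
    rw [e1] at this
    push_cast at this
    linarith
end
end

section
/- Let Δ be an F-homology 4-manifold with g_2(Δ) = m, and let u be a vertex of Δ such that lk_Δ u = C ⋆ ∂(pqc), where C is an n-cycle and pqc is a 2-simplex. If pqc ∉ Δ, then Δ is obtained by an edge expansion from an F-homology 4-manifold with g_2 ≤ m − (n − 2). -/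
/-!
Common definitions: finite abstract simplicial complexes (with vertices in ℕ),
links, f-vectors, g-numbers, reduced simplicial homology over a field (via Betti
numbers of the simplicial chain complex), homology spheres/manifolds, geometric
realization and triangulated spheres/balls, normal pseudomanifolds, and the
combinatorial operations (bistellar moves, edge contraction/expansion, edge
flips) used in the paper.
-/

noncomputable section

namespace SComplex

theorem ext_faces {A B : SComplex} (h : A.faces = B.faces) : A = B := by
  cases A; cases B; simp_all

/-- sign of a vertex in a face -/
def sg (F : Type*) [Field F] (σ : Finset ℕ) (v : ℕ) : F :=
  (-1 : F) ^ ((σ.filter fun x => x < v).card)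

/-- boundary of a face as a globally defined function -/
def col (F : Type*) [Field F] (σ : Finset ℕ) : Finset ℕ → F := fun τ =>
  if τ ⊆ σ ∧ τ.card + 1 = σ.card then ∑ v ∈ σ \ τ, sg F σ v else 0

/-- rank of the boundary map -/
def rk (F : Type*) [Field F] (Δ : SComplex) (n : ℕ) : ℕ :=
  Module.finrank F (Submodule.span F (col F '' (Δ.facesOfCard (n + 1) : Set (Finset ℕ))))

theorem finrank_range_bdry (F : Type*) [Field F] (Δ : SComplex) (n : ℕ) :
    Module.finrank F ↥(LinearMap.range (Δ.bdry F n)) = Δ.rk F n := by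
  let ι : (↥(Δ.facesOfCard n) → F) →ₗ[F] (Finset ℕ → F) :=
    Function.ExtendByZero.linearMap F (Subtype.val)
  have hι : Function.Injective ι := by
    intro a b hab
    funext x
    have := congrFun hab x.1
    simpa [ι, Subtype.val_injective.extend_apply] using this
  have h1 : (LinearMap.range (Δ.bdry F n)).map ι =
      Submodule.span F (col F '' (Δ.facesOfCard (n + 1) : Set (Finset ℕ))) := by
    unfold bdry
    rw [Matrix.range_mulVecLin, Submodule.map_span]
    congr 1
    ext f
    simp only [Set.mem_image, Set.mem_range, exists_exists_eq_and, Finset.mem_coe]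
    have key : ∀ σ : ↥(Δ.facesOfCard (n + 1)), ι ((Δ.bdryMat F n).col σ) = col F σ.1 := by
      intro σ
      obtain ⟨σ, hσ⟩ := σ
      have hσ' := hσ
      simp only [facesOfCard, Finset.mem_filter] at hσ'
      funext τ
      by_cases hτ : τ ∈ Δ.facesOfCard n
      · have : ι ((Δ.bdryMat F n).col ⟨σ, hσ⟩) τ = Δ.bdryMat F n ⟨τ, hτ⟩ ⟨σ, hσ⟩ := by
          have := Subtype.val_injective.extend_apply ((Δ.bdryMat F n).col ⟨σ, hσ⟩) 0 (⟨τ, hτ⟩ : ↥(Δ.facesOfCard n))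
          simpa [ι] using this
        rw [this]
        simp only [facesOfCard, Finset.mem_filter] at hτ
        simp [bdryMat, col, sg, hτ.2, hσ'.2]
      · have : ι ((Δ.bdryMat F n).col ⟨σ, hσ⟩) τ = 0 := by
          simp only [ι, Function.ExtendByZero.linearMap_apply]
          rw [Function.extend_apply']
          · rfl
          · rintro ⟨a, rfl⟩; exact hτ a.2
        rw [this, col, if_neg]
        rintro ⟨h1, h2⟩
        apply hτ
        simp only [facesOfCard, Finset.mem_filter]
        have h3 : τ.card + 1 = σ.card := h2
        exact ⟨Δ.down _ hσ'.1 _ h1, by omega⟩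
    constructor
    · rintro ⟨a, rfl⟩
      exact ⟨a.1, a.2, (key a).symm⟩
    · rintro ⟨a, ha, rfl⟩
      exact ⟨⟨a, ha⟩, key ⟨a, ha⟩⟩
  rw [rk, ← h1]
  exact (Submodule.equivMapOfInjective ι hι _).finrank_eq

theorem betti_zero' (F : Type*) [Field F] (Δ : SComplex) :
    Δ.betti F 0 = (Δ.facesOfCard 0).card - Δ.rk F 0 := by
  rw [betti, finrank_range_bdry]

theorem betti_succ' (F : Type*) [Field F] (Δ : SComplex) (n : ℕ) :
    Δ.betti F (n + 1) = (Δ.facesOfCard (n + 1)).card - Δ.rk F n - Δ.rk F (n + 1) := by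
  rw [betti, finrank_range_bdry]
  have h := LinearMap.finrank_range_add_finrank_ker (Δ.bdry F n)
  rw [finrank_range_bdry, Module.finrank_fintype_fun_eq_card, Fintype.card_coe] at h
  omega

theorem sg_ne_zero (F : Type*) [Field F] (σ : Finset ℕ) (v : ℕ) : sg F σ v ≠ 0 := by
  unfold sg; exact pow_ne_zero _ (by simp)

theorem dd_aux (F : Type*) [Field F] (ρ : Finset ℕ) (a b : ℕ) (ha : a ∈ ρ) (hab : a < b) :
    sg F ρ a * sg F (ρ.erase a) b + sg F ρ b * sg F (ρ.erase b) a = 0 := by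
  have h1 : (ρ.erase b).filter (fun x => x < a) = ρ.filter fun x => x < a := by
    ext x; simp only [Finset.mem_filter, Finset.mem_erase]
    constructor
    · rintro ⟨⟨_, h⟩, h'⟩; exact ⟨h, h'⟩
    · rintro ⟨h, h'⟩; exact ⟨⟨by omega, h⟩, h'⟩
  have h2 : ρ.filter (fun x => x < b) = insert a ((ρ.erase a).filter fun x => x < b) := by
    ext x; simp only [Finset.mem_filter, Finset.mem_erase, Finset.mem_insert]
    constructor
    · rintro ⟨h, h'⟩
      by_cases hx : x = a
      · exact Or.inl hx
      · exact Or.inr ⟨⟨hx, h⟩, h'⟩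
    · rintro (rfl | ⟨⟨_, h⟩, h'⟩)
      · exact ⟨ha, hab⟩
      · exact ⟨h, h'⟩
  unfold sg
  rw [h1, h2, Finset.card_insert_of_notMem (by simp)]
  ring

theorem col_erase_apply (F : Type*) [Field F] (τ ρ : Finset ℕ) (a b : ℕ) (hab : a ≠ b)
    (ha : a ∉ τ) (hb : b ∉ τ) (hρ : ρ = insert a (insert b τ)) :
    col F (ρ.erase a) τ = sg F (ρ.erase a) b := by
  have h : ρ.erase a = insert b τ := by
    rw [hρ, Finset.erase_insert]; simp [ha, hab]
  have h2 : insert b τ \ τ = {b} := by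
    ext x; simp only [Finset.mem_sdiff, Finset.mem_insert, Finset.mem_singleton]
    constructor
    · rintro ⟨h | h, h'⟩; exacts [h, absurd h h']
    · rintro rfl; exact ⟨Or.inl rfl, hb⟩
  rw [h, col, if_pos, h2, Finset.sum_singleton]
  exact ⟨Finset.subset_insert _ _, by rw [Finset.card_insert_of_notMem hb]⟩

theorem dd_zero (F : Type*) [Field F] (ρ : Finset ℕ) :
    ∑ x ∈ ρ, sg F ρ x • col F (ρ.erase x) = 0 := by
  funext τ
  simp only [Finset.sum_apply, Pi.smul_apply, smul_eq_mul, Pi.zero_apply]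
  by_cases h : τ ⊆ ρ ∧ τ.card + 2 = ρ.card
  · obtain ⟨h1, h2⟩ := h
    have h3 : (ρ \ τ).card = 2 := by
      rw [Finset.card_sdiff_of_subset h1]; omega
    have h4 : ∃ a b, a < b ∧ ρ \ τ = {a, b} := by
      obtain ⟨a, b, hab, he⟩ := Finset.card_eq_two.mp h3
      rcases lt_or_gt_of_ne hab with h | h
      · exact ⟨a, b, h, he⟩
      · exact ⟨b, a, h, by rw [he, Finset.pair_comm]⟩
    obtain ⟨a, b, hab, he⟩ := h4
    have ha : a ∈ ρ \ τ := by rw [he]; simp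
    have hb : b ∈ ρ \ τ := by rw [he]; simp
    rw [Finset.mem_sdiff] at ha hb
    have hρ : ρ = insert a (insert b τ) := by
      ext x
      have hx : x ∈ ρ \ τ ↔ x ∈ ({a, b} : Finset ℕ) := by rw [he]
      simp only [Finset.mem_sdiff, Finset.mem_insert, Finset.mem_singleton] at hx ⊢
      have := @h1 x
      tauto
    have hρ' : ρ = insert b (insert a τ) := by rw [hρ, Finset.insert_comm]
    rw [← Finset.sum_subset (Finset.sdiff_subset : ρ \ τ ⊆ ρ), he, Finset.sum_pair hab.ne,
      col_erase_apply F τ ρ a b hab.ne ha.2 hb.2 hρ,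
      col_erase_apply F τ ρ b a hab.ne' hb.2 ha.2 hρ']
    · exact dd_aux F ρ a b ha.1 hab
    · intro x hx hx'
      rw [col, if_neg, mul_zero]
      rintro ⟨h5, -⟩
      have : x ∈ τ := by
        simp only [Finset.mem_sdiff, not_and, not_not] at hx'
        exact hx' hx
      simpa using h5 this
  · apply Finset.sum_eq_zero
    intro x hx
    rw [col, if_neg, mul_zero]
    rintro ⟨h5, h6⟩
    apply h
    rw [Finset.card_erase_of_mem hx] at h6
    have := Finset.card_pos.mpr ⟨x, hx⟩
    exact ⟨h5.trans (Finset.erase_subset _ _), by omega⟩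

/-- An elementary collapse preserves Betti numbers. -/
theorem betti_collapse (F : Type*) [Field F] (L M : SComplex) (σ : Finset ℕ) (p : ℕ)
    (hp : p ∉ σ) (hσ : σ ∈ M.faces) (hσp : insert p σ ∈ M.faces)
    (hL : L.faces = M.faces \ {σ, insert p σ})
    (hfree : ∀ τ ∈ M.faces, σ ⊆ τ → τ = σ ∨ τ = insert p σ) (n : ℕ) :
    L.betti F n = M.betti F n := by
  have hne : σ ≠ insert p σ := fun h => hp (by rw [h]; simp)
  have hcp : (insert p σ).card = σ.card + 1 := Finset.card_insert_of_notMem hp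
  have hMemL : ∀ k τ, τ ∈ L.facesOfCard k ↔ τ ∈ M.facesOfCard k ∧ τ ≠ σ ∧ τ ≠ insert p σ := by
    intro k τ
    simp only [facesOfCard, Finset.mem_filter, hL, Finset.mem_sdiff, Finset.mem_insert,
      Finset.mem_singleton]
    tauto
  have hcM : ∀ k τ, τ ∈ M.facesOfCard k ↔ τ ∈ M.faces ∧ τ.card = k := by
    intro k τ; simp [facesOfCard]
  have f1 : M.facesOfCard σ.card = insert σ (L.facesOfCard σ.card) := by
    ext τ
    rw [Finset.mem_insert, hMemL, hcM]
    constructor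
    · rintro ⟨h, h'⟩
      by_cases h2 : τ = σ
      · exact Or.inl h2
      · exact Or.inr ⟨⟨h, h'⟩, h2, by rintro rfl; omega⟩
    · rintro (rfl | h)
      · exact ⟨hσ, rfl⟩
      · exact h.1
  have f2 : M.facesOfCard (σ.card + 1) = insert (insert p σ) (L.facesOfCard (σ.card + 1)) := by
    ext τ
    rw [Finset.mem_insert, hMemL, hcM]
    constructor
    · rintro ⟨h, h'⟩
      by_cases h2 : τ = insert p σ
      · exact Or.inl h2
      · exact Or.inr ⟨⟨h, h'⟩, by rintro rfl; omega, h2⟩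
    · rintro (rfl | h)
      · exact ⟨hσp, hcp⟩
      · exact h.1
  have f3 : ∀ k, k ≠ σ.card → k ≠ σ.card + 1 → M.facesOfCard k = L.facesOfCard k := by
    intro k hk hk'
    ext τ
    rw [hMemL, hcM]
    constructor
    · rintro ⟨h, h'⟩
      exact ⟨⟨h, h'⟩, by rintro rfl; omega, by rintro rfl; omega⟩
    · rintro h; exact h.1
  have c1 : (M.facesOfCard σ.card).card = (L.facesOfCard σ.card).card + 1 := by
    rw [f1, Finset.card_insert_of_notMem]
    rw [hMemL]; tauto
  have c2 : (M.facesOfCard (σ.card + 1)).card = (L.facesOfCard (σ.card + 1)).card + 1 := by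
    rw [f2, Finset.card_insert_of_notMem]
    rw [hMemL]; tauto
  have r3 : ∀ k, k + 1 ≠ σ.card → k ≠ σ.card → M.rk F k = L.rk F k := by
    intro k hk hk'
    rw [rk, f3 (k + 1) hk (by omega), rk]
  have r2 : M.rk F σ.card = L.rk F σ.card + 1 := by
    rw [rk, f2, rk, Finset.coe_insert, Set.image_insert_eq, Submodule.span_insert]
    set W := Submodule.span F (col F '' (L.facesOfCard (σ.card + 1) : Set (Finset ℕ))) with hW
    have hfin : Module.Finite F W := by
      rw [hW]; exact FiniteDimensional.span_of_finite F ((Finset.finite_toSet _).image _)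
    have hz : ∀ f ∈ W, f σ = 0 := by
      intro f hf
      have : W ≤ LinearMap.ker (LinearMap.proj (R := F) (φ := fun _ : Finset ℕ => F) σ) := by
        rw [hW, Submodule.span_le]
        rintro _ ⟨τ, hτ, rfl⟩
        simp only [SetLike.mem_coe, LinearMap.mem_ker, LinearMap.proj_apply]
        rw [col, if_neg]
        rintro ⟨h1, -⟩
        have hτ' := (hMemL _ _).mp hτ
        rcases hfree τ ((hcM _ _).mp hτ'.1).1 h1 with h | h
        · exact hτ'.2.1 h
        · exact hτ'.2.2 h
      exact this hf
    have hval : col F (insert p σ) σ ≠ 0 := by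
      rw [col, if_pos ⟨Finset.subset_insert _ _, hcp.symm⟩]
      have : insert p σ \ σ = {p} := by
        ext x; simp only [Finset.mem_sdiff, Finset.mem_insert, Finset.mem_singleton]
        constructor
        · rintro ⟨h | h, h'⟩; exacts [h, absurd h h']
        · rintro rfl; exact ⟨Or.inl rfl, hp⟩
      rw [this, Finset.sum_singleton]
      exact sg_ne_zero F _ _
    have hinf : (F ∙ col F (insert p σ)) ⊓ W = ⊥ := by
      rw [eq_bot_iff]
      rintro f ⟨h1, h2⟩
      obtain ⟨a, rfl⟩ := Submodule.mem_span_singleton.mp h1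
      have := hz _ h2
      simp only [Pi.smul_apply, smul_eq_mul, mul_eq_zero] at this
      rcases this with h | h
      · simp [h]
      · exact absurd h hval
    have := Submodule.finrank_sup_add_finrank_inf_eq (F ∙ col F (insert p σ)) W
    rw [hinf, finrank_bot, finrank_span_singleton (fun h => hval (by rw [h]; rfl))] at this
    omega
  have r1 : ∀ k, k + 1 = σ.card → M.rk F k = L.rk F k := by
    intro k hk
    rw [rk, rk, hk, f1, Finset.coe_insert, Set.image_insert_eq]
    rw [Submodule.span_insert_eq_span]
    have h := dd_zero F (insert p σ)
    rw [Finset.sum_insert hp, Finset.erase_insert hp] at h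
    have h2 : col F σ = (-(sg F (insert p σ) p)⁻¹) •
        ∑ x ∈ σ, sg F (insert p σ) x • col F ((insert p σ).erase x) := by
      rw [← neg_eq_of_add_eq_zero_right h]
      simp [smul_smul, sg_ne_zero]
    rw [h2]
    apply Submodule.smul_mem
    apply Submodule.sum_mem
    intro x hx
    apply Submodule.smul_mem
    apply Submodule.subset_span
    refine ⟨_, ?_, rfl⟩
    rw [Finset.mem_coe, hMemL, hcM]
    have hx' : x ∈ insert p σ := Finset.mem_insert_of_mem hx
    refine ⟨⟨M.down _ hσp _ (Finset.erase_subset _ _), by rw [Finset.card_erase_of_mem hx', hcp]; rfl⟩, ?_, ?_⟩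
    · intro h; rw [← h] at hx; simp at hx
    · intro h; rw [← h] at hx'; simp at hx'
  rcases n with _ | n
  · rw [betti_zero', betti_zero']
    by_cases h : σ.card = 0
    · rw [h] at c1 r2; omega
    · rw [f3 0 (by omega) (by omega)]
      by_cases h' : σ.card = 1
      · rw [r1 0 h'.symm]
      · rw [r3 0 (by omega) (by omega)]
  · rw [betti_succ', betti_succ']
    by_cases h : n = σ.card
    · rw [h, c2, r2, r3 (σ.card + 1) (by omega) (by omega)]; omega
    · by_cases h' : n + 1 = σ.card
      · rw [r1 n h', h', c1, r2]; omega
      · rw [f3 (n + 1) h' (by omega), r3 n h' h]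
        by_cases h2 : n + 2 = σ.card
        · rw [r1 (n + 1) h2]
        · rw [r3 (n + 1) h2 h']

/-- If the faces of `M` not in `L` are closed under toggling the vertex `p`, then
`L` and `M` have the same Betti numbers. -/
theorem betti_toggle (F : Type*) [Field F] (L M : SComplex) (p : ℕ)
    (hLM : L.faces ⊆ M.faces)
    (h1 : ∀ σ ∈ M.faces, σ ∉ L.faces → insert p σ ∈ M.faces)
    (h2 : ∀ σ ∈ M.faces, σ ∉ L.faces → σ.erase p ∉ L.faces) (n : ℕ) :
    L.betti F n = M.betti F n := by
  induction hk : (M.faces \ L.faces).card using Nat.strong_induction_on generalizing M with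
  | _ k ih =>
  by_cases hE : M.faces \ L.faces = ∅
  · have : L = M := ext_faces (Finset.Subset.antisymm hLM (Finset.sdiff_eq_empty_iff_subset.mp hE))
    rw [this]
  · obtain ⟨σ, hσ, hmax⟩ := Finset.exists_max_image ((M.faces \ L.faces).filter fun τ => p ∉ τ)
      Finset.card (by
        obtain ⟨τ, hτ⟩ := Finset.nonempty_iff_ne_empty.mpr hE
        rw [Finset.mem_sdiff] at hτ
        refine ⟨τ.erase p, ?_⟩
        rw [Finset.mem_filter, Finset.mem_sdiff]
        exact ⟨⟨M.down _ hτ.1 _ (Finset.erase_subset _ _), h2 _ hτ.1 hτ.2⟩, by simp⟩)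
    rw [Finset.mem_filter, Finset.mem_sdiff] at hσ
    obtain ⟨⟨hσM, hσL⟩, hpσ⟩ := hσ
    have hfree : ∀ τ ∈ M.faces, σ ⊆ τ → τ = σ ∨ τ = insert p σ := by
      intro τ hτ hst
      have hτL : τ ∉ L.faces := fun h => hσL (L.down _ h _ hst)
      have hs : σ ⊆ τ.erase p := fun x hx =>
        Finset.mem_erase.mpr ⟨fun h => hpσ (h ▸ hx), hst hx⟩
      have he : σ = τ.erase p := by
        apply Finset.eq_of_subset_of_card_le hs
        apply hmax
        rw [Finset.mem_filter, Finset.mem_sdiff]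
        exact ⟨⟨M.down _ hτ _ (Finset.erase_subset _ _), h2 _ hτ hτL⟩, by simp⟩
      by_cases hpt : p ∈ τ
      · right; rw [he, Finset.insert_erase hpt]
      · left; rw [he, Finset.erase_eq_of_notMem hpt]
    have hσpM := h1 σ hσM hσL
    let M' : SComplex :=
      { faces := M.faces \ {σ, insert p σ}
        down := by
          intro τ hτ ρ hρ
          rw [Finset.mem_sdiff] at hτ ⊢
          refine ⟨M.down _ hτ.1 _ hρ, fun hm => hτ.2 ?_⟩
          have hsρ : σ ⊆ ρ := by
            simp only [Finset.mem_insert, Finset.mem_singleton] at hm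
            rcases hm with rfl | rfl
            · exact Finset.Subset.refl _
            · exact Finset.subset_insert _ _
          simp only [Finset.mem_insert, Finset.mem_singleton]
          exact hfree τ hτ.1 (hsρ.trans hρ) }
    have hMM : M'.betti F n = M.betti F n :=
      betti_collapse F M' M σ p hpσ hσM hσpM rfl hfree n
    rw [← hMM]
    have hM'mem : ∀ τ, τ ∈ M'.faces ↔ τ ∈ M.faces ∧ τ ≠ σ ∧ τ ≠ insert p σ := by
      intro τ; simp [M']
    refine ih (M'.faces \ L.faces).card ?_ M' ?_ ?_ ?_ rfl
    · rw [← hk]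
      apply Finset.card_lt_card
      rw [Finset.ssubset_iff_of_subset]
      · exact ⟨σ, by simp [hσM, hσL], by simp [M']⟩
      · intro τ hτ
        rw [Finset.mem_sdiff, hM'mem] at hτ
        rw [Finset.mem_sdiff]; exact ⟨hτ.1.1, hτ.2⟩
    · intro τ hτ
      rw [hM'mem]
      refine ⟨hLM hτ, fun h => hσL (h ▸ hτ), fun h => hσL ?_⟩
      exact L.down _ hτ _ (h ▸ Finset.subset_insert _ _)
    · intro τ hτ hτL
      rw [hM'mem] at hτ ⊢
      refine ⟨h1 _ hτ.1 hτL, fun h => hpσ (h ▸ Finset.mem_insert_self _ _), fun h => ?_⟩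
      have hs : σ ⊆ insert p τ := by rw [h]; exact Finset.subset_insert _ _
      have hs' : σ ⊆ τ := by
        intro x hx
        rcases Finset.mem_insert.mp (hs hx) with rfl | h'
        · exact absurd hx hpσ
        · exact h'
      rcases hfree τ hτ.1 hs' with h' | h'
      · exact hτ.2.1 h'
      · exact hτ.2.2 h'
    · intro τ hτ hτL
      rw [hM'mem] at hτ
      exact h2 _ hτ.1 hτL

end SComplex

namespace SComplex

theorem mem_link {Δ : SComplex} {σ γ : Finset ℕ} :
    γ ∈ (Δ.link σ).faces ↔ Disjoint γ σ ∧ γ ∪ σ ∈ Δ.faces := by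
  simp only [link, Finset.mem_filter, Finset.disjoint_iff_inter_eq_empty]
  constructor
  · rintro ⟨_, h⟩; exact h
  · rintro ⟨h, h'⟩; exact ⟨Δ.down _ h' _ Finset.subset_union_left, h, h'⟩

theorem mem_link_singleton {Δ : SComplex} {v : ℕ} {γ : Finset ℕ} :
    γ ∈ (Δ.link {v}).faces ↔ v ∉ γ ∧ insert v γ ∈ Δ.faces := by
  rw [mem_link, Finset.disjoint_singleton_right, Finset.union_comm, Finset.insert_eq]

theorem mem_vertexSet {Δ : SComplex} {v : ℕ} : v ∈ Δ.vertexSet ↔ {v} ∈ Δ.faces := by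
  simp only [vertexSet, Finset.mem_biUnion, id]
  constructor
  · rintro ⟨σ, h, h'⟩; exact Δ.down _ h _ (by simpa using h')
  · intro h; exact ⟨_, h, by simp⟩

/-- complex from a predicate -/
def ofPred (B : Finset ℕ) (P : Finset ℕ → Prop)
    (hP : ∀ σ, P σ → ∀ τ ⊆ σ, P τ) : SComplex := by
  classical
  exact
  { faces := B.powerset.filter P
    down := by
      intro σ hσ τ hτ
      simp only [Finset.mem_filter, Finset.mem_powerset] at hσ ⊢
      exact ⟨hτ.trans hσ.1, hP _ hσ.2 _ hτ⟩ }

theorem mem_ofPred {B : Finset ℕ} {P : Finset ℕ → Prop}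
    {hP : ∀ σ, P σ → ∀ τ ⊆ σ, P τ} {σ : Finset ℕ} :
    σ ∈ (ofPred B P hP).faces ↔ σ ⊆ B ∧ P σ := by
  simp [ofPred]

theorem subset_vertexSet {Δ : SComplex} {σ : Finset ℕ} (h : σ ∈ Δ.faces) : σ ⊆ Δ.vertexSet := by
  intro x hx
  rw [mem_vertexSet]
  exact Δ.down _ h _ (by simpa using hx)

theorem exists_ofPred (Δ : SComplex) (w : ℕ) (P : Finset ℕ → Prop)
    (hP : ∀ σ, P σ → ∀ τ ⊆ σ, P τ) (hB : ∀ σ, P σ → σ.erase w ∈ Δ.faces) :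
    ∃ K : SComplex, ∀ σ, σ ∈ K.faces ↔ P σ := by
  refine ⟨ofPred (insert w Δ.vertexSet) P hP, fun σ => ?_⟩
  rw [mem_ofPred]
  refine ⟨fun h => h.2, fun h => ⟨?_, h⟩⟩
  have := subset_vertexSet (hB σ h)
  intro x hx
  by_cases hxw : x = w
  · simp [hxw]
  · exact Finset.mem_insert_of_mem (this (Finset.mem_erase.mpr ⟨hxw, hx⟩))

/-- membership predicate of the contraction of the edge `up` of `L` to the new vertex `w` -/
def CP (L : SComplex) (u p w : ℕ) (σ : Finset ℕ) : Prop :=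
  u ∉ σ ∧ p ∉ σ ∧ (σ ∈ L.faces ∨
    (w ∈ σ ∧ (insert u (σ.erase w) ∈ L.faces ∨ insert p (σ.erase w) ∈ L.faces)))

theorem exists_contr (L : SComplex) (u p w : ℕ) :
    ∃ K : SComplex, ∀ σ, σ ∈ K.faces ↔ CP L u p w σ := by
  apply exists_ofPred L w
  · rintro σ ⟨h1, h2, h3⟩ τ hτ
    refine ⟨fun h => h1 (hτ h), fun h => h2 (hτ h), ?_⟩
    rcases h3 with h | ⟨hw, h | h⟩
    · exact Or.inl (L.down _ h _ hτ)
    · by_cases hwt : w ∈ τ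
      · exact Or.inr ⟨hwt, Or.inl (L.down _ h _ (by grind))⟩
      · exact Or.inl (L.down _ h _ (by grind))
    · by_cases hwt : w ∈ τ
      · exact Or.inr ⟨hwt, Or.inr (L.down _ h _ (by grind))⟩
      · exact Or.inl (L.down _ h _ (by grind))
  · rintro σ ⟨h1, h2, h | ⟨hw, h | h⟩⟩ <;> exact L.down _ h _ (by grind)

theorem betti_contr (F : Type*) [Field F] (L K : SComplex) (u p w : ℕ)
    (huw : u ≠ w) (hpw : p ≠ w) (hw : ∀ σ ∈ L.faces, w ∉ σ)
    (hlc : ∀ σ, insert u σ ∈ L.faces → insert p σ ∈ L.faces → insert u (insert p σ) ∈ L.faces)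
    (hK : ∀ σ, σ ∈ K.faces ↔ CP L u p w σ) (n : ℕ) : K.betti F n = L.betti F n := by
  obtain ⟨M1, hM1⟩ : ∃ M1 : SComplex, ∀ σ, σ ∈ M1.faces ↔
      (σ ∈ L.faces ∨ (w ∈ σ ∧ insert u (σ.erase w) ∈ L.faces)) := by
    apply exists_ofPred L w
    · rintro σ (h | ⟨h1, h⟩) τ hτ
      · exact Or.inl (L.down _ h _ hτ)
      · by_cases hwt : w ∈ τ
        · exact Or.inr ⟨hwt, L.down _ h _ (by grind)⟩
        · exact Or.inl (L.down _ h _ (by grind))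
    · rintro σ (h | ⟨h1, h⟩) <;> exact L.down _ h _ (by grind)
  obtain ⟨M, hM⟩ : ∃ M : SComplex, ∀ σ, σ ∈ M.faces ↔
      (σ ∈ L.faces ∨ (w ∈ σ ∧ (insert u (σ.erase w) ∈ L.faces ∨ insert p (σ.erase w) ∈ L.faces))) := by
    apply exists_ofPred L w
    · rintro σ (h | ⟨h1, h | h⟩) τ hτ
      · exact Or.inl (L.down _ h _ hτ)
      · by_cases hwt : w ∈ τ
        · exact Or.inr ⟨hwt, Or.inl (L.down _ h _ (by grind))⟩
        · exact Or.inl (L.down _ h _ (by grind))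
      · by_cases hwt : w ∈ τ
        · exact Or.inr ⟨hwt, Or.inr (L.down _ h _ (by grind))⟩
        · exact Or.inl (L.down _ h _ (by grind))
    · rintro σ (h | ⟨h1, h | h⟩) <;> exact L.down _ h _ (by grind)
  obtain ⟨M2, hM2⟩ : ∃ M2 : SComplex, ∀ σ, σ ∈ M2.faces ↔ (u ∉ σ ∧ σ ∈ M.faces) := by
    apply exists_ofPred M w
    · rintro σ ⟨h1, h⟩ τ hτ
      exact ⟨fun h' => h1 (hτ h'), M.down _ h _ hτ⟩
    · rintro σ ⟨h1, h⟩; exact M.down _ h _ (Finset.erase_subset _ _)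
  have e1 : L.betti F n = M1.betti F n := by
    apply betti_toggle F L M1 u
    · intro σ h; rw [hM1]; exact Or.inl h
    · intro σ h h'
      rw [hM1] at h ⊢
      rcases h with h | ⟨h1, h⟩
      · exact absurd h h'
      · refine Or.inr ⟨by grind, L.down _ h _ (by grind)⟩
    · intro σ h h' h2
      rw [hM1] at h
      rcases h with h | ⟨h1, h⟩
      · exact absurd h h'
      · exact hw _ h2 (by grind)
  have e2 : M1.betti F n = M.betti F n := by
    apply betti_toggle F M1 M p
    · intro σ h; rw [hM1] at h; rw [hM]
      rcases h with h | ⟨h1, h⟩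
      · exact Or.inl h
      · exact Or.inr ⟨h1, Or.inl h⟩
    · intro σ h h'
      rw [hM1] at h'
      rw [hM] at h ⊢
      rcases h with h | ⟨h1, h | h⟩
      · exact absurd (Or.inl h) h'
      · exact absurd (Or.inr ⟨h1, h⟩) h'
      · exact Or.inr ⟨by grind, Or.inr (L.down _ h _ (by grind))⟩
    · intro σ h h' h2
      rw [hM1] at h' h2
      rw [hM] at h
      rcases h with h | ⟨h1, h | h⟩
      · exact absurd (Or.inl h) h'
      · exact absurd (Or.inr ⟨h1, h⟩) h'
      · rcases h2 with h2 | ⟨h2, h3⟩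
        · exact hw _ h2 (by grind)
        · apply h'
          refine Or.inr ⟨h1, ?_⟩
          have := hlc ((σ.erase w).erase p) (L.down _ h3 _ (by grind)) (L.down _ h _ (by grind))
          exact L.down _ this _ (by grind)
  have e3 : M2.betti F n = M.betti F n := by
    apply betti_toggle F M2 M w
    · intro σ h; rw [hM2] at h; exact h.2
    · intro σ h h'
      rw [hM2] at h'
      have hu : u ∈ σ := by by_contra hu; exact h' ⟨hu, h⟩
      rw [hM] at h ⊢
      rcases h with h | ⟨h1, h⟩
      · exact Or.inr ⟨by simp, Or.inl (L.down _ h _ (by grind))⟩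
      · have : insert w σ = σ := by grind
        rw [this]; exact Or.inr ⟨h1, h⟩
    · intro σ h h' h2
      rw [hM2] at h' h2
      apply h'
      exact ⟨by grind, h⟩
  have e4 : K.betti F n = M2.betti F n := by
    apply betti_toggle F K M2 w
    · intro σ h; rw [hK] at h; rw [hM2, hM]; exact ⟨h.1, h.2.2⟩
    · intro σ h h'
      rw [hM2, hM] at h
      rw [hK] at h'
      have hu : p ∈ σ := by by_contra hu; exact h' ⟨h.1, hu, h.2⟩
      rw [hM2, hM]
      obtain ⟨h0, h⟩ := h
      refine ⟨by grind, ?_⟩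
      rcases h with h | ⟨h1, h⟩
      · exact Or.inr ⟨by simp, Or.inr (L.down _ h _ (by grind))⟩
      · have : insert w σ = σ := by grind
        rw [this]; exact Or.inr ⟨h1, h⟩
    · intro σ h h' h2
      rw [hM2, hM] at h
      rw [hK] at h' h2
      apply h'
      exact ⟨h.1, by have := h2.2.1; grind, h.2⟩
  rw [e4, e3, ← e2, ← e1]

theorem link_link (Δ : SComplex) (v : ℕ) (σ : Finset ℕ) (hv : v ∉ σ) :
    (Δ.link {v}).link σ = Δ.link (insert v σ) := by
  apply ext_faces
  ext γ
  rw [mem_link, mem_link_singleton, mem_link, Finset.disjoint_insert_right]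
  have : insert v (γ ∪ σ) = γ ∪ insert v σ := by grind
  rw [this]
  constructor
  · rintro ⟨h1, h2, h3⟩; exact ⟨⟨by grind, h1⟩, h3⟩
  · rintro ⟨⟨h1, h2⟩, h3⟩; exact ⟨h2, by grind, h3⟩

theorem manifold_iff (F : Type*) [Field F] (Δ : SComplex) (d : ℕ) :
    Δ.IsHomologyManifold F d ↔ Δ.IsPure d ∧ ∀ τ ∈ Δ.faces, τ.Nonempty →
      (Δ.link τ).SameHomologyAsSphere F ((d : ℤ) - τ.card) := by
  unfold IsHomologyManifold
  refine and_congr_right fun _ => ?_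
  constructor
  · intro h τ hτ ⟨v, hv⟩
    have hv' : {v} ∈ Δ.faces := Δ.down _ hτ _ (by simpa using hv)
    have := (h v (mem_vertexSet.mpr hv')).2 (τ.erase v) (by
      rw [mem_link_singleton, Finset.insert_erase hv]; exact ⟨by simp, hτ⟩)
    rw [link_link _ _ _ (by simp), Finset.insert_erase hv] at this
    have hc : ((τ.erase v).card : ℤ) + 1 = τ.card := by exact_mod_cast Finset.card_erase_add_one hv
    convert this using 1
    omega
  · intro h v hv
    rw [mem_vertexSet] at hv
    refine ⟨⟨∅, by rw [mem_link_singleton]; simpa using hv⟩, ?_⟩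
    intro σ hσ
    rw [mem_link_singleton] at hσ
    have := h _ hσ.2 (by simp)
    rw [link_link _ _ _ hσ.1]
    rw [Finset.card_insert_of_notMem hσ.1] at this
    convert this using 1
    push_cast; ring

theorem sameHom_of_betti (F : Type*) [Field F] {A B : SComplex} {m : ℤ}
    (h : ∀ n, A.betti F n = B.betti F n) (hB : B.SameHomologyAsSphere F m) :
    A.SameHomologyAsSphere F m := by
  intro n; rw [h n]; exact hB n

/-- wrapper hiding a fact from automation -/
structure Hid (P : Prop) : Prop where
  o : P

set_option maxHeartbeats 1600000 in
theorem contr_manifold (F : Type*) [Field F] (Δ K : SComplex) (u p q c w : ℕ)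
    (hman : Δ.IsHomologyManifold F 4)
    (hup : u ≠ p) (huw : u ≠ w) (hpw : p ≠ w) (hqu : q ≠ u) (hqp : q ≠ p) (hqw : q ≠ w)
    (hcu : c ≠ u) (hcp : c ≠ p) (hcw : c ≠ w)
    (hw : ∀ σ ∈ Δ.faces, w ∉ σ)
    (hlc : ∀ σ, insert u σ ∈ Δ.faces → insert p σ ∈ Δ.faces → insert u (insert p σ) ∈ Δ.faces)
    (hq : ∀ σ, p ∉ σ → insert u σ ∈ Δ.faces → insert u (insert q σ) ∈ Δ.faces)
    (hc : ∀ σ, p ∉ σ → insert u σ ∈ Δ.faces → insert u (insert c σ) ∈ Δ.faces)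
    (hN : ∀ σ ∈ Δ.faces, p ∈ σ → q ∈ σ → c ∉ σ)
    (hK : ∀ σ, σ ∈ K.faces ↔ CP Δ u p w σ) : K.IsHomologyManifold F 4 := by
  rw [manifold_iff] at hman ⊢
  obtain ⟨⟨hp1, hp2⟩, hman⟩ := hman
  replace hw := Hid.mk hw
  replace hlc := Hid.mk hlc
  replace hq := Hid.mk hq
  replace hc := Hid.mk hc
  replace hN := Hid.mk hN
  replace hman := Hid.mk hman
  replace hp1 := Hid.mk hp1
  replace hp2 := Hid.mk hp2
  replace hK := Hid.mk hK
  refine ⟨⟨?_, ?_⟩, ?_⟩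
  · intro σ hσ
    rw [hK.o] at hσ
    obtain ⟨h1, h2, h | ⟨h3, h | h⟩⟩ := hσ
    · exact hp1.o _ h
    · have := hp1.o _ h
      rw [Finset.card_insert_of_notMem (by grind), Finset.card_erase_add_one h3] at this
      exact this
    · have := hp1.o _ h
      rw [Finset.card_insert_of_notMem (by grind), Finset.card_erase_add_one h3] at this
      exact this
  · -- purity
    have key : ∀ φ ∈ Δ.faces, φ.card = 5 → ∀ σ, u ∉ σ → p ∉ σ → σ.erase w ⊆ φ →
        (w ∈ σ → u ∈ φ ∨ p ∈ φ) → ∃ τ ∈ K.faces, σ ⊆ τ ∧ τ.card = 5 := by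
      intro φ hφ hcard σ h1 h2 hs hwσ
      have hwφ := hw.o φ hφ
      by_cases hu : u ∈ φ
      · by_cases hp : p ∈ φ
        · have hb : ∃ b, b ∉ φ ∧ b ≠ u ∧ b ≠ p ∧ b ≠ w ∧
              insert u (insert b (φ.erase p)) ∈ Δ.faces := by
            have hφ' : insert u (φ.erase p) ∈ Δ.faces := Δ.down _ hφ _ (by grind)
            by_cases hqφ : q ∈ φ
            · exact ⟨c, hN.o _ hφ hp hqφ, hcu, hcp, hcw, hc.o _ (by simp) hφ'⟩
            · exact ⟨q, hqφ, hqu, hqp, hqw, hq.o _ (by simp) hφ'⟩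
          obtain ⟨b, hb1, hb2, hb3, hb4, hb5⟩ := hb
          refine ⟨insert w (insert b ((φ.erase p).erase u)), ?_, ?_, ?_⟩
          · rw [hK.o]
            refine ⟨by grind, by grind, Or.inr ⟨by grind, Or.inl (Δ.down _ hb5 _ (by grind))⟩⟩
          · grind
          · rw [Finset.card_insert_of_notMem (by grind), Finset.card_insert_of_notMem (by grind),
              Finset.card_erase_of_mem (by grind), Finset.card_erase_of_mem hp, hcard]
        · refine ⟨insert w (φ.erase u), ?_, by grind, ?_⟩
          · rw [hK.o]
            refine ⟨by grind, by grind, Or.inr ⟨by grind, Or.inl (Δ.down _ hφ _ (by grind))⟩⟩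
          · rw [Finset.card_insert_of_notMem (by grind), Finset.card_erase_of_mem hu, hcard]
      · by_cases hp : p ∈ φ
        · refine ⟨insert w (φ.erase p), ?_, by grind, ?_⟩
          · rw [hK.o]
            refine ⟨by grind, by grind, Or.inr ⟨by grind, Or.inr (Δ.down _ hφ _ (by grind))⟩⟩
          · rw [Finset.card_insert_of_notMem (by grind), Finset.card_erase_of_mem hp, hcard]
        · refine ⟨φ, ?_, by grind, hcard⟩
          rw [hK.o]
          exact ⟨hu, hp, Or.inl hφ⟩
    intro σ hσ
    rw [hK.o] at hσ
    obtain ⟨h1, h2, h | ⟨h3, h | h⟩⟩ := hσ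
    · obtain ⟨φ, hφ, hs, hcard⟩ := hp2.o _ h
      exact key φ hφ hcard σ h1 h2 (by grind) (fun h' => absurd h' (hw.o _ h))
    · obtain ⟨φ, hφ, hs, hcard⟩ := hp2.o _ h
      exact key φ hφ hcard σ h1 h2 (by grind) (by grind)
    · obtain ⟨φ, hφ, hs, hcard⟩ := hp2.o _ h
      exact key φ hφ hcard σ h1 h2 (by grind) (by grind)
  · intro τ hτ hne
    have hτ' := (hK.o _).mp hτ
    obtain ⟨h1, h2, h3⟩ := hτ'
    by_cases hwτ : w ∈ τ
    swap
    · have hτΔ : τ ∈ Δ.faces := by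
        rcases h3 with h | h
        · exact h
        · exact absurd h.1 hwτ
      refine sameHom_of_betti F (fun n => ?_) (hman.o τ hτΔ hne)
      refine betti_contr F (Δ.link τ) (K.link τ) u p w huw hpw ?_ ?_ ?_ n
      · intro σ hσ; rw [mem_link] at hσ
        exact fun h => hw.o _ hσ.2 (Finset.mem_union_left _ h)
      · intro σ ha hb
        rw [mem_link] at ha hb ⊢
        rw [Finset.insert_union] at ha hb
        have := hlc.o _ ha.2 hb.2
        refine ⟨?_, ?_⟩
        · have := ha.1
          simp only [Finset.disjoint_insert_left] at this ⊢
          exact ⟨h1, h2, this.2⟩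
        · rw [Finset.insert_union, Finset.insert_union]; exact this
      · intro σ
        rw [mem_link, hK.o]
        simp only [CP, mem_link, Finset.mem_union, not_or, Finset.insert_union,
          Finset.disjoint_insert_left]
        have e : (σ ∪ τ).erase w = σ.erase w ∪ τ := by grind
        rw [e]
        have d : Disjoint (σ.erase w) τ ↔ Disjoint σ τ := by
          simp only [Finset.disjoint_left]; grind
        rw [d]
        tauto
    · set t := τ.erase w with ht
      have htu : u ∉ t := by grind
      have htp : p ∉ t := by grind
      have hτc : ∀ x, x ∉ t → (insert x t).card = τ.card := by
        intro x hx
        rw [Finset.card_insert_of_notMem hx, ht, Finset.card_erase_add_one hwτ]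
      replace hτc := Hid.mk hτc
      have h3' : insert u t ∈ Δ.faces ∨ insert p t ∈ Δ.faces := by
        rcases h3 with h | h
        · exact absurd hwτ (hw.o _ h)
        · exact h.2
      have hmemL : ∀ σ, σ ∈ (K.link τ).faces ↔ Disjoint σ τ ∧ u ∉ σ ∧ p ∉ σ ∧
          (insert u (σ ∪ t) ∈ Δ.faces ∨ insert p (σ ∪ t) ∈ Δ.faces) := by
        intro σ
        rw [mem_link, hK.o]
        simp only [CP, Finset.mem_union, not_or]
        constructor
        · rintro ⟨hd, ⟨a1, a2⟩, ⟨a3, a4⟩, a5⟩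
          have e : (σ ∪ τ).erase w = σ ∪ t := by
            have : w ∉ σ := fun h => (Finset.disjoint_left.mp hd h) hwτ
            grind
          rw [e] at a5
          refine ⟨hd, a1, a3, ?_⟩
          rcases a5 with h | h
          · exact absurd (Finset.mem_union_right _ hwτ) (hw.o _ h)
          · exact h.2
        · rintro ⟨hd, a1, a3, a5⟩
          have e : (σ ∪ τ).erase w = σ ∪ t := by
            have : w ∉ σ := fun h => (Finset.disjoint_left.mp hd h) hwτ
            grind
          rw [e]
          exact ⟨hd, ⟨a1, h1⟩, ⟨a3, h2⟩, Or.inr ⟨Or.inr hwτ, a5⟩⟩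
      replace hmemL := Hid.mk hmemL
      have hdis : ∀ σ, w ∉ σ → (Disjoint σ τ ↔ Disjoint σ t) := by
        intro σ hσ; simp only [Finset.disjoint_left]; grind
      replace hdis := Hid.mk hdis
      by_cases hpt : insert p t ∈ Δ.faces
      · have hB := hman.o _ hpt (by simp)
        rw [hτc.o p htp] at hB
        refine sameHom_of_betti F (fun n => ?_) hB
        by_cases hut : insert u t ∈ Δ.faces
        · -- both
          have hutp := hlc.o t hut hpt
          have hmemB : ∀ σ, σ ∈ (Δ.link (insert p t)).faces ↔
              Disjoint σ t ∧ p ∉ σ ∧ insert p (σ ∪ t) ∈ Δ.faces := by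
            intro σ
            rw [mem_link, Finset.disjoint_insert_right, Finset.union_insert]; tauto
          obtain ⟨M, hM⟩ : ∃ M : SComplex, ∀ σ, σ ∈ M.faces ↔ (Disjoint σ t ∧ p ∉ σ ∧
              (insert p (σ ∪ t) ∈ Δ.faces ∨ insert u (σ ∪ t) ∈ Δ.faces)) := by
            apply exists_ofPred Δ w
            · rintro σ ⟨a1, a2, a3⟩ ρ hρ
              refine ⟨Finset.disjoint_of_subset_left hρ a1, fun h => a2 (hρ h), ?_⟩
              rcases a3 with a3 | a3
              · exact Or.inl (Δ.down _ a3 _ (by grind))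
              · exact Or.inr (Δ.down _ a3 _ (by grind))
            · rintro σ ⟨a1, a2, a3 | a3⟩ <;> exact Δ.down _ a3 _ (by grind)
          have e1 : (Δ.link (insert p t)).betti F n = M.betti F n := by
            apply betti_toggle F _ M u
            · intro σ h
              rw [hmemB] at h; rw [hM]; exact ⟨h.1, h.2.1, Or.inl h.2.2⟩
            · intro σ h h'
              rw [hmemB] at h'; rw [hM] at h ⊢
              obtain ⟨a1, a2, a3 | a3⟩ := h
              · exact absurd ⟨a1, a2, a3⟩ h'
              · refine ⟨by simp [htu, a1], by grind, Or.inr (Δ.down _ a3 _ (by grind))⟩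
            · intro σ h h' h2
              rw [hmemB] at h' h2; rw [hM] at h
              obtain ⟨a1, a2, a3 | a3⟩ := h
              · exact absurd ⟨a1, a2, a3⟩ h'
              · apply h'
                refine ⟨a1, a2, ?_⟩
                have := hlc.o (σ.erase u ∪ t) (Δ.down _ a3 _ (by grind)) h2.2.2
                exact Δ.down _ this _ (by grind)
          have e2 : (K.link τ).betti F n = M.betti F n := by
            have hb : ∃ b, b ∉ t ∧ b ≠ u ∧ b ≠ p ∧ b ≠ w ∧
              ∀ σ, p ∉ σ → insert u σ ∈ Δ.faces → insert u (insert b σ) ∈ Δ.faces := by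
              by_cases hqt : q ∈ t
              · exact ⟨c, fun h => hN.o _ hpt (by simp) (by simp [hqt]) (by simp [h]), hcu, hcp, hcw, hc.o⟩
              · exact ⟨q, hqt, hqu, hqp, hqw, hq.o⟩
            obtain ⟨b, hb1, hb2, hb3, hb4, hb5⟩ := hb
            have hwf : ∀ σ ∈ M.faces, w ∉ σ := by
              intro σ h; rw [hM] at h
              obtain ⟨a1, a2, a3 | a3⟩ := h
              · have := hw.o _ a3; grind
              · have := hw.o _ a3; grind
            have hLM : ∀ σ, σ ∈ (K.link τ).faces ↔ σ ∈ M.faces ∧ u ∉ σ := by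
              intro σ
              constructor
              · intro h; rw [hmemL.o] at h
                have : w ∉ σ := fun h' => (Finset.disjoint_left.mp h.1 h') hwτ
                rw [hdis.o _ this] at h
                rw [hM]; tauto
              · rintro ⟨h, h'⟩
                have := hwf _ h
                rw [hM] at h
                rw [hmemL.o, hdis.o _ this]
                tauto
            apply betti_toggle F _ M b
            · intro σ h
              rw [hLM] at h; exact h.1
            · intro σ h h'
              rw [hLM] at h'
              have hu : u ∈ σ := by by_contra hu; exact h' ⟨h, hu⟩
              rw [hM] at h ⊢
              obtain ⟨a1, a2, a3⟩ := h
              refine ⟨by simp [hb1, a1], by grind, ?_⟩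
              have a4 : insert u (σ ∪ t) ∈ Δ.faces := by
                rcases a3 with a3 | a3
                · exact Δ.down _ a3 _ (by grind)
                · exact a3
              have := hb5 _ (by grind) a4
              exact Or.inr (Δ.down _ this _ (by grind))
            · intro σ h h' h2
              rw [hLM] at h' h2
              exact h' ⟨h, by have := h2.2; grind⟩
          rw [e2, e1]
        · congr 1
          apply ext_faces
          ext σ
          rw [hmemL.o, mem_link, Finset.disjoint_insert_right, Finset.union_insert]
          constructor
          · rintro ⟨a1, a2, a3, a4⟩
            have hwσ : w ∉ σ := fun h' => (Finset.disjoint_left.mp a1 h') hwτ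
            rw [hdis.o _ hwσ] at a1
            refine ⟨⟨a3, a1⟩, ?_⟩
            rcases a4 with a4 | a4
            · exact absurd (Δ.down _ a4 _ (by grind)) hut
            · exact a4
          · rintro ⟨⟨a3, a1⟩, a4⟩
            have hwσ : w ∉ σ := by have := hw.o _ a4; grind
            rw [hdis.o _ hwσ]
            refine ⟨a1, fun h => hut ?_, a3, Or.inr a4⟩
            exact Δ.down _ a4 _ (by grind)
      · have hut : insert u t ∈ Δ.faces := by tauto
        have hB := hman.o _ hut (by simp)
        rw [hτc.o u htu] at hB
        refine sameHom_of_betti F (fun n => ?_) hB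
        congr 1
        apply ext_faces
        ext σ
        rw [hmemL.o, mem_link, Finset.disjoint_insert_right, Finset.union_insert]
        constructor
        · rintro ⟨a1, a2, a3, a4⟩
          have hwσ : w ∉ σ := fun h' => (Finset.disjoint_left.mp a1 h') hwτ
          rw [hdis.o _ hwσ] at a1
          refine ⟨⟨a2, a1⟩, ?_⟩
          rcases a4 with a4 | a4
          · exact a4
          · exact absurd (Δ.down _ a4 _ (by grind)) hpt
        · rintro ⟨⟨a3, a1⟩, a4⟩
          have hwσ : w ∉ σ := by have := hw.o _ a4; grind
          rw [hdis.o _ hwσ]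
          refine ⟨a1, a3, fun h => hpt ?_, Or.inl a4⟩
          exact Δ.down _ a4 _ (by grind)

end SComplex

namespace SComplex

theorem mem_joinFaces {A B : Finset (Finset ℕ)} {σ : Finset ℕ} :
    σ ∈ joinFaces A B ↔ ∃ a ∈ A, ∃ b ∈ B, a ∪ b = σ := by
  simp only [joinFaces, Finset.mem_image, Finset.mem_product, Prod.exists]
  constructor
  · rintro ⟨a, b, ⟨h1, h2⟩, h3⟩; exact ⟨a, h1, b, h2, h3⟩
  · rintro ⟨a, h1, b, h2, h3⟩; exact ⟨a, b, ⟨h1, h2⟩, h3⟩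

theorem mem_bdryFaces {σ τ : Finset ℕ} : τ ∈ bdryFaces σ ↔ τ ≠ σ ∧ τ ⊆ σ := by
  simp [bdryFaces]

/-- combinatorial data of the vertex link -/
structure LinkData (Δ C : SComplex) (u p q c : ℕ) : Prop where
  pq : p ≠ q
  pc : p ≠ c
  qc : q ≠ c
  up : u ≠ p
  uq : u ≠ q
  uc : u ≠ c
  hp : {p} ∉ C.faces
  hq : {q} ∉ C.faces
  hc : {c} ∉ C.faces
  hu : {u} ∉ C.faces
  he : ∅ ∈ C.faces
  hL : ∀ σ, u ∉ σ → (insert u σ ∈ Δ.faces ↔ σ \ {p, q, c} ∈ C.faces ∧ ¬ {p, q, c} ⊆ σ)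
  hm : {p, q, c} ∉ Δ.faces

theorem linkData (Δ C : SComplex) (u p q c : ℕ) (he : ∅ ∈ C.faces)
    (hpqc : ({p, q, c} : Finset ℕ).card = 3)
    (hlk : (Δ.link {u}).faces = joinFaces C.faces (bdryFaces {p, q, c}))
    (hmiss : ({p, q, c} : Finset ℕ) ∉ Δ.faces) : LinkData Δ C u p q c := by
  have hlk' : ∀ a ∈ C.faces, ∀ b, b ⊆ ({p, q, c} : Finset ℕ) → b ≠ {p, q, c} →
      u ∉ a ∪ b ∧ insert u (a ∪ b) ∈ Δ.faces := by
    intro a ha b hb hb'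
    rw [← mem_link_singleton, hlk, mem_joinFaces]
    exact ⟨a, ha, b, mem_bdryFaces.mpr ⟨hb', hb⟩, rfl⟩
  have hpq : p ≠ q := by
    rintro rfl
    have := Finset.card_le_two (a := p) (b := c)
    simp at hpqc; omega
  have hpc : p ≠ c := by
    rintro rfl
    have := Finset.card_le_two (a := q) (b := p)
    simp at hpqc; omega
  have hqc : q ≠ c := by
    rintro rfl
    have := Finset.card_le_two (a := p) (b := q)
    simp at hpqc; omega
  have hp : {p} ∉ C.faces := by
    intro h
    have h1 := (hlk' _ h {q, c} (by grind) (fun h => by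
      have : p ∈ ({q, c} : Finset ℕ) := by rw [h]; simp
      simp at this; tauto)).2
    exact hmiss (Δ.down _ h1 _ (by grind))
  have hq : {q} ∉ C.faces := by
    intro h
    have h1 := (hlk' _ h {p, c} (by grind) (fun h => by
      have : q ∈ ({p, c} : Finset ℕ) := by rw [h]; simp
      simp at this; tauto)).2
    exact hmiss (Δ.down _ h1 _ (by grind))
  have hc : {c} ∉ C.faces := by
    intro h
    have h1 := (hlk' _ h {p, q} (by grind) (fun h => by
      have : c ∈ ({p, q} : Finset ℕ) := by rw [h]; simp
      simp at this; tauto)).2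
    exact hmiss (Δ.down _ h1 _ (by grind))
  have hu : {u} ∉ C.faces := by
    intro h
    have h1 := (hlk' _ h ∅ (by simp) (fun h => by
      have : p ∈ (∅ : Finset ℕ) := by rw [h]; simp
      simp at this)).1
    simp at h1
  have hsing : ∀ x ∈ ({p, q, c} : Finset ℕ), u ≠ x := by
    rintro x hx rfl
    have h1 := (hlk' _ he {u} (by simpa using hx) (fun h => by
      rw [← h] at hpqc; simp at hpqc)).1
    simp at h1
  refine ⟨hpq, hpc, hqc, hsing p (by simp), hsing q (by simp), hsing c (by simp),
    hp, hq, hc, hu, he, ?_, hmiss⟩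
  intro σ hσ
  have hC' : ∀ a ∈ C.faces, ∀ x ∈ a, x ∉ ({p, q, c} : Finset ℕ) := by
    intro a ha x hx hx'
    have hxC : {x} ∈ C.faces := C.down _ ha _ (by simpa using hx)
    simp only [Finset.mem_insert, Finset.mem_singleton] at hx'
    rcases hx' with rfl | rfl | rfl
    · exact hp hxC
    · exact hq hxC
    · exact hc hxC
  constructor
  · intro h
    have : σ ∈ (Δ.link {u}).faces := mem_link_singleton.mpr ⟨hσ, h⟩
    rw [hlk, mem_joinFaces] at this
    obtain ⟨a, ha, b, hb, rfl⟩ := this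
    rw [mem_bdryFaces] at hb
    refine ⟨C.down _ ha _ ?_, ?_⟩
    · intro x hx
      simp only [Finset.mem_sdiff, Finset.mem_union] at hx
      rcases hx.1 with h1 | h1
      · exact h1
      · exact absurd (hb.2 h1) hx.2
    · intro hs
      apply hb.1
      apply Finset.Subset.antisymm hb.2
      intro x hx
      rcases Finset.mem_union.mp (hs hx) with h1 | h1
      · exact absurd hx (hC' a ha x h1)
      · exact h1
  · rintro ⟨h1, h2⟩
    have := (hlk' _ h1 (σ ∩ {p, q, c}) Finset.inter_subset_right (fun h => h2 (by
      rw [← h]; exact Finset.inter_subset_left))).2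
    rwa [Finset.sdiff_union_inter] at this

theorem fVec_zero (Δ : SComplex) : Δ.fVec 0 = Δ.vertexSet.card := by
  unfold fVec
  rw [← Finset.card_image_of_injective Δ.vertexSet Finset.singleton_injective]
  congr 1
  ext σ
  simp only [Finset.mem_filter, Finset.mem_image, mem_vertexSet, zero_add, Finset.card_eq_one]
  constructor
  · rintro ⟨h, a, rfl⟩; exact ⟨a, h, rfl⟩
  · rintro ⟨a, h, rfl⟩; exact ⟨h, a, rfl⟩

namespace LinkData
variable {Δ C : SComplex} {u p q c : ℕ}

theorem lc (H : LinkData Δ C u p q c) (σ : Finset ℕ) (h1 : insert u σ ∈ Δ.faces)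
    (h2 : insert p σ ∈ Δ.faces) : insert u (insert p σ) ∈ Δ.faces := by
  by_cases hu : u ∈ σ
  · have : insert u (insert p σ) = insert p σ := by
      rw [Finset.insert_eq_of_mem]; simp [hu]
    rwa [this]
  · have hup := H.up
    have := (H.hL σ hu).mp h1
    rw [H.hL _ (by simp [hu, hup])]
    refine ⟨?_, ?_⟩
    · rw [Finset.insert_sdiff_of_mem _ (by simp)]; exact this.1
    · intro h
      exact H.hm (Δ.down _ h2 _ h)

theorem addq (H : LinkData Δ C u p q c) (σ : Finset ℕ) (hp : p ∉ σ)
    (h1 : insert u σ ∈ Δ.faces) : insert u (insert q σ) ∈ Δ.faces := by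
  have huq := H.uq
  have e : insert u (insert q σ) = insert u (insert q (σ.erase u)) := by
    ext x; simp only [Finset.mem_insert, Finset.mem_erase]; tauto
  have e1 : insert u σ = insert u (σ.erase u) := by
    ext x; simp only [Finset.mem_insert, Finset.mem_erase]; tauto
  rw [e1, H.hL _ (by simp)] at h1
  rw [e, H.hL _ (by simp [huq])]
  refine ⟨?_, ?_⟩
  · rw [Finset.insert_sdiff_of_mem _ (by simp)]; exact h1.1
  · intro h
    have := h (show p ∈ ({p, q, c} : Finset ℕ) by simp)
    have hpq := H.pq
    simp [hp, hpq] at this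

theorem addc (H : LinkData Δ C u p q c) (σ : Finset ℕ) (hp : p ∉ σ)
    (h1 : insert u σ ∈ Δ.faces) : insert u (insert c σ) ∈ Δ.faces := by
  have huc := H.uc
  have e : insert u (insert c σ) = insert u (insert c (σ.erase u)) := by
    ext x; simp only [Finset.mem_insert, Finset.mem_erase]; tauto
  have e1 : insert u σ = insert u (σ.erase u) := by
    ext x; simp only [Finset.mem_insert, Finset.mem_erase]; tauto
  rw [e1, H.hL _ (by simp)] at h1
  rw [e, H.hL _ (by simp [huc])]
  refine ⟨?_, ?_⟩
  · rw [Finset.insert_sdiff_of_mem _ (by simp)]; exact h1.1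
  · intro h
    have := h (show p ∈ ({p, q, c} : Finset ℕ) by simp)
    have hpc := H.pc
    simp [hp, hpc] at this

theorem nopqc (H : LinkData Δ C u p q c) (σ : Finset ℕ) (hσ : σ ∈ Δ.faces)
    (hp : p ∈ σ) (hq : q ∈ σ) : c ∉ σ := by
  intro hc
  apply H.hm
  apply Δ.down _ hσ
  intro x hx
  simp only [Finset.mem_insert, Finset.mem_singleton] at hx
  rcases hx with rfl | rfl | rfl <;> assumption

theorem hCm (H : LinkData Δ C u p q c) (σ : Finset ℕ) (hσ : σ ∈ C.faces) :
    u ∉ σ ∧ p ∉ σ ∧ q ∉ σ ∧ c ∉ σ := by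
  refine ⟨fun h => H.hu ?_, fun h => H.hp ?_, fun h => H.hq ?_, fun h => H.hc ?_⟩ <;>
  exact C.down _ hσ _ (by simpa using h)

theorem memD (H : LinkData Δ C u p q c) (σ : Finset ℕ) :
    (u ∉ σ ∧ p ∉ σ ∧ insert u σ ∈ Δ.faces) ↔ σ \ {q, c} ∈ C.faces := by
  have hup := H.up
  have huq := H.uq
  have huc := H.uc
  have hpq := H.pq
  have hpc := H.pc
  constructor
  · rintro ⟨h1, h2, h3⟩
    rw [H.hL _ h1] at h3
    exact C.down _ h3.1 _ (by
      intro x hx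
      simp only [Finset.mem_sdiff, Finset.mem_insert, Finset.mem_singleton, not_or] at hx ⊢
      exact ⟨hx.1, fun h => h2 (h ▸ hx.1), hx.2⟩)
  · intro h
    have := H.hCm _ h
    have h1 : u ∉ σ := fun h' => this.1 (by simp [h', huq, huc])
    have h2 : p ∉ σ := fun h' => this.2.1 (by simp [h', hpq, hpc])
    refine ⟨h1, h2, ?_⟩
    rw [H.hL _ h1]
    exact ⟨C.down _ h _ (Finset.sdiff_subset_sdiff subset_rfl (by simp)),
      fun h' => h2 (h' (by simp))⟩

theorem memS (H : LinkData Δ C u p q c) (σ : Finset ℕ) :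
    (u ∉ σ ∧ p ∉ σ ∧ insert u (insert p σ) ∈ Δ.faces) ↔
      σ \ {q, c} ∈ C.faces ∧ ¬ (q ∈ σ ∧ c ∈ σ) := by
  have hup := H.up
  rw [← H.memD]
  constructor
  · rintro ⟨h1, h2, h3⟩
    refine ⟨⟨h1, h2, Δ.down _ h3 _ (Finset.insert_subset_insert _ (Finset.subset_insert _ _))⟩, ?_⟩
    rintro ⟨h4, h5⟩
    exact H.nopqc _ h3 (by simp) (by simp [h4]) (by simp [h5])
  · rintro ⟨⟨h1, h2, h3⟩, h4⟩
    refine ⟨h1, h2, ?_⟩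
    rw [H.hL _ h1] at h3
    rw [H.hL _ (by simp [h1, hup])]
    refine ⟨by rw [Finset.insert_sdiff_of_mem _ (by simp)]; exact h3.1, fun h => h4 ?_⟩
    have a1 := h (show q ∈ ({p, q, c} : Finset ℕ) by simp)
    have a2 := h (show c ∈ ({p, q, c} : Finset ℕ) by simp)
    have hpq := H.pq
    have hpc := H.pc
    simp only [Finset.mem_insert, hpq.symm, hpc.symm, false_or] at a1 a2
    exact ⟨a1, a2⟩

theorem f0le (H : LinkData Δ C u p q c) (K : SComplex) (w : ℕ) (hw : ∀ σ ∈ Δ.faces, w ∉ σ)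
    (hu : {u} ∈ Δ.faces) (hwp : w ≠ p) (hwu : w ≠ u)
    (hK : ∀ σ, σ ∈ K.faces ↔ CP Δ u p w σ) :
    {w} ∈ K.faces ∧ Δ.fVec 0 ≤ K.fVec 0 + 1 := by
  have hwK : {w} ∈ K.faces := by
    rw [hK]
    refine ⟨by simp [hwu.symm], by simp [hwp.symm], Or.inr ⟨by simp, Or.inl (by simpa using hu)⟩⟩
  refine ⟨hwK, ?_⟩
  rw [fVec_zero, fVec_zero]
  have hs : Δ.vertexSet ⊆ {u, p} ∪ K.vertexSet.erase w := by
    intro x hx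
    rw [mem_vertexSet] at hx
    simp only [Finset.mem_union, Finset.mem_insert, Finset.mem_singleton, Finset.mem_erase,
      mem_vertexSet, hK]
    by_cases h1 : x = u
    · simp [h1]
    by_cases h2 : x = p
    · simp [h2]
    right
    refine ⟨fun h => hw _ hx (by simp [h]), by simp [Ne.symm h1], by simp [Ne.symm h2], Or.inl hx⟩
  have h1 := Finset.card_le_card hs
  have h2 := Finset.card_union_le {u, p} (K.vertexSet.erase w)
  have h3 := Finset.card_le_two (a := u) (b := p)
  have h4 := Finset.card_erase_add_one (mem_vertexSet.mpr hwK)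
  omega

theorem f1le (H : LinkData Δ C u p q c) (K : SComplex) (w : ℕ) (hw : ∀ σ ∈ Δ.faces, w ∉ σ)
    (hwp : w ≠ p) (hwu : w ≠ u)
    (hK : ∀ σ, σ ∈ K.faces ↔ CP Δ u p w σ) :
    K.fVec 1 + (C.vertexSet.card + 3) ≤ Δ.fVec 1 := by
  classical
  have hup := H.up
  have huq := H.uq
  have huc := H.uc
  have hpq := H.pq
  have hpc := H.pc
  have hqc := H.qc
  let W : Finset ℕ := insert u (insert q (insert c C.vertexSet))
  have hWc : W.card = C.vertexSet.card + 3 := by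
    have h1 : c ∉ C.vertexSet := by rw [mem_vertexSet]; exact H.hc
    have h2 : q ∉ insert c C.vertexSet := by
      rw [Finset.mem_insert, mem_vertexSet]; push Not; exact ⟨hqc, H.hq⟩
    have h3 : u ∉ insert q (insert c C.vertexSet) := by
      rw [Finset.mem_insert, Finset.mem_insert, mem_vertexSet]; push Not
      exact ⟨huq, huc, H.hu⟩
    simp only [W]
    rw [Finset.card_insert_of_notMem h3, Finset.card_insert_of_notMem h2,
      Finset.card_insert_of_notMem h1]
  have hWp : ∀ x ∈ W, x ≠ p := by
    intro x hx
    simp only [W, Finset.mem_insert, mem_vertexSet] at hx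
    rcases hx with rfl | rfl | rfl | hx
    · exact hup
    · exact hpq.symm
    · exact hpc.symm
    · rintro rfl; exact H.hp hx
  have hWf : ∀ x ∈ W, x ≠ u → ({u, p, x} : Finset ℕ) ∈ Δ.faces := by
    intro x hx hxu
    simp only [W, Finset.mem_insert, mem_vertexSet] at hx
    have key : ({x} : Finset ℕ) \ {q, c} ∈ C.faces ∧ ¬ (q ∈ ({x} : Finset ℕ) ∧ c ∈ ({x} : Finset ℕ)) := by
      refine ⟨?_, ?_⟩
      · rcases hx with rfl | rfl | rfl | hx
        · exact absurd rfl hxu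
        · rw [Finset.sdiff_eq_empty_iff_subset.mpr (by simp)]; exact H.he
        · rw [Finset.sdiff_eq_empty_iff_subset.mpr (by simp)]; exact H.he
        · exact C.down _ hx _ Finset.sdiff_subset
      · simp only [Finset.mem_singleton]
        rintro ⟨rfl, h⟩; exact hqc h.symm
    exact ((H.memS _).mpr key).2.2
  have hup' : ({p, u} : Finset ℕ) ∈ Δ.faces := by
    have := hWf q (by simp [W]) huq.symm
    exact Δ.down _ this _ (by intro x; simp; tauto)
  let T : Finset (Finset ℕ) := W.image fun v => {p, v}
  have hTc : T.card = C.vertexSet.card + 3 := by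
    rw [← hWc]
    apply Finset.card_image_of_injOn
    intro a ha b hb hab
    have ha' := hWp a ha
    have : a ∈ ({p, b} : Finset ℕ) := by
      have h : a ∈ ({p, a} : Finset ℕ) := by simp
      simp only at hab
      rwa [hab] at h
    simp only [Finset.mem_insert, Finset.mem_singleton, ha', false_or] at this
    exact this
  have hTs : T ⊆ Δ.faces.filter fun σ => σ.card = 1 + 1 := by
    intro σ hσ
    obtain ⟨x, hx, rfl⟩ := Finset.mem_image.mp hσ
    rw [Finset.mem_filter]
    refine ⟨?_, Finset.card_pair (hWp x hx).symm⟩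
    by_cases hxu : x = u
    · rw [hxu]; exact hup'
    · exact Δ.down _ (hWf x hx hxu) _ (by simp)
  let π : Finset ℕ → Finset ℕ := fun σ => σ.image fun x => if x = u ∨ x = p then w else x
  have hsub : (K.faces.filter fun σ => σ.card = 1 + 1) ⊆
      ((Δ.faces.filter fun σ => σ.card = 1 + 1) \ T).image π := by
    intro e he
    rw [Finset.mem_filter, hK] at he
    obtain ⟨⟨h1, h2, h3⟩, h4⟩ := he
    rw [Finset.mem_image]
    by_cases hwe : w ∈ e
    · obtain ⟨x, hx⟩ : ∃ x, e.erase w = {x} := by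
        rw [← Finset.card_eq_one, Finset.card_erase_of_mem hwe, h4]
      have hxe : x ∈ e ∧ x ≠ w := by
        have : x ∈ e.erase w := by rw [hx]; simp
        rw [Finset.mem_erase] at this; exact ⟨this.2, this.1⟩
      have hxu : x ≠ u := fun h => h1 (h ▸ hxe.1)
      have hxp : x ≠ p := fun h => h2 (h ▸ hxe.1)
      have he : e = {w, x} := by rw [← Finset.insert_erase hwe, hx]
      have h3' : ({u, x} : Finset ℕ) ∈ Δ.faces ∨ ({p, x} : Finset ℕ) ∈ Δ.faces := by
        rw [hx] at h3
        rcases h3 with h | h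
        · exact absurd hwe (hw _ h)
        · exact h.2
      by_cases hux : ({u, x} : Finset ℕ) ∈ Δ.faces
      · refine ⟨{u, x}, ?_, ?_⟩
        · rw [Finset.mem_sdiff, Finset.mem_filter]
          refine ⟨⟨hux, Finset.card_pair hxu.symm⟩, fun h => ?_⟩
          obtain ⟨y, hy, hy'⟩ := Finset.mem_image.mp h
          have : p ∈ ({u, x} : Finset ℕ) := by rw [← hy']; simp
          simp only [Finset.mem_insert, Finset.mem_singleton] at this
          rcases this with h | h
          · exact hup h.symm
          · exact hxp h.symm
        · simp [π, Finset.image_insert, hxu, hxp, he]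
      · have hpx := h3'.resolve_left hux
        refine ⟨{p, x}, ?_, ?_⟩
        · rw [Finset.mem_sdiff, Finset.mem_filter]
          refine ⟨⟨hpx, Finset.card_pair hxp.symm⟩, fun h => ?_⟩
          obtain ⟨y, hy, hy'⟩ := Finset.mem_image.mp h
          have : x ∈ ({p, y} : Finset ℕ) := by rw [hy']; simp
          simp only [Finset.mem_insert, Finset.mem_singleton] at this
          rcases this with h | h
          · exact hxp h
          · subst h
            exact hux (Δ.down _ (hWf x hy hxu) _ (by intro z; simp; tauto))
        · simp [π, Finset.image_insert, hxu, hxp, he]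
    · have h3' : e ∈ Δ.faces := h3.resolve_right fun h => hwe h.1
      refine ⟨e, ?_, ?_⟩
      · rw [Finset.mem_sdiff, Finset.mem_filter]
        refine ⟨⟨h3', h4⟩, fun h => ?_⟩
        obtain ⟨y, hy, hy'⟩ := Finset.mem_image.mp h
        apply h2
        rw [← hy']; simp
      · have : Set.EqOn (fun x => if x = u ∨ x = p then w else x) id e := by
          intro x hx
          have a1 : x ≠ u := fun h => h1 (h ▸ hx)
          have a2 : x ≠ p := fun h => h2 (h ▸ hx)
          simp [a1, a2]
        simp only [π]
        rw [Finset.image_congr this, Finset.image_id]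
  have hle := Finset.card_le_card hsub
  have hle2 := Finset.card_image_le (f := π) (s := (Δ.faces.filter fun σ => σ.card = 1 + 1) \ T)
  have hle3 := Finset.card_sdiff_add_card_eq_card hTs
  unfold fVec
  omega

theorem expansion (H : LinkData Δ C u p q c) (K : SComplex) (w : ℕ) (hw : ∀ σ ∈ Δ.faces, w ∉ σ)
    (hwp : w ≠ p) (hwu : w ≠ u) (hwK : {w} ∈ K.faces)
    (hK : ∀ σ, σ ∈ K.faces ↔ CP Δ u p w σ)
    (htop : ∀ D S : SComplex, (∀ σ, σ ∈ D.faces ↔ σ \ {q, c} ∈ C.faces) →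
      (∀ σ, σ ∈ S.faces ↔ σ \ {q, c} ∈ C.faces ∧ ¬ (q ∈ σ ∧ c ∈ σ)) →
      S.IsTriangulatedSphere 2 ∧ D.IsTriangulatedBall 3) : EdgeExpansion K Δ := by
  have hup := H.up
  obtain ⟨D1, hD1⟩ : ∃ D : SComplex, ∀ σ, σ ∈ D.faces ↔
      (u ∉ σ ∧ p ∉ σ ∧ insert u σ ∈ Δ.faces) := by
    apply exists_ofPred Δ w
    · rintro σ ⟨a, b, h⟩ τ hτ
      exact ⟨fun h' => a (hτ h'), fun h' => b (hτ h'),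
        Δ.down _ h _ (Finset.insert_subset_insert _ hτ)⟩
    · rintro σ ⟨a, b, h⟩
      exact Δ.down _ h _ ((Finset.erase_subset _ _).trans (Finset.subset_insert _ _))
  obtain ⟨D2, hD2⟩ : ∃ D : SComplex, ∀ σ, σ ∈ D.faces ↔
      (u ∉ σ ∧ p ∉ σ ∧ insert p σ ∈ Δ.faces) := by
    apply exists_ofPred Δ w
    · rintro σ ⟨a, b, h⟩ τ hτ
      exact ⟨fun h' => a (hτ h'), fun h' => b (hτ h'),
        Δ.down _ h _ (Finset.insert_subset_insert _ hτ)⟩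
    · rintro σ ⟨a, b, h⟩
      exact Δ.down _ h _ ((Finset.erase_subset _ _).trans (Finset.subset_insert _ _))
  obtain ⟨S, hS⟩ : ∃ D : SComplex, ∀ σ, σ ∈ D.faces ↔
      (u ∉ σ ∧ p ∉ σ ∧ insert u (insert p σ) ∈ Δ.faces) := by
    apply exists_ofPred Δ w
    · rintro σ ⟨a, b, h⟩ τ hτ
      exact ⟨fun h' => a (hτ h'), fun h' => b (hτ h'),
        Δ.down _ h _ (Finset.insert_subset_insert _ (Finset.insert_subset_insert _ hτ))⟩
    · rintro σ ⟨a, b, h⟩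
      exact Δ.down _ h _ ((Finset.erase_subset _ _).trans
        ((Finset.subset_insert _ _).trans (Finset.subset_insert _ _)))
  have ht := htop D1 S (fun σ => (hD1 σ).trans (H.memD σ)) (fun σ => (hS σ).trans (H.memS σ))
  refine ⟨w, u, p, S, D1, D2, hwK, hup, ?_, ?_, ht.1, ht.2, ?_, ?_, ?_⟩
  · rw [mem_vertexSet, hK]; intro h; exact h.1 (by simp)
  · rw [mem_vertexSet, hK]; intro h; exact h.2.1 (by simp)
  · ext σ
    rw [Finset.mem_union, hD1, hD2, mem_link_singleton, hK]
    simp only [CP, Finset.mem_insert, not_or]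
    constructor
    · intro h
      have hwσ : w ∉ σ := by
        rcases h with h | h
        · exact fun h' => hw _ h.2.2 (by simp [h'])
        · exact fun h' => hw _ h.2.2 (by simp [h'])
      rw [Finset.erase_insert hwσ]
      refine ⟨hwσ, ⟨hwu.symm, by tauto⟩, ⟨hwp.symm, by tauto⟩, Or.inr ⟨by simp, by tauto⟩⟩
    · rintro ⟨hwσ, ⟨_, a1⟩, ⟨_, a2⟩, h⟩
      rw [Finset.erase_insert hwσ] at h
      rcases h with h | ⟨_, h⟩
      · exact absurd (Finset.mem_insert_self _ _) (hw _ h)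
      · tauto
  · ext σ
    rw [Finset.mem_inter, hD1, hD2, hS]
    constructor
    · rintro ⟨⟨a, b, h⟩, _, _, h'⟩
      exact ⟨a, b, H.lc _ h h'⟩
    · rintro ⟨a, b, h⟩
      exact ⟨⟨a, b, Δ.down _ h _ (Finset.insert_subset_insert _ (Finset.subset_insert _ _))⟩,
        a, b, Δ.down _ h _ (Finset.subset_insert _ _)⟩
  · ext σ
    simp only [Finset.mem_union, Finset.mem_filter, mem_joinFaces, Finset.mem_powerset, hS, hD1,
      hD2, hK]
    constructor
    · intro h
      have hwσ := hw _ h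
      by_cases hu : u ∈ σ
      · by_cases hp : p ∈ σ
        · refine Or.inl (Or.inl (Or.inr ⟨{u, p}, subset_rfl, (σ.erase u).erase p,
            ⟨by simp, by simp, ?_⟩, ?_⟩))
          · have : insert u (insert p ((σ.erase u).erase p)) = σ := by
              rw [Finset.insert_erase (by simp [hp, hup.symm]), Finset.insert_erase hu]
            rwa [this]
          · rw [Finset.insert_union, Finset.singleton_union,
              Finset.insert_erase (by simp [hp, hup.symm]), Finset.insert_erase hu]
        · refine Or.inl (Or.inr ⟨{u}, subset_rfl, σ.erase u, ⟨by simp, by simp [hp], ?_⟩, ?_⟩)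
          · rwa [Finset.insert_erase hu]
          · rw [Finset.singleton_union, Finset.insert_erase hu]
      · by_cases hp : p ∈ σ
        · refine Or.inr ⟨{p}, subset_rfl, σ.erase p, ⟨by simp [hu], by simp, ?_⟩, ?_⟩
          · rwa [Finset.insert_erase hp]
          · rw [Finset.singleton_union, Finset.insert_erase hp]
        · exact Or.inl (Or.inl (Or.inl ⟨⟨hu, hp, Or.inl h⟩, hwσ⟩))
    · rintro (((⟨⟨h1, h2, h3⟩, h4⟩ | ⟨a, ha, b, ⟨_, _, hb⟩, rfl⟩) | ⟨a, ha, b, ⟨_, _, hb⟩, rfl⟩) |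
        ⟨a, ha, b, ⟨_, _, hb⟩, rfl⟩)
      · exact h3.resolve_right fun h => h4 h.1
      · refine Δ.down _ hb _ ?_
        refine (Finset.union_subset_union_left ha).trans ?_
        rw [Finset.insert_union, Finset.singleton_union]
      · exact Δ.down _ hb _ (Finset.union_subset_union_left ha)
      · exact Δ.down _ hb _ (Finset.union_subset_union_left ha)

end LinkData

theorem main_of_top (F : Type*) [Field F] (Δ : SComplex) (m : ℤ)
    (hman : Δ.IsHomologyManifold F 4) (hg2 : Δ.g2 4 = m)
    (u p q c : ℕ) (n : ℕ) (C : SComplex)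
    (hu : ({u} : Finset ℕ) ∈ Δ.faces)
    (hcard : C.vertexSet.card = n) (H : LinkData Δ C u p q c)
    (htop : ∀ D S : SComplex, (∀ σ, σ ∈ D.faces ↔ σ \ {q, c} ∈ C.faces) →
      (∀ σ, σ ∈ S.faces ↔ σ \ {q, c} ∈ C.faces ∧ ¬ (q ∈ σ ∧ c ∈ σ)) →
      S.IsTriangulatedSphere 2 ∧ D.IsTriangulatedBall 3) :
    ∃ Δ' : SComplex, Δ'.IsHomologyManifold F 4 ∧
      Δ'.g2 4 ≤ m - ((n : ℤ) - 2) ∧ EdgeExpansion Δ' Δ := by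
  obtain ⟨w, hw⟩ := Infinite.exists_notMem_finset (Δ.vertexSet ∪ {u, p, q, c})
  simp only [Finset.mem_union, Finset.mem_insert, Finset.mem_singleton, not_or] at hw
  obtain ⟨hwV, hwu, hwp, hwq, hwc⟩ := hw
  have hw : ∀ σ ∈ Δ.faces, w ∉ σ := by
    intro σ hσ h
    exact hwV (subset_vertexSet hσ h)
  obtain ⟨K, hK⟩ := exists_contr Δ u p w
  obtain ⟨hwK, hf0⟩ := H.f0le K w hw hu hwp hwu hK
  have hf1 := H.f1le K w hw hwp hwu hK
  refine ⟨K, ?_, ?_, H.expansion K w hw hwp hwu hwK hK htop⟩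
  · exact contr_manifold F Δ K u p q c w hman H.up (Ne.symm hwu) (Ne.symm hwp) H.uq.symm H.pq.symm
      (Ne.symm hwq) H.uc.symm H.pc.symm (Ne.symm hwc) hw H.lc H.addq H.addc H.nopqc hK
  · rw [hcard] at hf1
    rw [← hg2]
    unfold g2
    push_cast
    omega

end SComplex

namespace SComplex

theorem cycle_enum (C : SComplex) (n : ℕ) (hC : IsCycle C n) :
    ∃ N : ℕ, 3 ≤ N ∧ ∃ v : ℕ → ℕ, (∀ i < N, ∀ j < N, v i = v j → i = j) ∧ v N = v 0 ∧
      ∀ σ, σ ∈ C.faces ↔ ∃ i < N, σ ⊆ {v i, v (i + 1)} := by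
  classical
  obtain ⟨hn, hcard, hpure, ⟨hne, hconn⟩, hdeg⟩ := hC
  let V := {x // x ∈ C.vertexSet}
  let G : SimpleGraph V :=
    { Adj := fun x y => C.EdgeRel x y
      symm := ⟨by
        rintro x y ⟨h1, h2⟩
        exact ⟨h1.symm, by rwa [Finset.pair_comm]⟩⟩
      loopless := ⟨fun x h => h.1 rfl⟩ }
  have hnb : ∀ x : V, (G.neighborSet x).ncard = 2 := by
    intro x
    rw [← hdeg x x.2, ← Set.ncard_image_of_injective _ Subtype.val_injective,
      ← Set.ncard_coe_finset]
    congr 1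
    ext y
    simp only [Set.mem_image, SimpleGraph.mem_neighborSet, Finset.mem_coe, mem_vertexSet,
      mem_link_singleton]
    constructor
    · rintro ⟨y, h, rfl⟩
      exact ⟨by simpa using h.1, h.2⟩
    · rintro ⟨h1, h2⟩
      have : y ∈ C.vertexSet := mem_vertexSet.mpr (C.down _ h2 _ (by simp))
      exact ⟨⟨y, this⟩, ⟨by simpa using h1, h2⟩, rfl⟩
  have hcyc : G.IsCycles := fun x _ => hnb x
  obtain ⟨x0, hx0⟩ := hne
  have hreach : ∀ y, Relation.ReflTransGen C.EdgeRel x0 y → ∃ hy : y ∈ C.vertexSet,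
      G.Reachable ⟨x0, hx0⟩ ⟨y, hy⟩ := by
    intro y h
    induction h with
    | refl => exact ⟨hx0, SimpleGraph.Reachable.refl _⟩
    | tail h1 h2 ih =>
      obtain ⟨hb, ih⟩ := ih
      refine ⟨mem_vertexSet.mpr (C.down _ h2.2 _ (by simp)), ih.trans ?_⟩
      exact SimpleGraph.Adj.reachable (G := G) h2
  obtain ⟨p, hp, hsupp⟩ := hcyc.exists_cycle_toSubgraph_verts_eq_connectedComponentSupp
    (c := G.connectedComponentMk ⟨x0, hx0⟩) (v := ⟨x0, hx0⟩) rfl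
    (Set.nonempty_of_ncard_ne_zero (by rw [hnb]; simp))
  have hall : ∀ y : V, y ∈ p.toSubgraph.verts := by
    intro y
    rw [hsupp, SimpleGraph.ConnectedComponent.mem_supp_iff, SimpleGraph.ConnectedComponent.eq]
    obtain ⟨_, h⟩ := hreach y (hconn _ hx0 _ y.2)
    exact h.symm
  have hlen := hp.three_le_length
  refine ⟨p.length, hlen, fun i => (p.getVert i : ℕ), ?_, ?_, ?_⟩
  · intro i hi j hj h
    exact hp.getVert_injOn' (by simp; omega) (by simp; omega) (Subtype.val_injective h)
  · simp
  · intro σ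
    constructor
    · intro hσ
      obtain ⟨τ, hτ, hs, hc⟩ := hpure.2 σ hσ
      obtain ⟨x, y, hxy, rfl⟩ := Finset.card_eq_two.mp hc
      have hx : x ∈ C.vertexSet := mem_vertexSet.mpr (C.down _ hτ _ (by simp))
      have hy : y ∈ C.vertexSet := mem_vertexSet.mpr (C.down _ hτ _ (by simp))
      have hadj : G.Adj ⟨x, hx⟩ ⟨y, hy⟩ := ⟨hxy, hτ⟩
      rw [← hp.adj_toSubgraph_iff_of_isCycles hcyc (hall _),
        SimpleGraph.Walk.toSubgraph_adj_iff] at hadj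
      obtain ⟨i, hi, hil⟩ := hadj
      refine ⟨i, hil, hs.trans ?_⟩
      rw [Sym2.eq_iff] at hi
      rcases hi with ⟨h1, h2⟩ | ⟨h1, h2⟩
      · simp [h1, h2]
      · simp only [h1, h2]; rw [Finset.pair_comm]
    · rintro ⟨i, hi, hs⟩
      have := p.adj_getVert_succ hi
      exact C.down _ this.2 _ hs

end SComplex

namespace SComplex

/-- piecewise linear loop through the vertices `v 0, ..., v N` -/
def loop (v : ℕ → ℕ) (N : ℕ) (t : ℝ) (x : ℕ) : ℝ :=
  ∑ i ∈ Finset.range (N + 1), if v i = x then max 0 (1 - |t - i|) else 0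

theorem loop_continuous (v : ℕ → ℕ) (N : ℕ) : Continuous (loop v N) := by
  refine continuous_pi fun x => ?_
  unfold loop
  refine continuous_finsetSum _ fun i _ => ?_
  split_ifs <;> fun_prop

theorem loop_apply (v : ℕ → ℕ) (N k : ℕ) (hk : k < N) (s : ℝ) (h0 : 0 ≤ s) (h1 : s ≤ 1) (x : ℕ) :
    loop v N (k + s) x = (if v k = x then 1 - s else 0) + (if v (k + 1) = x then s else 0) := by
  unfold loop
  have hs : ({k, k + 1} : Finset ℕ) ⊆ Finset.range (N + 1) := by
    intro i; simp only [Finset.mem_insert, Finset.mem_singleton, Finset.mem_range]; omega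
  rw [← Finset.sum_subset hs]
  · rw [Finset.sum_pair (by omega)]
    have e1 : max 0 (1 - |(k : ℝ) + s - k|) = 1 - s := by
      rw [add_sub_cancel_left, abs_of_nonneg h0, max_eq_right (by linarith)]
    have e2 : max 0 (1 - |(k : ℝ) + s - ((k + 1 : ℕ) : ℝ)|) = s := by
      push_cast
      rw [abs_of_nonpos (by linarith), max_eq_right (by linarith)]; ring
    rw [e1, e2]
  · intro i _ hi
    simp only [Finset.mem_insert, Finset.mem_singleton, not_or] at hi
    have : 1 ≤ |(k : ℝ) + s - i| := by
      rcases lt_or_gt_of_ne hi.1 with h | h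
      · have : (i : ℝ) + 1 ≤ k := by exact_mod_cast h
        rw [le_abs]; left; linarith
      · have : (k : ℝ) + 2 ≤ i := by exact_mod_cast (by omega : k + 2 ≤ i)
        rw [le_abs]; right; linarith
    rw [max_eq_left (by linarith)]; simp

theorem exists_floor (N : ℕ) (t : ℝ) (h0 : 0 ≤ t) (h1 : t < N) :
    ∃ k : ℕ, k < N ∧ ∃ s : ℝ, 0 ≤ s ∧ s < 1 ∧ t = k + s := by
  refine ⟨⌊t⌋₊, (Nat.floor_lt h0).mpr h1, t - ⌊t⌋₊, ?_, ?_, by ring⟩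
  · linarith [Nat.floor_le h0]
  · linarith [Nat.lt_floor_add_one t]

theorem loop_inj (v : ℕ → ℕ) (N : ℕ) (hN : 3 ≤ N)
    (hinj : ∀ i < N, ∀ j < N, v i = v j → i = j) (hv : v N = v 0)
    (t t' : ℝ) (h0 : 0 ≤ t) (h1 : t < N) (h0' : 0 ≤ t') (h1' : t' < N)
    (h : loop v N t = loop v N t') : t = t' := by
  obtain ⟨k, hk, s, hs0, hs1, rfl⟩ := exists_floor N t h0 h1
  obtain ⟨k', hk', s', hs0', hs1', rfl⟩ := exists_floor N t' h0' h1'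
  have hsucc : ∀ i < N, ∀ j < N, v i = v (j + 1) → i = if j + 1 = N then 0 else j + 1 := by
    intro i hi j hj hij
    split_ifs with hjN
    · rw [hjN, hv] at hij; exact hinj _ hi _ (by omega) hij
    · exact hinj _ hi _ (by omega) hij
  have hne : ∀ i < N, v i ≠ v (i + 1) := by
    intro i hi hij
    have := hsucc i hi i hi hij
    split_ifs at this <;> omega
  have hx : ∀ x, _ := fun x => congrFun h x
  have a1 := hx (v k)
  have a2 := hx (v k')
  rw [loop_apply v N k hk s hs0 hs1.le, loop_apply v N k' hk' s' hs0' hs1'.le] at a1 a2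
  rw [if_pos rfl, if_neg (hne k hk).symm] at a1
  rw [if_pos rfl, if_neg (hne k' hk').symm] at a2
  by_cases hkk : k = k'
  · subst hkk
    rw [if_pos rfl, if_neg (hne k hk).symm] at a1
    linarith
  · exfalso
    have hvk : v k ≠ v k' := fun h => hkk (hinj _ hk _ hk' h)
    rw [if_neg hvk.symm] at a1
    rw [if_neg hvk] at a2
    have b1 : v (k' + 1) = v k := by
      by_contra hh; rw [if_neg hh] at a1; linarith
    have b2 : v (k + 1) = v k' := by
      by_contra hh; rw [if_neg hh] at a2; linarith
    have c1 := hsucc k hk k' hk' b1.symm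
    have c2 := hsucc k' hk' k hk b2.symm
    split_ifs at c1 c2 <;> omega

theorem loop_real (C : SComplex) (v : ℕ → ℕ) (N : ℕ) (hN : 3 ≤ N)
    (hinj : ∀ i < N, ∀ j < N, v i = v j → i = j) (hv : v N = v 0)
    (hC : ∀ σ, σ ∈ C.faces ↔ ∃ i < N, σ ⊆ {v i, v (i + 1)}) (f : ℕ → ℝ) :
    f ∈ C.realization ↔ ∃ t : ℝ, 0 ≤ t ∧ t < N ∧ f = loop v N t := by
  have hne : ∀ i < N, v i ≠ v (i + 1) := by
    intro i hi hij
    by_cases h : i + 1 = N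
    · rw [h, hv] at hij; have := hinj _ hi _ (by omega) hij; omega
    · have := hinj _ hi _ (by omega) hij; omega
  constructor
  · rintro ⟨σ, hσ, h1, h2, h3⟩
    obtain ⟨i, hi, hs⟩ := (hC σ).mp hσ
    have hsum : f (v i) + f (v (i + 1)) = 1 := by
      rw [← h3, ← Finset.sum_pair (hne i hi)]
      symm
      exact Finset.sum_subset hs fun x _ hx => h1 x hx
    have hz : ∀ x, x ≠ v i → x ≠ v (i + 1) → f x = 0 := by
      intro x hx1 hx2
      apply h1
      intro hx
      have := hs hx
      simp [hx1, hx2] at this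
    have key : f = loop v N (i + f (v (i + 1))) := by
      ext x
      rw [loop_apply v N i hi _ (h2 _) (by linarith [h2 (v i)])]
      have := hne i hi
      by_cases hx1 : v i = x
      · subst hx1
        rw [if_pos rfl, if_neg this.symm]; linarith
      · by_cases hx2 : v (i + 1) = x
        · subst hx2
          rw [if_pos rfl, if_neg hx1]; linarith
        · rw [if_neg hx1, if_neg hx2, hz x (Ne.symm hx1) (Ne.symm hx2)]; ring
    have hiN : (i : ℝ) + 1 ≤ N := by exact_mod_cast hi
    by_cases hlt : (i : ℝ) + f (v (i + 1)) < N
    · exact ⟨_, by have := h2 (v (i + 1)); positivity, hlt, key⟩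
    · have h4 : f (v (i + 1)) ≤ 1 := by linarith [h2 (v i)]
      have h5 : f (v (i + 1)) = 1 := by linarith
      have h6 : i + 1 = N := by
        have : (N : ℝ) ≤ ((i + 1 : ℕ) : ℝ) := by push_cast; linarith
        have : N ≤ i + 1 := by exact_mod_cast this
        omega
      refine ⟨0, le_rfl, by positivity, ?_⟩
      rw [key]
      ext x
      rw [loop_apply v N i hi _ (h2 _) h4, h5, h6, hv]
      have := loop_apply v N 0 (by omega) 0 le_rfl zero_le_one x
      simp only [Nat.cast_zero, add_zero] at this
      rw [this]
      simp
  · rintro ⟨t, h0, h1, rfl⟩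
    obtain ⟨k, hk, s, hs0, hs1, rfl⟩ := exists_floor N t h0 h1
    refine ⟨{v k, v (k + 1)}, (hC _).mpr ⟨k, hk, subset_rfl⟩, ?_, ?_, ?_⟩
    · intro x hx
      simp only [Finset.mem_insert, Finset.mem_singleton, not_or] at hx
      rw [loop_apply v N k hk s hs0 hs1.le, if_neg (Ne.symm hx.1), if_neg (Ne.symm hx.2)]; simp
    · intro x
      rw [loop_apply v N k hk s hs0 hs1.le]
      have : 0 ≤ 1 - s := by linarith
      split_ifs <;> linarith
    · rw [Finset.sum_pair (hne k hk), loop_apply v N k hk s hs0 hs1.le,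
        loop_apply v N k hk s hs0 hs1.le, if_pos rfl, if_pos rfl, if_neg (hne k hk).symm,
        if_neg (hne k hk)]
      ring

theorem exists_circle (C : SComplex) (n : ℕ) (hC : IsCycle C n) :
    ∃ G : Real.Angle → ℕ → ℝ, Continuous G ∧ Function.Injective G ∧
      ∀ f, f ∈ C.realization ↔ ∃ θ, f = G θ := by
  obtain ⟨N, hN, v, hinj, hv, hF⟩ := cycle_enum C n hC
  have hreal := loop_real C v N hN hinj hv hF
  have hpi : (0 : ℝ) < 2 * Real.pi := by positivity
  have hNp : (0 : ℝ) < N := by positivity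
  have : Fact ((0 : ℝ) < 2 * Real.pi) := ⟨hpi⟩
  let h : ℝ → ℕ → ℝ := fun s => loop v N (s * (N / (2 * Real.pi)))
  have hr : 0 < N / (2 * Real.pi) := by positivity
  have hlt : ∀ s, s < 2 * Real.pi → s * (N / (2 * Real.pi)) < N := by
    intro s hs
    calc _ < (2 * Real.pi) * (N / (2 * Real.pi)) := by gcongr
      _ = N := by field_simp
  have hcont : Continuous h := (loop_continuous v N).comp (by fun_prop)
  have h0 : h 0 = h (2 * Real.pi) := by
    simp only [h]
    rw [zero_mul, mul_div_cancel₀ _ hpi.ne']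
    ext x
    have e1 := loop_apply v N 0 (by omega) 0 le_rfl zero_le_one x
    have e2 := loop_apply v N (N - 1) (by omega) 1 zero_le_one le_rfl x
    rw [Nat.sub_add_cancel (by omega), Nat.cast_sub (by omega)] at e2
    simp only [Nat.cast_zero, add_zero] at e1
    rw [Nat.cast_one, sub_add_cancel] at e2
    rw [e1, e2, hv]; simp
  have hcoe : ∀ s ∈ Set.Ico (0 : ℝ) (2 * Real.pi),
      AddCircle.liftIco (2 * Real.pi) 0 h (s : AddCircle (2 * Real.pi)) = h s := by
    intro s hs
    exact AddCircle.liftIco_zero_coe_apply hs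
  have hsurj : ∀ θ : AddCircle (2 * Real.pi), ∃ s ∈ Set.Ico (0 : ℝ) (2 * Real.pi), (s : AddCircle (2 * Real.pi)) = θ := by
    intro θ
    have := AddCircle.coe_image_Ico_eq (2 * Real.pi) 0
    rw [zero_add] at this
    have h' : θ ∈ (Set.univ : Set (AddCircle (2 * Real.pi))) := trivial
    rw [← this] at h'
    exact h'
  refine ⟨AddCircle.liftIco (2 * Real.pi) 0 h, ?_, ?_, ?_⟩
  · exact AddCircle.liftIco_zero_continuous h0 hcont.continuousOn
  · intro a b hab
    obtain ⟨s, hs, rfl⟩ := hsurj a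
    obtain ⟨s', hs', rfl⟩ := hsurj b
    rw [hcoe s hs, hcoe s' hs'] at hab
    have := loop_inj v N hN hinj hv _ _ (mul_nonneg hs.1 hr.le) (hlt _ hs.2)
      (mul_nonneg hs'.1 hr.le) (hlt _ hs'.2) hab
    rw [mul_right_cancel₀ hr.ne' this]
  · intro f
    rw [hreal]
    constructor
    · rintro ⟨t, ht0, ht1, rfl⟩
      have hs : t / (N / (2 * Real.pi)) ∈ Set.Ico (0 : ℝ) (2 * Real.pi) := by
        refine ⟨by positivity, ?_⟩
        rw [div_lt_iff₀ hr, mul_div_cancel₀ _ hpi.ne']; exact ht1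
      refine ⟨((t / (N / (2 * Real.pi)) : ℝ) : AddCircle (2 * Real.pi)), ?_⟩
      rw [hcoe _ hs]
      simp only [h]
      rw [div_mul_cancel₀ _ hr.ne']
    · rintro ⟨θ, rfl⟩
      obtain ⟨s, hs, rfl⟩ := hsurj θ
      rw [hcoe s hs]
      exact ⟨_, mul_nonneg hs.1 hr.le, hlt _ hs.2, rfl⟩

end SComplex

namespace SComplex

/-- point of the join with barycentric coordinates `a`, `b` at `q`, `c` -/
def jpt (G : ℕ → ℝ) (q c : ℕ) (a b : ℝ) : ℕ → ℝ := fun x =>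
  (1 - a - b) * G x + (if x = q then a else 0) + (if x = c then b else 0)

theorem jpt_mem (X C : SComplex) (q c : ℕ) (α T : Finset ℕ)
    (hαT : α ∪ T ∈ X.faces) (G : ℕ → ℝ) (h1 : ∀ v, v ∉ α → G v = 0) (h2 : ∀ v, 0 ≤ G v)
    (h3 : ∑ v ∈ α, G v = 1) (a b : ℝ) (ha : 0 ≤ a) (hb : 0 ≤ b) (hab : a + b ≤ 1)
    (hqT : a ≠ 0 → q ∈ T) (hcT : b ≠ 0 → c ∈ T) : jpt G q c a b ∈ X.realization := by
  have hr : 0 ≤ 1 - a - b := by linarith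
  refine ⟨α ∪ T, hαT, ?_, ?_, ?_⟩
  · intro x hx
    rw [Finset.mem_union, not_or] at hx
    unfold jpt
    rw [h1 x hx.1]
    have e1 : (if x = q then a else 0) = 0 := by
      split_ifs with h
      · by_contra h'; exact hx.2 (h ▸ hqT h')
      · rfl
    have e2 : (if x = c then b else 0) = 0 := by
      split_ifs with h
      · by_contra h'; exact hx.2 (h ▸ hcT h')
      · rfl
    rw [e1, e2]; ring
  · intro x
    unfold jpt
    have := mul_nonneg hr (h2 x)
    split_ifs <;> linarith
  · unfold jpt
    rw [Finset.sum_add_distrib, Finset.sum_add_distrib, ← Finset.mul_sum,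
      ← Finset.sum_subset (Finset.subset_union_left) (fun x _ hx => h1 x hx), h3,
      Finset.sum_ite_eq', Finset.sum_ite_eq']
    have e1 : (if q ∈ α ∪ T then a else 0) = a := by
      split_ifs with h
      · rfl
      · by_contra h'; exact h (Finset.mem_union_right _ (hqT (Ne.symm h')))
    have e2 : (if c ∈ α ∪ T then b else 0) = b := by
      split_ifs with h
      · rfl
      · by_contra h'; exact h (Finset.mem_union_right _ (hcT (Ne.symm h')))
    rw [e1, e2]; ring

theorem exists_jpt (C : SComplex) (q c : ℕ) (hqc : q ≠ c) (g0 : ℕ → ℝ) (hg0 : g0 ∈ C.realization)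
    (hz : ∀ g ∈ C.realization, g q = 0 ∧ g c = 0)
    (σ : Finset ℕ) (hσ : σ \ {q, c} ∈ C.faces) (f : ℕ → ℝ) (h1 : ∀ v, v ∉ σ → f v = 0)
    (h2 : ∀ v, 0 ≤ f v) (h3 : ∑ v ∈ σ, f v = 1) :
    f q + f c ≤ 1 ∧ ∃ g ∈ C.realization, f = jpt g q c (f q) (f c) := by
  have hsum : ∑ v ∈ σ \ {q, c}, f v = 1 - f q - f c := by
    have e1 : ∑ v ∈ σ ∪ {q, c}, f v = 1 := by
      rw [← h3]; symm
      exact Finset.sum_subset Finset.subset_union_left fun x _ hx => h1 x hx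
    have e2 := Finset.sum_sdiff (f := f) (Finset.subset_union_right (s₁ := σ) (s₂ := {q, c}))
    rw [Finset.union_sdiff_right, e1, Finset.sum_pair hqc] at e2
    linarith
  have hr : 0 ≤ ∑ v ∈ σ \ {q, c}, f v := Finset.sum_nonneg fun v _ => h2 v
  refine ⟨by linarith, ?_⟩
  by_cases hr0 : 1 - f q - f c = 0
  · refine ⟨g0, hg0, ?_⟩
    ext x
    unfold jpt
    rw [hr0]
    by_cases hxq : x = q
    · subst hxq; rw [if_pos rfl, if_neg hqc]; ring
    by_cases hxc : x = c
    · subst hxc; rw [if_pos rfl, if_neg hqc.symm]; ring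
    rw [if_neg hxq, if_neg hxc]
    have : f x = 0 := by
      by_cases hx : x ∈ σ
      · rw [hr0, Finset.sum_eq_zero_iff_of_nonneg fun v _ => h2 v] at hsum
        exact hsum x (by simp [hx, hxq, hxc])
      · exact h1 x hx
    rw [this]; ring
  · have hg : (fun x => if x ∈ σ \ {q, c} then f x / (1 - f q - f c) else 0) ∈ C.realization := by
      refine ⟨_, hσ, fun v hv => if_neg hv, fun v => ?_, ?_⟩
      · have : 0 ≤ 1 - f q - f c := by linarith
        have := h2 v
        beta_reduce
        split_ifs <;> positivity
      · rw [Finset.sum_congr rfl fun x hx => if_pos hx, ← Finset.sum_div, hsum, div_self hr0]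
    refine ⟨_, hg, ?_⟩
    ext x
    unfold jpt
    by_cases hxq : x = q
    · subst hxq; simp [hqc]
    by_cases hxc : x = c
    · subst hxc; simp [hqc.symm]
    rw [if_neg hxq, if_neg hxc]
    beta_reduce
    by_cases hx : x ∈ σ
    · rw [if_pos (by simp [hx, hxq, hxc])]; field_simp; ring
    · rw [if_neg (by simp [hx]), h1 x hx]; ring

theorem realD (C D : SComplex) (q c : ℕ) (hqc : q ≠ c) (g0 : ℕ → ℝ) (hg0 : g0 ∈ C.realization)
    (hz : ∀ g ∈ C.realization, g q = 0 ∧ g c = 0)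
    (hD : ∀ σ, σ ∈ D.faces ↔ σ \ {q, c} ∈ C.faces) (f : ℕ → ℝ) :
    f ∈ D.realization ↔ ∃ g ∈ C.realization, ∃ a b : ℝ, 0 ≤ a ∧ 0 ≤ b ∧ a + b ≤ 1 ∧
      f = jpt g q c a b := by
  constructor
  · rintro ⟨σ, hσ, h1, h2, h3⟩
    obtain ⟨h4, g, hg, h5⟩ := exists_jpt C q c hqc g0 hg0 hz σ ((hD σ).mp hσ) f h1 h2 h3
    exact ⟨g, hg, f q, f c, h2 _, h2 _, h4, h5⟩
  · rintro ⟨g, ⟨α, hα, h1, h2, h3⟩, a, b, ha, hb, hab, rfl⟩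
    refine jpt_mem D C q c α {q, c} ((hD _).mpr (C.down _ hα _ ?_)) g h1 h2 h3 a b ha hb hab
      (by simp) (by simp)
    rw [Finset.union_sdiff_right]; exact Finset.sdiff_subset

theorem realS (C S : SComplex) (q c : ℕ) (hqc : q ≠ c) (g0 : ℕ → ℝ) (hg0 : g0 ∈ C.realization)
    (hz : ∀ g ∈ C.realization, g q = 0 ∧ g c = 0) (hqC : {q} ∉ C.faces) (hcC : {c} ∉ C.faces)
    (hS : ∀ σ, σ ∈ S.faces ↔ σ \ {q, c} ∈ C.faces ∧ ¬ (q ∈ σ ∧ c ∈ σ)) (f : ℕ → ℝ) :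
    f ∈ S.realization ↔ ∃ g ∈ C.realization, ∃ a b : ℝ, 0 ≤ a ∧ 0 ≤ b ∧ a + b ≤ 1 ∧ a * b = 0 ∧
      f = jpt g q c a b := by
  constructor
  · rintro ⟨σ, hσ, h1, h2, h3⟩
    have hσ' := (hS σ).mp hσ
    obtain ⟨h4, g, hg, h5⟩ := exists_jpt C q c hqc g0 hg0 hz σ hσ'.1 f h1 h2 h3
    refine ⟨g, hg, f q, f c, h2 _, h2 _, h4, ?_, h5⟩
    by_contra h
    exact hσ'.2 ⟨by by_contra hh; simp [h1 _ hh] at h, by by_contra hh; simp [h1 _ hh] at h⟩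
  · rintro ⟨g, ⟨α, hα, h1, h2, h3⟩, a, b, ha, hb, hab, hab0, rfl⟩
    have hqα : q ∉ α := fun h => hqC (C.down _ hα _ (by simpa using h))
    have hcα : c ∉ α := fun h => hcC (C.down _ hα _ (by simpa using h))
    rcases mul_eq_zero.mp hab0 with h0 | h0
    · refine jpt_mem S C q c α {c} ((hS _).mpr ⟨C.down _ hα _ ?_, ?_⟩) g h1 h2 h3 a b ha hb hab
        (fun h => absurd h0 h) (by simp)
      · intro x; simp only [Finset.mem_sdiff, Finset.mem_union, Finset.mem_insert,
          Finset.mem_singleton]; tauto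
      · simp [hqα, hqc]
    · refine jpt_mem S C q c α {q} ((hS _).mpr ⟨C.down _ hα _ ?_, ?_⟩) g h1 h2 h3 a b ha hb hab
        (by simp) (fun h => absurd h0 h)
      · intro x; simp only [Finset.mem_sdiff, Finset.mem_union, Finset.mem_insert,
          Finset.mem_singleton]; tauto
      · simp [hcα, hqc.symm]

theorem homeo_of_bijOn {E : Type*} [TopologicalSpace E] (Φ : E → ℕ → ℝ) (s : Set E)
    (T : Set (ℕ → ℝ)) (hs : IsCompact s) (hc : Continuous Φ) (hb : Set.BijOn Φ s T) :
    Nonempty (↥T ≃ₜ ↥s) := by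
  have : CompactSpace s := isCompact_iff_compactSpace.mp hs
  have hcont : Continuous (hb.equiv Φ) :=
    Continuous.subtype_mk (hc.comp continuous_subtype_val) _
  exact ⟨(hcont.homeoOfEquivCompactToT2).symm⟩

/-- complex coordinate of a point in 3-space -/
def zc (x : EuclideanSpace ℝ (Fin 3)) : ℂ := ⟨x 0, x 1⟩

/-- height of the ball above the complex coordinate -/
def hgt (x : EuclideanSpace ℝ (Fin 3)) : ℝ := √(1 - ‖zc x‖ ^ 2)

/-- parametrisation of the join -/
def Phi (G : Real.Angle → ℕ → ℝ) (q c : ℕ) (x : EuclideanSpace ℝ (Fin 3)) : ℕ → ℝ := fun i =>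
  ‖zc x‖ ^ 2 * G (Complex.arg (zc x) : Real.Angle) i +
    (if i = q then (1 - ‖zc x‖ ^ 2 + x 2 * hgt x) / 2 else 0) +
    (if i = c then (1 - ‖zc x‖ ^ 2 - x 2 * hgt x) / 2 else 0)

theorem continuous_zc : Continuous zc := by
  have : zc = fun x => (x 0 : ℂ) + (x 1 : ℂ) * Complex.I := by
    ext x
    simp [zc, Complex.mk_eq_add_mul_I]
  rw [this]
  fun_prop

theorem continuous_hgt : Continuous hgt := by
  unfold hgt
  have := continuous_zc
  fun_prop

theorem continuous_Phi (G : Real.Angle → ℕ → ℝ) (q c : ℕ) (hG : Continuous G)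
    (h0 : ∀ θ i, 0 ≤ G θ i) (h1 : ∀ θ i, G θ i ≤ 1) : Continuous (Phi G q c) := by
  refine continuous_pi fun i => ?_
  have hz := continuous_zc
  have hh := continuous_hgt
  have key : Continuous fun z : ℂ => ‖z‖ ^ 2 * G (Complex.arg z : Real.Angle) i := by
    rw [continuous_iff_continuousAt]
    intro z
    by_cases hz : z = 0
    · subst hz
      have : Filter.Tendsto (fun z : ℂ => ‖z‖ ^ 2) (nhds 0) (nhds 0) := by
        have : Continuous fun z : ℂ => ‖z‖ ^ 2 := by fun_prop
        simpa using this.tendsto 0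
      unfold ContinuousAt
      simp only [norm_zero, ne_eq, OfNat.ofNat_ne_zero, not_false_eq_true, zero_pow, zero_mul]
      refine squeeze_zero (fun z => mul_nonneg (by positivity) (h0 _ _)) (fun z => ?_) this
      exact mul_le_of_le_one_right (by positivity) (h1 _ _)
    · have a1 := Complex.continuousAt_arg_coe_angle hz
      have a2 : Continuous fun θ => G θ i := (continuous_apply i).comp hG
      have a3 := a2.continuousAt.comp a1
      exact ContinuousAt.mul (by fun_prop) a3
  have key' := key.comp hz
  unfold Phi
  refine Continuous.add (Continuous.add key' ?_) ?_
  · split_ifs <;> fun_prop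
  · split_ifs <;> fun_prop

theorem norm_sq3 (x : EuclideanSpace ℝ (Fin 3)) : ‖x‖ ^ 2 = ‖zc x‖ ^ 2 + x 2 ^ 2 := by
  rw [EuclideanSpace.norm_sq_eq, Fin.sum_univ_three, ← Complex.normSq_eq_norm_sq]
  simp [zc, Complex.normSq_apply]
  ring

theorem Phi_eq (G : Real.Angle → ℕ → ℝ) (q c : ℕ) (x : EuclideanSpace ℝ (Fin 3))
    (hx : ‖zc x‖ ^ 2 ≤ 1) :
    Phi G q c x = jpt (G (Complex.arg (zc x) : Real.Angle)) q c (hgt x * (hgt x + x 2) / 2)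
      (hgt x * (hgt x - x 2) / 2) := by
  have hh : hgt x ^ 2 = 1 - ‖zc x‖ ^ 2 := Real.sq_sqrt (by linarith)
  ext i
  unfold Phi jpt
  have e1 : (1 - ‖zc x‖ ^ 2 + x 2 * hgt x) / 2 = hgt x * (hgt x + x 2) / 2 := by
    rw [← hh]; ring
  have e2 : (1 - ‖zc x‖ ^ 2 - x 2 * hgt x) / 2 = hgt x * (hgt x - x 2) / 2 := by
    rw [← hh]; ring
  have e3 : 1 - hgt x * (hgt x + x 2) / 2 - hgt x * (hgt x - x 2) / 2 = ‖zc x‖ ^ 2 := by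
    linear_combination -hh
  rw [e1, e2, e3]

theorem ball_facts (x : EuclideanSpace ℝ (Fin 3)) (hx : ‖x‖ ≤ 1) :
    ‖zc x‖ ^ 2 ≤ 1 ∧ 0 ≤ hgt x ∧ hgt x ^ 2 = 1 - ‖zc x‖ ^ 2 ∧ x 2 ^ 2 ≤ hgt x ^ 2 ∧
      |x 2| ≤ hgt x := by
  have h1 : ‖x‖ ^ 2 ≤ 1 := by nlinarith [norm_nonneg x]
  rw [norm_sq3] at h1
  have h2 : ‖zc x‖ ^ 2 ≤ 1 := by nlinarith [sq_nonneg (x 2)]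
  have hh : hgt x ^ 2 = 1 - ‖zc x‖ ^ 2 := Real.sq_sqrt (by linarith)
  have h0 : 0 ≤ hgt x := Real.sqrt_nonneg _
  have h3 : x 2 ^ 2 ≤ hgt x ^ 2 := by linarith
  exact ⟨h2, h0, hh, h3, abs_le_of_sq_le_sq h3 h0⟩

theorem jpt_q (g : ℕ → ℝ) (q c : ℕ) (hqc : q ≠ c) (hg : g q = 0) (a b : ℝ) :
    jpt g q c a b q = a := by simp [jpt, hg, hqc]

theorem jpt_c (g : ℕ → ℝ) (q c : ℕ) (hqc : q ≠ c) (hg : g c = 0) (a b : ℝ) :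
    jpt g q c a b c = b := by simp [jpt, hg, hqc.symm]

theorem ext3 (x y : EuclideanSpace ℝ (Fin 3)) (h1 : zc x = zc y) (h2 : x 2 = y 2) : x = y := by
  have a := congrArg Complex.re h1
  have b := congrArg Complex.im h1
  simp only [zc] at a b
  ext i
  fin_cases i
  · exact a
  · exact b
  · exact h2

theorem topo (C : SComplex) (n : ℕ) (hC : IsCycle C n) (q c : ℕ) (hqc : q ≠ c)
    (hqC : {q} ∉ C.faces) (hcC : {c} ∉ C.faces) (D S : SComplex)
    (hD : ∀ σ, σ ∈ D.faces ↔ σ \ {q, c} ∈ C.faces)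
    (hS : ∀ σ, σ ∈ S.faces ↔ σ \ {q, c} ∈ C.faces ∧ ¬ (q ∈ σ ∧ c ∈ σ)) :
    S.IsTriangulatedSphere 2 ∧ D.IsTriangulatedBall 3 := by
  obtain ⟨G, hGc, hGi, hGr⟩ := exists_circle C n hC
  have hz : ∀ g ∈ C.realization, g q = 0 ∧ g c = 0 := by
    rintro g ⟨α, hα, h1, h2, h3⟩
    exact ⟨h1 _ fun h => hqC (C.down _ hα _ (by simpa using h)),
      h1 _ fun h => hcC (C.down _ hα _ (by simpa using h))⟩
  have hGm : ∀ θ, G θ ∈ C.realization := fun θ => (hGr _).mpr ⟨θ, rfl⟩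
  have hGq : ∀ θ, G θ q = 0 := fun θ => (hz _ (hGm θ)).1
  have hGcc : ∀ θ, G θ c = 0 := fun θ => (hz _ (hGm θ)).2
  have hG0 : ∀ θ i, 0 ≤ G θ i := by
    intro θ i
    obtain ⟨α, hα, h1, h2, h3⟩ := hGm θ
    exact h2 i
  have hG1 : ∀ θ i, G θ i ≤ 1 := by
    intro θ i
    obtain ⟨α, hα, h1, h2, h3⟩ := hGm θ
    by_cases hi : i ∈ α
    · rw [← h3]; exact Finset.single_le_sum (fun v _ => h2 v) hi
    · rw [h1 i hi]; exact zero_le_one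
  have hcont := continuous_Phi G q c hGc hG0 hG1
  have hRD := realD C D q c hqc (G 0) (hGm 0) hz hD
  have hRS := realS C S q c hqc (G 0) (hGm 0) hz hqC hcC hS
  -- injectivity on the ball
  have hinj : Set.InjOn (Phi G q c) (Metric.closedBall 0 1) := by
    intro x hx y hy hxy
    rw [mem_closedBall_zero_iff] at hx hy
    obtain ⟨x1, x2, x3, x4, x5⟩ := ball_facts x hx
    obtain ⟨y1, y2, y3, y4, y5⟩ := ball_facts y hy
    have hxy' := hxy
    rw [Phi_eq G q c x x1, Phi_eq G q c y y1] at hxy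
    have eq := congrFun hxy q
    have ec := congrFun hxy c
    rw [jpt_q _ _ _ hqc (hGq _), jpt_q _ _ _ hqc (hGq _)] at eq
    rw [jpt_c _ _ _ hqc (hGcc _), jpt_c _ _ _ hqc (hGcc _)] at ec
    have hh2 : hgt x ^ 2 = hgt y ^ 2 := by linear_combination eq + ec
    have hh : hgt x = hgt y := (sq_eq_sq₀ x2 y2).mp hh2
    have ht : hgt x * x 2 = hgt x * y 2 := by rw [← hh] at eq ec; linear_combination eq - ec
    have hn2 : ‖zc x‖ ^ 2 = ‖zc y‖ ^ 2 := by linarith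
    have hn : ‖zc x‖ = ‖zc y‖ := (sq_eq_sq₀ (norm_nonneg _) (norm_nonneg _)).mp hn2
    apply ext3
    · by_cases h0 : zc x = 0
      · rw [h0, norm_zero] at hn
        rw [h0, norm_eq_zero.mp hn.symm]
      · have hpos : ‖zc x‖ ^ 2 ≠ 0 := pow_ne_zero _ (norm_ne_zero_iff.mpr h0)
        have hGG : G (Complex.arg (zc x) : Real.Angle) = G (Complex.arg (zc y) : Real.Angle) := by
          ext i
          by_cases hiq : i = q
          · rw [hiq, hGq, hGq]
          by_cases hic : i = c
          · rw [hic, hGcc, hGcc]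
          have := congrFun hxy' i
          simp only [Phi, if_neg hiq, if_neg hic, add_zero] at this
          rw [← hn2] at this
          exact mul_left_cancel₀ hpos this
        have harg := Complex.arg_coe_angle_eq_iff.mp (hGi hGG)
        exact Complex.ext_norm_arg hn harg
    · by_cases h0 : hgt x = 0
      · rw [← hh] at y5
        rw [h0] at x5 y5
        rw [abs_nonpos_iff.mp x5, abs_nonpos_iff.mp y5]
      · exact mul_left_cancel₀ h0 ht
  -- images
  have hsurj : ∀ g ∈ C.realization, ∀ a b : ℝ, 0 ≤ a → 0 ≤ b → a + b ≤ 1 →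
      ∃ x : EuclideanSpace ℝ (Fin 3), ‖x‖ ≤ 1 ∧ (a * b = 0 → ‖x‖ = 1) ∧
        Phi G q c x = jpt g q c a b := by
    intro g hg a b ha hb hab
    obtain ⟨θ, rfl⟩ := (hGr g).mp hg
    obtain ⟨φ, rfl⟩ : ∃ φ : ℝ, (φ : Real.Angle) = θ := Real.Angle.induction_on θ fun x => ⟨x, rfl⟩
    let r := √(1 - a - b)
    have hr0 : 0 ≤ r := Real.sqrt_nonneg _
    have hr2 : r ^ 2 = 1 - a - b := Real.sq_sqrt (by linarith)
    let h := √(a + b)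
    have hh0 : 0 ≤ h := Real.sqrt_nonneg _
    have hh2 : h ^ 2 = a + b := Real.sq_sqrt (by linarith)
    have hth : ((a - b) / h) * h = a - b := by
      by_cases h0 : h = 0
      · have : a + b = 0 := by rw [← hh2, h0]; ring
        rw [h0]
        have h1 : a = 0 := by linarith
        have h2 : b = 0 := by linarith
        simp [h1, h2]
      · exact div_mul_cancel₀ _ h0
    let z : ℂ := r * Complex.exp (φ * Complex.I)
    have hzn : ‖z‖ = r := by
      simp [z, Complex.norm_exp_ofReal_mul_I, abs_of_nonneg hr0]
    have hzarg : r ≠ 0 → (Complex.arg z : Real.Angle) = φ := by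
      intro hr
      have hr' : 0 < r := lt_of_le_of_ne hr0 (Ne.symm hr)
      simp only [z]
      rw [Complex.arg_real_mul _ hr']
      rw [Complex.exp_mul_I]
      have hang := Complex.arg_cos_add_sin_mul_I_coe_angle (φ : Real.Angle)
      rw [Real.Angle.cos_coe, Real.Angle.sin_coe, Complex.ofReal_cos, Complex.ofReal_sin] at hang
      exact hang
    let x : EuclideanSpace ℝ (Fin 3) := !₂[z.re, z.im, (a - b) / h]
    have hxz : zc x = z := by apply Complex.ext <;> simp [zc, x]
    have hxt : x 2 = (a - b) / h := by simp [x]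
    have hxh : hgt x = h := by
      simp only [hgt, hxz, hzn, hr2, h]; congr 1; ring
    have hxn : ‖x‖ ^ 2 = r ^ 2 + ((a - b) / h) ^ 2 := by rw [norm_sq3, hxz, hzn, hxt]
    have hid : h ^ 2 * (1 - ‖x‖ ^ 2) = 4 * (a * b) := by
      rw [hxn]
      have : h ^ 2 * (1 - (r ^ 2 + ((a - b) / h) ^ 2)) = h ^ 2 * (1 - r ^ 2) - (((a - b) / h) * h) ^ 2 := by
        ring
      rw [this, hth, hr2, hh2]; ring
    have hcase : h = 0 → ‖x‖ ^ 2 = 1 := by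
      intro h0
      rw [hxn, h0, div_zero, hr2]
      have : a + b = 0 := by rw [← hh2, h0]; ring
      linarith
    have hPhi : Phi G q c x = jpt (G φ) q c a b := by
      have hx1 : ‖zc x‖ ^ 2 ≤ 1 := by rw [hxz, hzn, hr2]; linarith
      ext i
      unfold Phi jpt
      rw [hxz, hzn, hxh, hxt, hth, hr2]
      have e1 : (1 - (1 - a - b) + (a - b)) / 2 = a := by ring
      have e2 : (1 - (1 - a - b) - (a - b)) / 2 = b := by ring
      rw [e1, e2]
      by_cases hr : r = 0
      · have : 1 - a - b = 0 := by rw [← hr2, hr]; ring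
        rw [this]; ring
      · rw [hzarg hr]
    have hsq1 : ‖x‖ ^ 2 ≤ 1 := by
      by_cases h0 : h = 0
      · exact (hcase h0).le
      · have hp : 0 < h ^ 2 := by positivity
        by_contra hcon
        have : h ^ 2 * (1 - ‖x‖ ^ 2) < 0 := mul_neg_of_pos_of_neg hp (by linarith)
        nlinarith [mul_nonneg ha hb]
    refine ⟨x, ?_, ?_, hPhi⟩
    · exact (sq_le_one_iff₀ (norm_nonneg x)).mp hsq1
    · intro h0
      have : ‖x‖ ^ 2 = 1 := by
        by_cases hh : h = 0
        · exact hcase hh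
        · rw [h0, mul_zero] at hid
          have := (mul_eq_zero.mp hid).resolve_left (pow_ne_zero _ hh)
          linarith
      nlinarith [norm_nonneg x]
  have hmap : ∀ x : EuclideanSpace ℝ (Fin 3), ‖x‖ ≤ 1 →
      0 ≤ hgt x * (hgt x + x 2) / 2 ∧ 0 ≤ hgt x * (hgt x - x 2) / 2 ∧
      hgt x * (hgt x + x 2) / 2 + hgt x * (hgt x - x 2) / 2 ≤ 1 ∧
      (‖x‖ = 1 → (hgt x * (hgt x + x 2) / 2) * (hgt x * (hgt x - x 2) / 2) = 0) := by
    intro x hx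
    obtain ⟨x1, x2, x3, x4, x5⟩ := ball_facts x hx
    have := abs_le.mp x5
    refine ⟨?_, ?_, ?_, ?_⟩
    · have : 0 ≤ hgt x + x 2 := by linarith
      positivity
    · have : 0 ≤ hgt x - x 2 := by linarith
      positivity
    · nlinarith [sq_nonneg ‖zc x‖]
    · intro h1
      have hn := norm_sq3 x
      rw [h1] at hn
      have : hgt x ^ 2 - x 2 ^ 2 = 0 := by linarith
      linear_combination (hgt x ^ 2 / 4) * this
  constructor
  · refine homeo_of_bijOn (Phi G q c) (Metric.sphere (0 : EuclideanSpace ℝ (Fin 3)) 1) _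
      (isCompact_sphere _ _) hcont ⟨?_, hinj.mono Metric.sphere_subset_closedBall, ?_⟩
    · intro x hx
      rw [mem_sphere_zero_iff_norm] at hx
      obtain ⟨m1, m2, m3, m4⟩ := hmap x hx.le
      rw [hRS]
      exact ⟨_, hGm _, _, _, m1, m2, m3, m4 hx, Phi_eq G q c x (ball_facts x hx.le).1⟩
    · intro f hf
      obtain ⟨g, hg, a, b, ha, hb, hab, hab0, rfl⟩ := (hRS f).mp hf
      obtain ⟨x, h1, h2, h3⟩ := hsurj g hg a b ha hb hab
      exact ⟨x, by rw [mem_sphere_zero_iff_norm]; exact h2 hab0, h3⟩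
  · refine homeo_of_bijOn (Phi G q c) (Metric.closedBall (0 : EuclideanSpace ℝ (Fin 3)) 1) _
      (isCompact_closedBall _ _) hcont ⟨?_, hinj, ?_⟩
    · intro x hx
      rw [mem_closedBall_zero_iff] at hx
      obtain ⟨m1, m2, m3, m4⟩ := hmap x hx
      rw [hRD]
      exact ⟨_, hGm _, _, _, m1, m2, m3, Phi_eq G q c x (ball_facts x hx).1⟩
    · intro f hf
      obtain ⟨g, hg, a, b, ha, hb, hab, rfl⟩ := (hRD f).mp hf
      obtain ⟨x, h1, h2, h3⟩ := hsurj g hg a b ha hb hab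
      exact ⟨x, by rw [mem_closedBall_zero_iff]; exact h1, h3⟩

end SComplex


open SComplex in
/-- Let `Δ` be an `F`-homology 4-manifold with `g₂(Δ) = m` and `u`
a vertex with `lk_Δ u = C ⋆ ∂(pqc)`, where `C` is an `n`-cycle and `pqc` a
2-simplex. If `pqc ∉ Δ`, then `Δ` is obtained by an edge expansion from an
`F`-homology 4-manifold with `g₂ ≤ m - (n - 2)`. -/
theorem statement7 (F : Type*) [Field F] (Δ : SComplex) (m : ℤ)
    (hman : Δ.IsHomologyManifold F 4) (hg2 : Δ.g2 4 = m)
    (u p q c : ℕ) (n : ℕ) (C : SComplex)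
    (hu : ({u} : Finset ℕ) ∈ Δ.faces)
    (hC : IsCycle C n) (hpqc : ({p, q, c} : Finset ℕ).card = 3)
    (hlk : (Δ.link {u}).faces = joinFaces C.faces (bdryFaces {p, q, c}))
    (hmiss : ({p, q, c} : Finset ℕ) ∉ Δ.faces) :
    ∃ Δ' : SComplex, Δ'.IsHomologyManifold F 4 ∧
      Δ'.g2 4 ≤ m - ((n : ℤ) - 2) ∧ EdgeExpansion Δ' Δ := by
  have he : ∅ ∈ C.faces := by
    obtain ⟨x, hx⟩ := hC.2.2.2.1.1
    exact C.down _ (mem_vertexSet.mp hx) _ (by simp)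
  have H := linkData Δ C u p q c he hpqc hlk hmiss
  exact main_of_top F Δ m hman hg2 u p q c n C hu hC.2.1 H
    (fun D S hD hS => topo C n hC q c H.qc H.hq H.hc D S hD hS)
end
end
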